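/- arXiv:1809.07919 — 3 statements merged into one kernel-verified Lean document; each statement's English description precedes it below -/
import Mathlib

section
/- Let $\Omega$ be a bounded open set in $\mathbb{R}^n$, and let $u\in C^2(\Omega)$ and $f\in C(\Omega)$ satisfy the Poisson equation $\Delta u=f$ on $\Omega$. Then for every $\alpha\in(0,1)$ there is a constant $C=C(n,\alpha)$ depending only on $n$ and $\alpha$ such that for every $\mu\in(0,1]$: $[u]^*_{1,\alpha;\Omega}\leq C\,(\mu^{-1-\alpha}\sup_{\Omega}|u|+\mu^{1-\alpha}|f|^{(2)}_{0;\Omega})$. -/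
open Metric Set

/-- The Laplacian of `u : ℝⁿ → ℝ`, as the sum of the second derivatives
in the coordinate directions, computed via real Fréchet derivatives. -/
noncomputable def lapl (n : ℕ) (u : EuclideanSpace ℝ (Fin n) → ℝ)
    (x : EuclideanSpace ℝ (Fin n)) : ℝ :=
  ∑ i : Fin n,
    (fderiv ℝ (fun w => fderiv ℝ u w (EuclideanSpace.single i (1 : ℝ))) x)
      (EuclideanSpace.single i (1 : ℝ))

open Filter Topology InnerProductSpace Module

section SecondDerivative

variable {E : Type*} [NormedAddCommGroup E] [InnerProductSpace ℝ E]

/-- The necessary second order condition at a local maximum of a function of one variable. -/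
theorem IsLocalMax.second_deriv_nonpos {g g' : ℝ → ℝ} {t c : ℝ} (hmax : IsLocalMax g t)
    (hg : ∀ᶠ s in 𝓝 t, HasDerivAt g (g' s) s) (hg' : HasDerivAt g' c t) : c ≤ 0 := by
  by_contra! hc
  have h0 : g' t = 0 := hmax.hasDerivAt_eq_zero hg.self_of_nhds
  set k : ℝ → ℝ := fun s => g s - c / 4 * (s - t) ^ 2 with hk
  have hkd : ∀ᶠ s in 𝓝 t, HasDerivAt k (g' s - c / 2 * (s - t)) s := by
    filter_upwards [hg] with s hs
    refine (hs.sub ((((hasDerivAt_id s).sub_const t).pow 2).const_mul (c / 4))).congr_deriv ?_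
    simp; ring
  have hkd' : deriv k =ᶠ[𝓝 t] fun s => g' s - c / 2 * (s - t) := by
    filter_upwards [hkd] with s hs using hs.deriv
  have h2 : HasDerivAt (fun s => g' s - c / 2 * (s - t)) (c - c / 2) t := by
    refine (hg'.sub (((hasDerivAt_id t).sub_const t).const_mul (c / 2))).congr_deriv ?_
    simp
  have hmin : IsLocalMin k t := by
    refine isLocalMin_of_deriv_deriv_pos ?_ ?_ hkd.self_of_nhds.continuousAt
    · rw [hkd'.deriv_eq, h2.deriv]; linarith
    · rw [hkd'.self_of_nhds]; simp [h0]
  have hev : ∀ᶠ s in 𝓝 t, s = t := by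
    filter_upwards [hmin, hmax] with s h1 h2
    simp only [hk, sub_self] at h1
    have : (s - t) ^ 2 ≤ 0 := by nlinarith
    have : s - t = 0 := by nlinarith
    linarith
  obtain ⟨s, hs, hst⟩ := Filter.nonempty_of_mem
    (inter_mem (nhdsWithin_le_nhds hev) (self_mem_nhdsWithin : {t}ᶜ ∈ 𝓝[≠] t))
  exact hst hs

theorem ContDiffAt.eventually_hasDerivAt_line {u : E → ℝ} {p : E} (hu : ContDiffAt ℝ 2 u p)
    (v : E) :
    ∀ᶠ s : ℝ in 𝓝 0, HasDerivAt (fun s : ℝ => u (p + s • v)) (fderiv ℝ u (p + s • v) v) s := by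
  have hc : Tendsto (fun s : ℝ => p + s • v) (𝓝 0) (𝓝 p) := by
    have : Continuous (fun s : ℝ => p + s • v) := by fun_prop
    simpa using this.tendsto 0
  have hev := hc.eventually (hu.eventually (by simp))
  filter_upwards [hev] with s hs
  have h1 := (hs.differentiableAt (by norm_num)).hasFDerivAt
  have h2 : HasDerivAt (fun s : ℝ => p + s • v) v s := by
    simpa using ((hasDerivAt_id s).smul_const v).const_add p
  exact h1.comp_hasDerivAt s h2

theorem ContDiffAt.hasDerivAt_fderiv_line {u : E → ℝ} {p : E} (hu : ContDiffAt ℝ 2 u p)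
    (v : E) :
    HasDerivAt (fun s : ℝ => fderiv ℝ u (p + s • v) v) (fderiv ℝ (fderiv ℝ u) p v v) 0 := by
  have h1 : HasFDerivAt (fderiv ℝ u) (fderiv ℝ (fderiv ℝ u) p) (p + (0 : ℝ) • v) := by
    have : ContDiffAt ℝ 1 (fderiv ℝ u) p := hu.fderiv_right (by norm_num)
    simpa using (this.differentiableAt (by norm_num)).hasFDerivAt
  have h2 : HasDerivAt (fun s : ℝ => p + s • v) v 0 := by
    simpa using ((hasDerivAt_id (0 : ℝ)).smul_const v).const_add p
  exact ((ContinuousLinearMap.apply ℝ ℝ v).hasFDerivAt).comp_hasDerivAt (0 : ℝ)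
    (h1.comp_hasDerivAt 0 h2)

/-- The second order condition along lines for a signed sum of four values of `u`
minus a comparison function. -/
theorem second_deriv_le_of_isLocalMax_lines {u : E → ℝ} {p₁ p₂ p₃ p₄ v : E}
    (h₁ : ContDiffAt ℝ 2 u p₁) (h₂ : ContDiffAt ℝ 2 u p₂) (h₃ : ContDiffAt ℝ 2 u p₃)
    (h₄ : ContDiffAt ℝ 2 u p₄) {σ₂ σ₃ σ₄ : ℝ} (hσ₂ : σ₂ ^ 2 = 1) (hσ₃ : σ₃ ^ 2 = 1)
    (hσ₄ : σ₄ ^ 2 = 1) {q q' : ℝ → ℝ} {c : ℝ} (hq : ∀ᶠ s in 𝓝 0, HasDerivAt q (q' s) s)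
    (hq' : HasDerivAt q' c 0)
    (hmax : IsLocalMax (fun s : ℝ => u (p₁ + s • v) - u (p₂ + s • (σ₂ • v))
      - u (p₃ + s • (σ₃ • v)) + u (p₄ + s • (σ₄ • v)) - q s) 0) :
    fderiv ℝ (fderiv ℝ u) p₁ v v - fderiv ℝ (fderiv ℝ u) p₂ v v
      - fderiv ℝ (fderiv ℝ u) p₃ v v + fderiv ℝ (fderiv ℝ u) p₄ v v ≤ c := by
  have key := hmax.second_deriv_nonpos (c := fderiv ℝ (fderiv ℝ u) p₁ v v
      - fderiv ℝ (fderiv ℝ u) p₂ (σ₂ • v) (σ₂ • v) - fderiv ℝ (fderiv ℝ u) p₃ (σ₃ • v) (σ₃ • v)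
      + fderiv ℝ (fderiv ℝ u) p₄ (σ₄ • v) (σ₄ • v) - c) (by
        filter_upwards [h₁.eventually_hasDerivAt_line v, h₂.eventually_hasDerivAt_line (σ₂ • v),
          h₃.eventually_hasDerivAt_line (σ₃ • v), h₄.eventually_hasDerivAt_line (σ₄ • v), hq]
          with s k₁ k₂ k₃ k₄ k₅
        exact (((k₁.sub k₂).sub k₃).add k₄).sub k₅)
      (((((h₁.hasDerivAt_fderiv_line v).sub (h₂.hasDerivAt_fderiv_line (σ₂ • v))).sub
        (h₃.hasDerivAt_fderiv_line (σ₃ • v))).add (h₄.hasDerivAt_fderiv_line (σ₄ • v))).sub hq')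
  simp only [map_smul, smul_apply, smul_eq_mul, ← mul_assoc, ← pow_two,
    hσ₂, hσ₃, hσ₄, one_mul] at key
  linarith

theorem laplacian_eq_sum_fderiv_fderiv [FiniteDimensional ℝ E] {ι : Type*} [Fintype ι]
    (b : OrthonormalBasis ι ℝ E) (u : E → ℝ) (x : E) :
    Laplacian.laplacian u x = ∑ i, fderiv ℝ (fderiv ℝ u) x (b i) (b i) := by
  rw [laplacian_eq_iteratedFDeriv_orthonormalBasis u b]
  simp [iteratedFDeriv_two_apply]

theorem exists_orthonormalBasis_apply_eq [FiniteDimensional ℝ E] {e : E} (he : ‖e‖ = 1) :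
    ∃ (b : OrthonormalBasis (Fin (finrank ℝ E)) ℝ E) (i : Fin (finrank ℝ E)), b i = e := by
  have hpos : 0 < finrank ℝ E := by
    have : Nontrivial E := ⟨e, 0, by rintro rfl; simp at he⟩
    exact finrank_pos
  obtain ⟨b, hb⟩ := Orthonormal.exists_orthonormalBasis_extension_of_card_eq (𝕜 := ℝ) (E := E)
    (ι := Fin (finrank ℝ E)) (by simp) (v := fun _ => e) (s := {⟨0, hpos⟩}) (by
      refine ⟨fun i => by simpa using he, fun i j hij => ?_⟩
      exact absurd (Subsingleton.elim i j) hij)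
  exact ⟨b, _, hb _ rfl⟩

end SecondDerivative

section ZygmundEstimate

variable {E : Type*} [NormedAddCommGroup E] [InnerProductSpace ℝ E] [FiniteDimensional ℝ E]

theorem rpow_sub_one_le_mul_rpow_add_mul_rpow {α r y z : ℝ} (hα : α < 1) (hy : 0 < y)
    (hz : 0 < z) (hyr : y ≤ r) (hzr : z ≤ r) :
    r ^ (α - 1) ≤ z * y ^ (α - 2) + y * z ^ (α - 2) := by
  wlog hyz : y ≤ z generalizing y z
  · rw [add_comm]; exact this hz hy hzr hyr (le_of_not_ge hyz)
  have h1 : r ^ (α - 1) ≤ y ^ (α - 1) :=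
    Real.rpow_le_rpow_of_nonpos hy hyr (by linarith)
  have h2 : y ^ (α - 1) = y * y ^ (α - 2) := by
    rw [show α - 1 = 1 + (α - 2) by ring, Real.rpow_add hy, Real.rpow_one]
  have h3 : y * y ^ (α - 2) ≤ z * y ^ (α - 2) := by gcongr
  have h4 : 0 ≤ y * z ^ (α - 2) := by positivity
  linarith

theorem hasDerivAt_barrier (a b K α z : ℝ) {y : ℝ} (hy : 0 < y) :
    (∀ᶠ s in 𝓝 (0 : ℝ), HasDerivAt
      (fun s => a * (b + (y + s) ^ 2 + z ^ 2) + K * (z * (y + s) ^ α + (y + s) * z ^ α))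
      (2 * a * (y + s) + K * (z * (α * (y + s) ^ (α - 1)) + z ^ α)) s) ∧
    HasDerivAt (fun s => 2 * a * (y + s) + K * (z * (α * (y + s) ^ (α - 1)) + z ^ α))
      (2 * a - K * (α * (1 - α)) * (z * y ^ (α - 2))) 0 := by
  constructor
  · filter_upwards [lt_mem_nhds (show -y < 0 by linarith)] with s hs
    have h1 : HasDerivAt (fun s : ℝ => y + s) 1 s := (hasDerivAt_id s).const_add y
    have h2 := h1.rpow_const (p := α) (Or.inl (by linarith))
    refine (((((h1.pow 2).const_add b).add_const (z ^ 2)).const_mul a).add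
      (((h2.const_mul z).add (h1.mul_const (z ^ α))).const_mul K)).congr_deriv ?_
    simp; ring
  · have h1 : HasDerivAt (fun s : ℝ => y + s) 1 0 := (hasDerivAt_id _).const_add y
    have h2 := h1.rpow_const (p := α - 1) (Or.inl (by simpa using hy.ne'))
    refine ((h1.const_mul (2 * a)).add
      ((((h2.const_mul α).const_mul z).add_const (z ^ α)).const_mul K)).congr_deriv ?_
    rw [show α - 1 - 1 = α - 2 by ring]
    simp; ring

/-- Comparison of the mixed second difference of `u` in the direction `e` with the barrier
`a (y² + z²) + K (z y ^ α + y z ^ α)`, by the maximum principle in the variables `(x, y, z)`. -/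
theorem mixed_difference_le_barrier {u : E → ℝ} {x₀ e : E} {r a K M F α : ℝ} (he : ‖e‖ = 1)
    (hr : 0 < r) (hα₀ : 0 < α) (hα₁ : α < 1) (ha : 0 ≤ a) (hK : 0 ≤ K)
    (hu : ∀ p ∈ closedBall x₀ (3 * r), ContDiffAt ℝ 2 u p)
    (hM : ∀ p ∈ closedBall x₀ (3 * r), |u p| ≤ M)
    (hF : ∀ p ∈ closedBall x₀ (3 * r), |Laplacian.laplacian u p| ≤ F)
    (haM : 4 * M ≤ a * r ^ 2)
    (hKF : 4 * F + 2 * a * finrank ℝ E < K * (α * (1 - α)) * r ^ (α - 1) / 2)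
    {y z : ℝ} (hy : y ∈ Icc 0 r) (hz : z ∈ Icc 0 r) :
    u (x₀ + (y + z) • e) - u (x₀ + (y - z) • e) - u (x₀ - (y - z) • e) + u (x₀ - (y + z) • e)
      ≤ a * (y ^ 2 + z ^ 2) + K * (z * y ^ α + y * z ^ α) := by
  set B : E × ℝ × ℝ → ℝ := fun P => a * (‖P.1 - x₀‖ ^ 2 + P.2.1 ^ 2 + P.2.2 ^ 2)
    + K * (P.2.2 * P.2.1 ^ α + P.2.1 * P.2.2 ^ α) with hB
  set G : E × ℝ × ℝ → ℝ := fun P => u (P.1 + (P.2.1 + P.2.2) • e)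
    - u (P.1 + (P.2.1 - P.2.2) • e) - u (P.1 - (P.2.1 - P.2.2) • e)
    + u (P.1 - (P.2.1 + P.2.2) • e) - B P with hG
  set S : Set (E × ℝ × ℝ) := closedBall x₀ r ×ˢ Icc 0 r ×ˢ Icc 0 r with hS
  have hball : ∀ x ∈ closedBall x₀ r, ∀ c : ℝ, |c| ≤ 2 * r →
      x + c • e ∈ closedBall x₀ (3 * r) ∧ x - c • e ∈ closedBall x₀ (3 * r) := by
    intro x hx c hc
    rw [mem_closedBall, dist_eq_norm] at hx
    have hce : ‖c • e‖ = |c| := by rw [norm_smul, he, mul_one, Real.norm_eq_abs]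
    constructor
    · rw [mem_closedBall, dist_eq_norm, add_sub_right_comm]
      linarith [norm_add_le (x - x₀) (c • e)]
    · rw [mem_closedBall, dist_eq_norm, sub_right_comm]
      linarith [norm_sub_le (x - x₀) (c • e)]
  have hpts : ∀ P ∈ S, (P.1 + (P.2.1 + P.2.2) • e ∈ closedBall x₀ (3 * r) ∧
      P.1 - (P.2.1 + P.2.2) • e ∈ closedBall x₀ (3 * r)) ∧
      (P.1 + (P.2.1 - P.2.2) • e ∈ closedBall x₀ (3 * r) ∧
      P.1 - (P.2.1 - P.2.2) • e ∈ closedBall x₀ (3 * r)) := by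
    rintro ⟨x, y, z⟩ ⟨hx, ⟨hy0, hy1⟩, hz0, hz1⟩
    simp only at hx hy0 hy1 hz0 hz1
    exact ⟨hball x hx _ (abs_le.2 ⟨by linarith, by linarith⟩),
      hball x hx _ (abs_le.2 ⟨by linarith, by linarith⟩)⟩
  have hcu : ContinuousOn u (closedBall x₀ (3 * r)) :=
    fun p hp => (hu p hp).continuousAt.continuousWithinAt
  have hBc : Continuous B := by
    have h1 : Continuous fun P : E × ℝ × ℝ => P.2.1 ^ α :=
      (Real.continuous_rpow_const hα₀.le).comp (by fun_prop)
    have h2 : Continuous fun P : E × ℝ × ℝ => P.2.2 ^ α :=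
      (Real.continuous_rpow_const hα₀.le).comp (by fun_prop)
    fun_prop
  have hGc : ContinuousOn G S := by
    refine ContinuousOn.sub (((ContinuousOn.sub ?_ ?_).sub ?_).add ?_) hBc.continuousOn
    · exact hcu.comp (by fun_prop) fun P hP => (hpts P hP).1.1
    · exact hcu.comp (by fun_prop) fun P hP => (hpts P hP).2.1
    · exact hcu.comp (by fun_prop) fun P hP => (hpts P hP).2.2
    · exact hcu.comp (by fun_prop) fun P hP => (hpts P hP).1.2
  have hSc : IsCompact S := (isCompact_closedBall x₀ r).prod (isCompact_Icc.prod isCompact_Icc)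
  have hmem : (x₀, y, z) ∈ S := ⟨mem_closedBall_self hr.le, hy, hz⟩
  suffices hle : ∀ P ∈ S, G P ≤ 0 by
    have := hle _ hmem
    simp only [hG, hB, sub_self, norm_zero] at this
    linarith
  obtain ⟨⟨x, y, z⟩, hP, hPmax⟩ := hSc.exists_isMaxOn ⟨_, hmem⟩ hGc
  by_contra! hcon
  obtain ⟨Q, hQS, hQ⟩ := hcon
  have hpos : 0 < G (x, y, z) := hQ.trans_le (hPmax hQS)
  clear hQ hQS Q hmem hy hz
  obtain ⟨⟨hp₁, hp₄⟩, hp₂, hp₃⟩ := hpts _ hP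
  obtain ⟨hx, ⟨hy0, hy1⟩, hz0, hz1⟩ := hP
  simp only at hp₁ hp₂ hp₃ hp₄ hx hy0 hy1 hz0 hz1
  have hyα : 0 ≤ y ^ α := Real.rpow_nonneg hy0 α
  have hzα : 0 ≤ z ^ α := Real.rpow_nonneg hz0 α
  have hKnn : 0 ≤ K * (z * y ^ α + y * z ^ α) := by positivity
  have hupper : G (x, y, z) ≤ a * r ^ 2 - a * (‖x - x₀‖ ^ 2 + y ^ 2 + z ^ 2) := by
    have := abs_le.1 (hM _ hp₁)
    have := abs_le.1 (hM _ hp₂)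
    have := abs_le.1 (hM _ hp₃)
    have := abs_le.1 (hM _ hp₄)
    simp only [hG, hB]
    linarith
  have hlt : ‖x - x₀‖ ^ 2 + y ^ 2 + z ^ 2 < r ^ 2 := by
    by_contra! h
    linarith [mul_le_mul_of_nonneg_left h ha]
  have hxr : ‖x - x₀‖ < r := lt_of_pow_lt_pow_left₀ 2 hr.le (by nlinarith)
  have hyr : y < r := lt_of_pow_lt_pow_left₀ 2 hr.le (by nlinarith [sq_nonneg ‖x - x₀‖])
  have hzr : z < r := lt_of_pow_lt_pow_left₀ 2 hr.le (by nlinarith [sq_nonneg ‖x - x₀‖])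
  have hy0' : 0 < y := by
    refine hy0.lt_of_ne ?_
    rintro rfl
    have : 0 ≤ a * (‖x - x₀‖ ^ 2 + 0 ^ 2 + z ^ 2) := by positivity
    simp only [hG, hB, zero_add, zero_sub, neg_smul, sub_neg_eq_add, ← sub_eq_add_neg] at hpos
    linarith
  have hz0' : 0 < z := by
    refine hz0.lt_of_ne ?_
    rintro rfl
    have : 0 ≤ a * (‖x - x₀‖ ^ 2 + y ^ 2 + 0 ^ 2) := by positivity
    simp only [hG, hB, add_zero, sub_zero] at hpos
    linarith
  have hloc : IsLocalMax G (x, y, z) := by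
    refine hPmax.isLocalMax (prod_mem_nhds ?_ (prod_mem_nhds (Icc_mem_nhds hy0' hyr)
      (Icc_mem_nhds hz0' hzr)))
    exact closedBall_mem_nhds_of_mem (by rwa [mem_ball, dist_eq_norm])
  have hline : ∀ γ : ℝ → E × ℝ × ℝ, Continuous γ → γ 0 = (x, y, z) →
      IsLocalMax (fun s => G (γ s)) 0 := by
    intro γ hγ h0
    exact IsLocalMax.comp_continuous (h0 ▸ hloc) hγ.continuousAt
  set D := fun p v => fderiv ℝ (fderiv ℝ u) p v v with hD
  set Φ : E → ℝ := fun v => D (x + (y + z) • e) v - D (x + (y - z) • e) v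
    - D (x - (y - z) • e) v + D (x - (y + z) • e) v with hΦ
  have hu₁ := hu _ hp₁
  have hu₂ := hu _ hp₂
  have hu₃ := hu _ hp₃
  have hu₄ := hu _ hp₄
  have hxdir : ∀ v : E, ‖v‖ = 1 → Φ v ≤ 2 * a := by
    intro v hv
    refine second_deriv_le_of_isLocalMax_lines hu₁ hu₂ hu₃ hu₄ (σ₂ := 1) (σ₃ := 1) (σ₄ := 1)
      (by norm_num) (by norm_num) (by norm_num)
      (q := fun s => B (x + s • v, y, z)) (q' := fun s => a * (2 * inner ℝ (x - x₀) v + 2 * s))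
      ?_ ?_ ?_
    · refine Eventually.of_forall fun s => ?_
      have h : ∀ s : ℝ, B (x + s • v, y, z) = a * ((‖x - x₀‖ ^ 2 + 2 * inner ℝ (x - x₀) v * s
          + s ^ 2) + (y ^ 2 + z ^ 2)) + K * (z * y ^ α + y * z ^ α) := by
        intro s
        simp only [hB]
        rw [add_sub_right_comm, norm_add_sq_real, inner_smul_right, norm_smul, hv,
          Real.norm_eq_abs, mul_one, sq_abs]
        ring
      simp_rw [h]
      refine ((((((hasDerivAt_id s).const_mul (2 * inner ℝ (x - x₀) v)).const_add
        (‖x - x₀‖ ^ 2)).add ((hasDerivAt_id s).pow 2)).add_const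
        (y ^ 2 + z ^ 2)).const_mul a).add_const _ |>.congr_deriv ?_
      simp
    · refine ((((hasDerivAt_id (0 : ℝ)).const_mul 2).const_add _).const_mul a).congr_deriv ?_
      ring
    · convert hline (fun s => (x + s • v, y, z)) (by fun_prop) (by simp) using 2 with s
      simp only [hG]
      simp only [one_smul]
      congr 5 <;> abel
  have hydir : Φ e ≤ 2 * a - K * (α * (1 - α)) * (z * y ^ (α - 2)) := by
    obtain ⟨h1, h2⟩ := hasDerivAt_barrier a (‖x - x₀‖ ^ 2) K α z hy0'
    refine second_deriv_le_of_isLocalMax_lines hu₁ hu₂ hu₃ hu₄ (σ₂ := 1) (σ₃ := -1) (σ₄ := -1)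
      (by norm_num) (by norm_num) (by norm_num) h1 h2 ?_
    convert hline (fun s => (x, y + s, z)) (by fun_prop) (by simp) using 2 with s
    simp only [hG, hB]
    congr 5 <;> module
  have hzdir : Φ e ≤ 2 * a - K * (α * (1 - α)) * (y * z ^ (α - 2)) := by
    obtain ⟨h1, h2⟩ := hasDerivAt_barrier a (‖x - x₀‖ ^ 2) K α y hz0'
    refine second_deriv_le_of_isLocalMax_lines hu₁ hu₂ hu₃ hu₄ (σ₂ := -1) (σ₃ := 1) (σ₄ := -1)
      (by norm_num) (by norm_num) (by norm_num) h1 h2 ?_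
    convert hline (fun s => (x, y, z + s)) (by fun_prop) (by simp) using 2 with s
    simp only [hG, hB]
    congr 1
    · congr 4 <;> module
    · ring
  obtain ⟨b, i₀, hb⟩ := exists_orthonormalBasis_apply_eq he
  have hsum : ∑ i, Φ (b i) = Laplacian.laplacian u (x + (y + z) • e)
      - Laplacian.laplacian u (x + (y - z) • e) - Laplacian.laplacian u (x - (y - z) • e)
      + Laplacian.laplacian u (x - (y + z) • e) := by
    simp only [laplacian_eq_sum_fderiv_fderiv b, hΦ, Finset.sum_add_distrib,
      Finset.sum_sub_distrib, hD]
  have hlower : -(4 * F) ≤ ∑ i, Φ (b i) := by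
    rw [hsum]
    have := abs_le.1 (hF _ hp₁)
    have := abs_le.1 (hF _ hp₂)
    have := abs_le.1 (hF _ hp₃)
    have := abs_le.1 (hF _ hp₄)
    linarith
  have hrest : ∑ i ∈ Finset.univ.erase i₀, Φ (b i) ≤ (finrank ℝ E - 1) * (2 * a) := by
    refine (Finset.sum_le_card_nsmul _ _ (2 * a) fun i _ => hxdir _ (b.norm_eq_one i)).trans_eq ?_
    rw [Finset.card_erase_of_mem (Finset.mem_univ _), Finset.card_univ, Fintype.card_fin,
      nsmul_eq_mul, Nat.cast_pred i₀.pos]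
  have hsplit := Finset.add_sum_erase Finset.univ (fun i => Φ (b i)) (Finset.mem_univ i₀)
  simp only [hb] at hsplit
  have hbar := mul_le_mul_of_nonneg_left
    (rpow_sub_one_le_mul_rpow_add_mul_rpow hα₁ hy0' hz0' hy1 hz1)
    (show 0 ≤ K * (α * (1 - α)) from
      mul_nonneg hK (mul_nonneg hα₀.le (sub_nonneg.2 hα₁.le)))
  linarith

theorem second_difference_le {u : E → ℝ} {x₀ v : E} {r M F α : ℝ} (hr : 0 < r) (hα₀ : 0 < α)
    (hα₁ : α < 1) (hM₀ : 0 < M) (hF₀ : 0 ≤ F)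
    (hu : ∀ p ∈ closedBall x₀ (3 * r), ContDiffAt ℝ 2 u p)
    (hM : ∀ p ∈ closedBall x₀ (3 * r), |u p| ≤ M)
    (hF : ∀ p ∈ closedBall x₀ (3 * r), |Laplacian.laplacian u p| ≤ F) (hv : ‖v‖ ≤ r) :
    u (x₀ + v) + u (x₀ - v) - 2 * u x₀ ≤
      (2 + 32 * (finrank ℝ E + 1) / (α * (1 - α))) * (r ^ (-(1 + α)) * (M + r ^ 2 * F))
        * ‖v‖ ^ (1 + α) := by
  rcases eq_or_ne v 0 with rfl | hv0
  · rw [norm_zero, Real.zero_rpow (by linarith)]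
    simp; linarith
  have hh : 0 < ‖v‖ := norm_pos_iff.2 hv0
  set h := ‖v‖ with hh_def
  have hαα : 0 < α * (1 - α) := mul_pos hα₀ (by linarith)
  set N : ℝ := (finrank ℝ E : ℝ) with hN
  have hN0 : 0 ≤ N := Nat.cast_nonneg _
  set R := r ^ (-(1 + α)) with hR
  have hR0 : 0 < R := Real.rpow_pos_of_pos hr _
  have hRr : R * r ^ 2 * r ^ (α - 1) = 1 := by
    rw [hR, ← Real.rpow_natCast, ← Real.rpow_add hr, ← Real.rpow_add hr,
      show -(1 + α) + ((2 : ℕ) : ℝ) + (α - 1) = 0 by push_cast; ring, Real.rpow_zero]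
  set K : ℝ := 2 / (α * (1 - α)) * (R * (4 * (r ^ 2 * F) + 8 * (N + 1) * M)) with hK
  have hK0 : 0 ≤ K := by positivity
  have hKF : 4 * F + 2 * (4 * M / r ^ 2) * N < K * (α * (1 - α)) * r ^ (α - 1) / 2 := by
    have h1 : K * (α * (1 - α)) * r ^ (α - 1) / 2
        = (R * r ^ 2 * r ^ (α - 1)) * (4 * F + 8 * (N + 1) * M / r ^ 2) := by
      have : 1 - α ≠ 0 := by linarith
      rw [hK]; field_simp
    have h2 : 2 * (4 * M / r ^ 2) * N < 8 * (N + 1) * M / r ^ 2 := by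
      rw [show 2 * (4 * M / r ^ 2) * N = 8 * N * M / r ^ 2 by ring]
      gcongr
      linarith
    rw [h1, hRr]; linarith
  have hmem : h / 2 ∈ Icc 0 r := ⟨by positivity, by linarith⟩
  have key := mixed_difference_le_barrier (e := h⁻¹ • v) (a := 4 * M / r ^ 2)
    (by rw [norm_smul, norm_inv, norm_norm, inv_mul_cancel₀ hh.ne']) hr hα₀ hα₁ (by positivity)
    hK0 hu hM hF (by field_simp; rfl) hKF hmem hmem
  rw [add_halves, smul_inv_smul₀ hh.ne', sub_self, zero_smul, add_zero, sub_zero] at key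
  have h1 : h ^ 2 ≤ R * r ^ 2 * h ^ (1 + α) := by
    have : (h / r) ^ (2 : ℝ) ≤ (h / r) ^ (1 + α) :=
      Real.rpow_le_rpow_of_exponent_ge (by positivity) ((div_le_one hr).2 hv) (by linarith)
    rw [Real.rpow_two, Real.div_rpow hh.le hr.le, div_pow, div_le_iff₀ (by positivity)] at this
    rw [hR, Real.rpow_neg hr.le]
    calc h ^ 2 ≤ _ := this
      _ = _ := by ring
  have h2 : h / 2 * (h / 2) ^ α ≤ h ^ (1 + α) := by
    rw [Real.rpow_add hh, Real.rpow_one]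
    gcongr <;> linarith
  set P := h ^ (1 + α) with hP
  have hP0 : 0 < P := Real.rpow_pos_of_pos hh _
  have h3 : 4 * M / r ^ 2 * ((h / 2) ^ 2 + (h / 2) ^ 2) ≤ 2 * (R * M) * P := by
    calc _ = 2 * M / r ^ 2 * h ^ 2 := by ring
      _ ≤ 2 * M / r ^ 2 * (R * r ^ 2 * P) := by gcongr
      _ = _ := by field_simp
  have h4 : K * (h / 2 * (h / 2) ^ α + h / 2 * (h / 2) ^ α) ≤
      32 * (N + 1) / (α * (1 - α)) * (R * (M + r ^ 2 * F)) * P := by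
    calc _ ≤ K * (P + P) := by gcongr
      _ = 2 * (4 * (r ^ 2 * F) + 8 * (N + 1) * M) * (2 / (α * (1 - α)) * (R * P)) := by
        rw [hK]; ring
      _ ≤ 2 * (8 * (N + 1) * (r ^ 2 * F) + 8 * (N + 1) * M) * (2 / (α * (1 - α)) * (R * P)) := by
        gcongr
        linarith
      _ = _ := by ring
  have h5 : 2 * (R * M) * P ≤ 2 * (R * (M + r ^ 2 * F)) * P := by
    gcongr
    have := mul_nonneg (sq_nonneg r) hF₀
    linarith
  linarith

theorem abs_second_difference_le {u : E → ℝ} {x₀ v : E} {r M F α : ℝ} (hr : 0 < r)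
    (hα₀ : 0 < α) (hα₁ : α < 1) (hM₀ : 0 < M) (hF₀ : 0 ≤ F)
    (hu : ∀ p ∈ closedBall x₀ (3 * r), ContDiffAt ℝ 2 u p)
    (hM : ∀ p ∈ closedBall x₀ (3 * r), |u p| ≤ M)
    (hF : ∀ p ∈ closedBall x₀ (3 * r), |Laplacian.laplacian u p| ≤ F) (hv : ‖v‖ ≤ r) :
    |u (x₀ + v) + u (x₀ - v) - 2 * u x₀| ≤
      (2 + 32 * (finrank ℝ E + 1) / (α * (1 - α))) * (r ^ (-(1 + α)) * (M + r ^ 2 * F))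
        * ‖v‖ ^ (1 + α) := by
  refine abs_le'.2 ⟨second_difference_le hr hα₀ hα₁ hM₀ hF₀ hu hM hF hv, ?_⟩
  have := second_difference_le (u := -u) hr hα₀ hα₁ hM₀ hF₀ (fun p hp => (hu p hp).neg)
    (by simpa using hM) (by simpa [laplacian_neg] using hF) hv
  simp only [Pi.neg_apply] at this
  linarith

end ZygmundEstimate

section ZygmundToHolder

theorem abs_apply_one_le_of_dyadic {g : ℝ → ℝ} {A α : ℝ} (hα : 0 < α) (hg₀ : g 0 = 0)
    (hg : HasDerivAt g 0 0)
    (hA : ∀ t : ℝ, 0 < t → t ≤ 1 → |g t - 2 * g (t / 2)| ≤ A * t ^ (1 + α)) :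
    |g 1| ≤ A / (1 - 2 ^ (-α)) := by
  set q : ℝ := 2 ^ (-α) with hq
  have hq0 : 0 < q := by positivity
  have hq1 : q < 1 := Real.rpow_lt_one_of_one_lt_of_neg one_lt_two (by linarith)
  have hA0 : 0 ≤ A := by simpa using (abs_nonneg _).trans (hA 1 one_pos le_rfl)
  set B := A / (1 - q) with hB
  have hB0 : 0 ≤ B := div_nonneg hA0 (by linarith)
  have hBA : B * (1 - q) = A := div_mul_cancel₀ _ (by linarith)
  have hstep : ∀ N : ℕ, |g 1 - 2 ^ N * g ((1 / 2) ^ N)| ≤ B * (1 - q ^ N) := by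
    intro N
    induction N with
    | zero => simp
    | succ N ih =>
      have h1 := hA ((1 / 2) ^ N) (by positivity) (pow_le_one₀ (by norm_num) (by norm_num))
      have h2 : ((1 / 2 : ℝ) ^ N) ^ (1 + α) = (1 / 2) ^ N * q ^ N := by
        rw [Real.rpow_add (by positivity), Real.rpow_one, hq, Real.rpow_neg (by norm_num),
          ← Real.inv_rpow (by norm_num), ← Real.rpow_natCast, ← Real.rpow_natCast,
          ← Real.rpow_mul (by norm_num), ← Real.rpow_mul (by norm_num), mul_comm (N : ℝ) α,
          one_div]
      have h3 : (2 : ℝ) ^ N * (1 / 2) ^ N = 1 := by rw [← mul_pow]; norm_num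
      have h4 : |2 ^ N * g ((1 / 2) ^ N) - 2 ^ (N + 1) * g ((1 / 2) ^ (N + 1))|
          ≤ A * q ^ N := by
        calc _ = 2 ^ N * |g ((1 / 2) ^ N) - 2 * g ((1 / 2) ^ N / 2)| := by
              rw [show ((1 : ℝ) / 2) ^ (N + 1) = (1 / 2) ^ N / 2 by ring, pow_succ, mul_assoc,
                ← mul_sub, abs_mul, abs_of_pos (by positivity)]
          _ ≤ 2 ^ N * (A * ((1 / 2) ^ N * q ^ N)) := by rw [← h2]; gcongr
          _ = (2 ^ N * (1 / 2) ^ N) * (A * q ^ N) := by ring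
          _ = _ := by rw [h3, one_mul]
      calc _ ≤ B * (1 - q ^ N) + A * q ^ N := (abs_sub_le _ _ _).trans (add_le_add ih h4)
        _ = _ := by rw [← hBA]; ring
  have hlim : Tendsto (fun N : ℕ => (2 : ℝ) ^ N * g ((1 / 2) ^ N)) atTop (𝓝 0) := by
    have h1 : Tendsto (fun N : ℕ => (1 / 2 : ℝ) ^ N) atTop (𝓝[≠] 0) :=
      tendsto_nhdsWithin_iff.2 ⟨tendsto_pow_atTop_nhds_zero_of_lt_one (by norm_num) (by norm_num),
        Eventually.of_forall fun N => by simp⟩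
    refine (hg.tendsto_slope_zero.comp h1).congr fun N => ?_
    simp [hg₀]
  have hlim' := (tendsto_const_nhds.sub hlim : Tendsto (fun N : ℕ =>
    g 1 - (2 : ℝ) ^ N * g ((1 / 2) ^ N)) atTop (𝓝 (g 1 - 0))).abs
  rw [sub_zero] at hlim'
  refine le_of_tendsto' hlim' fun N => (hstep N).trans ?_
  nlinarith [mul_nonneg hB0 (pow_nonneg hq0.le N)]

variable {E : Type*} [NormedAddCommGroup E] [NormedSpace ℝ E]

theorem abs_taylor_le_of_second_difference_le {u : E → ℝ} {x p v : E} {r A α : ℝ} (hα : 0 < α)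
    (hA : ∀ c ∈ closedBall x (2 * r), ∀ w : E, ‖w‖ ≤ r →
      |u (c + w) + u (c - w) - 2 * u c| ≤ A * ‖w‖ ^ (1 + α))
    (hp : p ∈ closedBall x r) (hd : DifferentiableAt ℝ u p) (hv : ‖v‖ ≤ r) :
    |u (p + v) - u p - fderiv ℝ u p v| ≤ A * ‖v‖ ^ (1 + α) / (1 - 2 ^ (-α)) := by
  set g : ℝ → ℝ := fun t => u (p + t • v) - u p - t * fderiv ℝ u p v with hg
  have hgd : HasDerivAt g 0 0 := by
    have h1 : HasFDerivAt u (fderiv ℝ u p) (p + (0 : ℝ) • v) := by simpa using hd.hasFDerivAt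
    have h2 : HasDerivAt (fun s : ℝ => p + s • v) v 0 := by
      simpa using ((hasDerivAt_id (0 : ℝ)).smul_const v).const_add p
    refine (((h1.comp_hasDerivAt 0 h2).sub_const (u p)).sub
      ((hasDerivAt_id (0 : ℝ)).mul_const (fderiv ℝ u p v))).congr_deriv ?_
    simp
  have h1 := abs_apply_one_le_of_dyadic hα (by simp [hg]) hgd (A := A * ‖v‖ ^ (1 + α)) ?_
  · simpa [hg] using h1
  intro t ht0 ht1
  have hn : ‖(t / 2) • v‖ = t / 2 * ‖v‖ := by
    rw [norm_smul, Real.norm_eq_abs, abs_of_pos (by positivity)]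
  have hnr : t / 2 * ‖v‖ ≤ ‖v‖ := by nlinarith [norm_nonneg v]
  have hc : p + (t / 2) • v ∈ closedBall x (2 * r) := by
    rw [mem_closedBall, dist_eq_norm] at hp ⊢
    rw [add_sub_right_comm]
    linarith [norm_add_le (p - x) ((t / 2) • v)]
  have h2 := hA _ hc ((t / 2) • v) (by linarith)
  rw [add_assoc, ← add_smul, add_halves, add_sub_cancel_right, hn] at h2
  rcases eq_or_ne v 0 with rfl | hv0
  · simp [hg, Real.zero_rpow (show 1 + α ≠ 0 by linarith)]
  have hvpos := norm_pos_iff.2 hv0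
  have hA0 : 0 ≤ A := by
    have := (abs_nonneg _).trans h2
    exact nonneg_of_mul_nonneg_left this (by positivity)
  calc |g t - 2 * g (t / 2)| = |u (p + t • v) + u p - 2 * u (p + (t / 2) • v)| := by
        simp only [hg]; congr 1; ring
    _ ≤ _ := h2
    _ ≤ A * (t * ‖v‖) ^ (1 + α) := by gcongr; linarith
    _ = _ := by rw [Real.mul_rpow ht0.le (norm_nonneg v)]; ring

theorem norm_fderiv_sub_le_of_second_difference_le {u : E → ℝ} {x y : E} {r A α : ℝ} (hα : 0 < α)
    (hA₀ : 0 ≤ A) (hA : ∀ c ∈ closedBall x (2 * r), ∀ w : E, ‖w‖ ≤ r →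
      |u (c + w) + u (c - w) - 2 * u c| ≤ A * ‖w‖ ^ (1 + α))
    (hx : DifferentiableAt ℝ u x) (hy : DifferentiableAt ℝ u y) (hxy : ‖x - y‖ ≤ r) :
    ‖fderiv ℝ u x - fderiv ℝ u y‖ ≤ 2 * (1 + 1 / (1 - 2 ^ (-α))) * A * ‖x - y‖ ^ α := by
  have hq1 : (2 : ℝ) ^ (-α) < 1 := Real.rpow_lt_one_of_one_lt_of_neg one_lt_two (by linarith)
  have hq1' : 0 < 1 - (2 : ℝ) ^ (-α) := by linarith
  rcases eq_or_ne x y with rfl | hne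
  · simp; positivity
  set h := ‖x - y‖ with hh
  have hh0 : 0 < h := norm_pos_iff.2 (sub_ne_zero.2 hne)
  have hbound : ∀ v : E, ‖v‖ = h → |(fderiv ℝ u x - fderiv ℝ u y) v| ≤
      2 * (1 + 1 / (1 - 2 ^ (-α))) * A * h ^ (1 + α) := by
    intro v hv
    have hr0 : 0 ≤ r := hh0.le.trans hxy
    have hyx : y ∈ closedBall x r := by rwa [mem_closedBall, dist_eq_norm, norm_sub_rev]
    have h1 := abs_taylor_le_of_second_difference_le hα hA (mem_closedBall_self hr0) hx
      (hv.trans_le hxy)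
    have h2 := abs_taylor_le_of_second_difference_le hα hA hyx hy (hv.trans_le hxy)
    have hyx' : ‖y - x‖ = h := by rw [norm_sub_rev]
    have hc : x + (1 / 2 : ℝ) • (y - x + v) ∈ closedBall x (2 * r) := by
      rw [mem_closedBall, dist_eq_norm, add_sub_cancel_left, norm_smul]
      norm_num
      linarith [norm_add_le (y - x) v]
    have hhalf : ∀ w : E, ‖w‖ ≤ 2 * h → ‖(1 / 2 : ℝ) • w‖ ≤ h := by
      intro w hw
      rw [norm_smul]
      norm_num
      linarith
    have hA' : ∀ w : E, ‖w‖ ≤ 2 * h → |u (x + (1 / 2 : ℝ) • (y - x + v) + (1 / 2 : ℝ) • w) +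
        u (x + (1 / 2 : ℝ) • (y - x + v) - (1 / 2 : ℝ) • w)
        - 2 * u (x + (1 / 2 : ℝ) • (y - x + v))| ≤ A * h ^ (1 + α) := by
      intro w hw
      refine (hA _ hc _ ((hhalf w hw).trans hxy)).trans ?_
      gcongr
      exact hhalf w hw
    have h3 := hA' (y - x + v) (by linarith [norm_add_le (y - x) v])
    have h4 := hA' (y - x - v) (by linarith [norm_sub_le (y - x) v])
    rw [show x + (1 / 2 : ℝ) • (y - x + v) + (1 / 2 : ℝ) • (y - x + v) = y + v by module,
      show x + (1 / 2 : ℝ) • (y - x + v) - (1 / 2 : ℝ) • (y - x + v) = x by module] at h3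
    rw [show x + (1 / 2 : ℝ) • (y - x + v) + (1 / 2 : ℝ) • (y - x - v) = y by module,
      show x + (1 / 2 : ℝ) • (y - x + v) - (1 / 2 : ℝ) • (y - x - v) = x + v by module] at h4
    rw [hv] at h1 h2
    rw [show 2 * (1 + 1 / (1 - (2 : ℝ) ^ (-α))) * A * h ^ (1 + α)
      = 2 * (A * h ^ (1 + α)) + 2 * (A * h ^ (1 + α) / (1 - 2 ^ (-α))) by ring,
      sub_apply]
    rw [abs_le] at *
    constructor <;> linarith
  refine ContinuousLinearMap.opNorm_le_bound _ (by positivity) fun w => ?_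
  rcases eq_or_ne w 0 with rfl | hw
  · simp
  have hw0 := norm_pos_iff.2 hw
  have := hbound ((h / ‖w‖) • w) (by
    rw [norm_smul, Real.norm_eq_abs, abs_of_pos (by positivity), div_mul_cancel₀ _ hw0.ne'])
  rw [map_smul, smul_eq_mul, abs_mul, abs_of_pos (div_pos hh0 hw0), Real.rpow_add hh0,
    Real.rpow_one, div_mul_eq_mul_div, div_le_iff₀ hw0] at this
  rw [Real.norm_eq_abs]
  refine le_of_mul_le_mul_left (this.trans_eq ?_) hh0
  ring

theorem norm_fderiv_le_of_second_difference_le {u : E → ℝ} {x : E} {r A M α : ℝ} (hr : 0 < r)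
    (hα : 0 < α) (hA₀ : 0 ≤ A) (hM₀ : 0 ≤ M)
    (hA : ∀ c ∈ closedBall x (2 * r), ∀ w : E, ‖w‖ ≤ r →
      |u (c + w) + u (c - w) - 2 * u c| ≤ A * ‖w‖ ^ (1 + α))
    (hx : DifferentiableAt ℝ u x) (hM : ∀ p ∈ closedBall x r, |u p| ≤ M) :
    ‖fderiv ℝ u x‖ ≤ (2 * (r ^ (-(1 + α)) * M) + 1 / (1 - 2 ^ (-α)) * A) * r ^ α := by
  have hq1 : (2 : ℝ) ^ (-α) < 1 := Real.rpow_lt_one_of_one_lt_of_neg one_lt_two (by linarith)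
  have hq1' : 0 < 1 - (2 : ℝ) ^ (-α) := by linarith
  refine ContinuousLinearMap.opNorm_le_bound _ (by positivity) fun w => ?_
  rcases eq_or_ne w 0 with rfl | hw
  · simp
  have hw0 := norm_pos_iff.2 hw
  set v := (r / ‖w‖) • w with hv_def
  have hv : ‖v‖ = r := by
    rw [norm_smul, Real.norm_eq_abs, abs_of_pos (by positivity), div_mul_cancel₀ _ hw0.ne']
  have h1 := abs_taylor_le_of_second_difference_le hα hA (mem_closedBall_self hr.le) hx hv.le
  have h2 := hM x (mem_closedBall_self hr.le)
  have h3 := hM (x + v) (by rw [mem_closedBall, dist_eq_norm, add_sub_cancel_left, hv])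
  have h4 : |fderiv ℝ u x v| ≤ 2 * M + A * r ^ (1 + α) / (1 - 2 ^ (-α)) := by
    rw [hv] at h1
    rw [abs_le] at *
    constructor <;> linarith
  rw [hv_def, map_smul, smul_eq_mul, abs_mul, abs_of_pos (div_pos hr hw0), div_mul_eq_mul_div,
    div_le_iff₀ hw0] at h4
  rw [Real.norm_eq_abs]
  refine le_of_mul_le_mul_left (h4.trans_eq ?_) hr
  have h5 : r ^ (-(1 + α)) * (r * r ^ α) = 1 := by
    rw [Real.rpow_neg hr.le, Real.rpow_add hr, Real.rpow_one]
    exact inv_mul_cancel₀ (by positivity)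
  have h6 : r ^ (1 + α) = r * r ^ α := by rw [Real.rpow_add hr, Real.rpow_one]
  rw [h6]
  linear_combination (-2 * M * ‖w‖) * h5

end ZygmundToHolder

section InteriorEstimate

/-- Interior Hölder estimate for the gradient, for two points that are both centers of balls
of radius `5 r` on which `u` and its Laplacian are bounded. -/
theorem norm_fderiv_sub_le_of_laplacian_le {E : Type*} [NormedAddCommGroup E]
    [InnerProductSpace ℝ E] [FiniteDimensional ℝ E] {u : E → ℝ} {x y : E} {r M F α : ℝ}
    (hr : 0 < r) (hα₀ : 0 < α) (hα₁ : α < 1) (hM₀ : 0 < M) (hF₀ : 0 ≤ F)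
    (hu : ∀ p ∈ closedBall x (5 * r) ∪ closedBall y (5 * r), ContDiffAt ℝ 2 u p)
    (hM : ∀ p ∈ closedBall x (5 * r) ∪ closedBall y (5 * r), |u p| ≤ M)
    (hF : ∀ p ∈ closedBall x (5 * r) ∪ closedBall y (5 * r), |Laplacian.laplacian u p| ≤ F) :
    ‖fderiv ℝ u x - fderiv ℝ u y‖ ≤
      (4 + 2 * (1 + 1 / (1 - 2 ^ (-α))) * (2 + 32 * (finrank ℝ E + 1) / (α * (1 - α))))
        * (r ^ (-(1 + α)) * (M + r ^ 2 * F)) * ‖x - y‖ ^ α := by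
  have hq1 : (2 : ℝ) ^ (-α) < 1 := Real.rpow_lt_one_of_one_lt_of_neg one_lt_two (by linarith)
  have hq1' : 0 < 1 - (2 : ℝ) ^ (-α) := by linarith
  have hαα : 0 < α * (1 - α) := mul_pos hα₀ (by linarith)
  set b : ℝ := 1 / (1 - 2 ^ (-α)) with hb
  have hb0 : 0 < b := by positivity
  set Z : ℝ := 2 + 32 * (finrank ℝ E + 1) / (α * (1 - α)) with hZ
  have hZ0 : 0 < Z := by positivity
  set W := r ^ (-(1 + α)) * (M + r ^ 2 * F) with hW
  have hW0 : 0 ≤ W := by positivity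
  have hMW : r ^ (-(1 + α)) * M ≤ W := by
    rw [hW]; gcongr
    have := mul_nonneg (sq_nonneg r) hF₀
    linarith
  have hdiff : ∀ z, closedBall z (5 * r) ⊆ closedBall x (5 * r) ∪ closedBall y (5 * r) →
      (∀ c ∈ closedBall z (2 * r), ∀ w : E, ‖w‖ ≤ r →
        |u (c + w) + u (c - w) - 2 * u c| ≤ Z * W * ‖w‖ ^ (1 + α)) ∧
      DifferentiableAt ℝ u z ∧
      ‖fderiv ℝ u z‖ ≤ (2 * (r ^ (-(1 + α)) * M) + b * (Z * W)) * r ^ α := by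
    intro z hz
    have h1 : ∀ c ∈ closedBall z (2 * r), ∀ w : E, ‖w‖ ≤ r →
        |u (c + w) + u (c - w) - 2 * u c| ≤ Z * W * ‖w‖ ^ (1 + α) := by
      intro c hc w hw
      have hsub : closedBall c (3 * r) ⊆ closedBall x (5 * r) ∪ closedBall y (5 * r) :=
        (closedBall_subset_closedBall' (by rw [mem_closedBall] at hc; linarith)).trans hz
      exact abs_second_difference_le hr hα₀ hα₁ hM₀ hF₀ (fun p hp => hu p (hsub hp))
        (fun p hp => hM p (hsub hp)) (fun p hp => hF p (hsub hp)) hw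
    have h2 : DifferentiableAt ℝ u z :=
      (hu z (hz (mem_closedBall_self (by positivity)))).differentiableAt (by norm_num)
    exact ⟨h1, h2, norm_fderiv_le_of_second_difference_le hr hα₀ (by positivity) hM₀.le h1 h2
      fun p hp => hM p (hz (closedBall_subset_closedBall (by linarith) hp))⟩
  obtain ⟨hx1, hx2, hx3⟩ := hdiff x subset_union_left
  obtain ⟨-, hy2, hy3⟩ := hdiff y subset_union_right
  rcases le_total ‖x - y‖ r with hxy | hxy
  · refine (norm_fderiv_sub_le_of_second_difference_le hα₀ (by positivity) hx1 hx2 hy2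
      hxy).trans ?_
    rw [← mul_assoc]
    gcongr
    linarith
  · calc _ ≤ ‖fderiv ℝ u x‖ + ‖fderiv ℝ u y‖ := norm_sub_le _ _
      _ ≤ 2 * ((2 * (r ^ (-(1 + α)) * M) + b * (Z * W)) * r ^ α) := by linarith
      _ ≤ 2 * ((2 * W + b * (Z * W)) * ‖x - y‖ ^ α) := by gcongr
      _ = (4 + 2 * b * Z) * W * ‖x - y‖ ^ α := by ring
      _ ≤ _ := by
        gcongr
        linarith

theorem ContDiffAt.lapl_eq_laplacian {n : ℕ} {u : EuclideanSpace ℝ (Fin n) → ℝ}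
    {x : EuclideanSpace ℝ (Fin n)} (hu : ContDiffAt ℝ 2 u x) :
    lapl n u x = Laplacian.laplacian u x := by
  rw [laplacian_eq_sum_fderiv_fderiv (EuclideanSpace.basisFun (Fin n) ℝ), lapl]
  refine Finset.sum_congr rfl fun i _ => ?_
  have h : DifferentiableAt ℝ (fderiv ℝ u) x :=
    (hu.fderiv_right (m := 1) (by norm_num)).differentiableAt (by norm_num)
  rw [EuclideanSpace.basisFun_apply, fderiv_clm_apply h (differentiableAt_const _)]
  simp

theorem infDist_compl_pos_of_isBounded {E : Type*} [NormedAddCommGroup E] [NormedSpace ℝ E]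
    [Nontrivial E] {Ω : Set E} (hΩ : IsOpen Ω) (hb : Bornology.IsBounded Ω) {x : E}
    (hx : x ∈ Ω) : 0 < infDist x Ωᶜ := by
  refine (hΩ.isClosed_compl.notMem_iff_infDist_pos ?_).1 (by simpa using hx)
  rw [nonempty_compl]
  rintro rfl
  exact NormedSpace.unbounded_univ ℝ E hb

end InteriorEstimate

/-- **Weighted interior Hölder gradient estimate for the Poisson equation**
(Proposition 2.1, inequality (2.15)). Let `Ω ⊂ ℝⁿ` be bounded and open and let
`u ∈ C²(Ω)`, `f ∈ C(Ω)` satisfy `Δu = f` on `Ω`. Then for every `α ∈ (0,1)` there is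
`C = C(n,α)` such that for all `μ ∈ (0,1]`,
`[u]^*_{1,α;Ω} ≤ C (μ^{-1-α} sup_Ω |u| + μ^{1-α} |f|^{(2)}_{0;Ω})`.
Here `d_x = dist(x,∂Ω)` is realized as `infDist x Ωᶜ`, the weighted seminorm
`[u]^*_{1,α;Ω} = sup_{x≠y} min(d_x,d_y)^{1+α} ‖∇u(x)-∇u(y)‖ / |x-y|^α ≤ …` is stated
pointwise, and the sup-type quantities on the right are expressed through arbitrary
upper bounds `K₁ ≥ sup_Ω |u|` and `K₂ ≥ |f|^{(2)}_{0;Ω} = sup_x d_x² |f(x)|`. -/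
theorem poisson_weighted_interior_holder_gradient_estimate (n : ℕ)
    (α : ℝ) (hα0 : 0 < α) (hα1 : α < 1) :
    ∃ C : ℝ, ∀ Ω : Set (EuclideanSpace ℝ (Fin n)),
      IsOpen Ω → Bornology.IsBounded Ω →
      ∀ u f : EuclideanSpace ℝ (Fin n) → ℝ,
      ContDiffOn ℝ 2 u Ω →
      ContinuousOn f Ω →
      (∀ x ∈ Ω, lapl n u x = f x) →
      ∀ μ : ℝ, 0 < μ → μ ≤ 1 →
      ∀ K₁ K₂ : ℝ,
      (∀ x ∈ Ω, |u x| ≤ K₁) →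
      (∀ x ∈ Ω, (infDist x Ωᶜ) ^ 2 * |f x| ≤ K₂) →
      ∀ x ∈ Ω, ∀ y ∈ Ω,
        (min (infDist x Ωᶜ) (infDist y Ωᶜ)) ^ (1 + α) * ‖fderiv ℝ u x - fderiv ℝ u y‖ ≤
          C * (μ ^ (-(1 + α)) * K₁ + μ ^ (1 - α) * K₂) * ‖x - y‖ ^ α := by
  set b : ℝ := 4 + 2 * (1 + 1 / (1 - 2 ^ (-α))) *
    (2 + 32 * (finrank ℝ (EuclideanSpace ℝ (Fin n)) + 1) / (α * (1 - α))) with hb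
  have hq1 : (2 : ℝ) ^ (-α) < 1 := Real.rpow_lt_one_of_one_lt_of_neg one_lt_two (by linarith)
  have hq1' : 0 < 1 - (2 : ℝ) ^ (-α) := by linarith
  have hαα : 0 < α * (1 - α) := mul_pos hα0 (by linarith)
  have hb0 : 0 < b := by positivity
  refine ⟨b * 10 ^ (1 + α), ?_⟩
  intro Ω hΩ hbdd u f hu _ hf μ hμ0 hμ1 K₁ K₂ hK₁ hK₂ x hx y hy
  rcases eq_or_ne x y with rfl | hxy
  · simp [Real.zero_rpow hα0.ne']
  have : Nontrivial (EuclideanSpace ℝ (Fin n)) := ⟨x, y, hxy⟩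
  have hK₁0 : 0 ≤ K₁ := (abs_nonneg _).trans (hK₁ x hx)
  have hK₂0 : 0 ≤ K₂ := (by positivity : 0 ≤ infDist x Ωᶜ ^ 2 * |f x|).trans (hK₂ x hx)
  have hdx := infDist_compl_pos_of_isBounded hΩ hbdd hx
  have hdy := infDist_compl_pos_of_isBounded hΩ hbdd hy
  rcases hK₁0.eq_or_lt with rfl | hK₁pos
  · have hzero : ∀ z ∈ Ω, fderiv ℝ u z = 0 := fun z hz => by
      have : u =ᶠ[𝓝 z] fun _ => 0 := by
        filter_upwards [hΩ.mem_nhds hz] with p hp using abs_nonpos_iff.1 (hK₁ p hp)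
      rw [this.fderiv_eq, fderiv_const_apply]
    rw [hzero x hx, hzero y hy, sub_self, norm_zero, mul_zero]
    positivity
  set d := min (infDist x Ωᶜ) (infDist y Ωᶜ) with hd
  have hd0 : 0 < d := lt_min hdx hdy
  set r := μ * d / 10 with hr
  have hr0 : 0 < r := by positivity
  have hrd : 5 * r ≤ d / 2 := by nlinarith
  have hdist : ∀ p ∈ closedBall x (5 * r) ∪ closedBall y (5 * r), d / 2 ≤ infDist p Ωᶜ := by
    rintro p (hp | hp) <;> rw [mem_closedBall'] at hp
    · linarith [infDist_le_infDist_add_dist (s := Ωᶜ) (x := x) (y := p),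
        min_le_left (infDist x Ωᶜ) (infDist y Ωᶜ)]
    · linarith [infDist_le_infDist_add_dist (s := Ωᶜ) (x := y) (y := p),
        min_le_right (infDist x Ωᶜ) (infDist y Ωᶜ)]
  have hsub : ∀ p ∈ closedBall x (5 * r) ∪ closedBall y (5 * r), p ∈ Ω := by
    intro p hp
    by_contra hpΩ
    linarith [hdist p hp, infDist_zero_of_mem (mem_compl hpΩ)]
  have hcd : ∀ p ∈ Ω, ContDiffAt ℝ 2 u p := fun p hp => hu.contDiffAt (hΩ.mem_nhds hp)
  have key := norm_fderiv_sub_le_of_laplacian_le (x := x) (y := y) (M := K₁)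
    (F := 4 * K₂ / d ^ 2) hr0 hα0 hα1 hK₁pos (by positivity)
    (fun p hp => hcd p (hsub p hp)) (fun p hp => hK₁ p (hsub p hp)) (by
      intro p hp
      rw [← (hcd p (hsub p hp)).lapl_eq_laplacian, hf p (hsub p hp), le_div_iff₀ (by positivity)]
      have h1 : (d / 2) ^ 2 * |f p| ≤ K₂ := by
        refine le_trans ?_ (hK₂ p (hsub p hp))
        gcongr
        exact hdist p hp
      linarith)
  rw [← hb] at key
  have hscale : d ^ (1 + α) * r ^ (-(1 + α)) = 10 ^ (1 + α) * μ ^ (-(1 + α)) := by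
    rw [hr, Real.rpow_neg (by positivity), Real.rpow_neg hμ0.le, Real.div_rpow (by positivity)
      (by norm_num), Real.mul_rpow hμ0.le hd0.le]
    field_simp
  have hμ2 : μ ^ (-(1 + α)) * μ ^ 2 = μ ^ (1 - α) := by
    rw [← Real.rpow_natCast, ← Real.rpow_add hμ0]
    congr 1
    push_cast
    ring
  have hr2 : r ^ 2 * (4 * K₂ / d ^ 2) ≤ μ ^ 2 * K₂ := by
    have h1 : r ^ 2 * (4 * K₂ / d ^ 2) = μ ^ 2 * K₂ / 25 := by
      rw [hr]; field_simp; ring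
    have : 0 ≤ μ ^ 2 * K₂ := by positivity
    linarith
  calc _ ≤ d ^ (1 + α) * (b * (r ^ (-(1 + α)) * (K₁ + r ^ 2 * (4 * K₂ / d ^ 2)))
          * ‖x - y‖ ^ α) := by gcongr
    _ = b * ((d ^ (1 + α) * r ^ (-(1 + α))) * (K₁ + r ^ 2 * (4 * K₂ / d ^ 2)))
          * ‖x - y‖ ^ α := by ring
    _ ≤ b * ((10 ^ (1 + α) * μ ^ (-(1 + α))) * (K₁ + μ ^ 2 * K₂)) * ‖x - y‖ ^ α := by
        rw [hscale]; gcongr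
    _ = _ := by rw [← hμ2]; ring
end

section
/- Let $B$ be the open unit ball in $\mathbb{C}^n$ and $\alpha\in(0,1]$. Suppose $u\in C^2(B)\cap C(\bar B)$ is plurisubharmonic on $B$ and satisfies $\det(u_{i\bar j})=f$ in $B$ and $u=\varphi$ on $\partial B$, where $\varphi\in C^{1,\alpha}(\partial B)$, $f\geq 0$ and $f^{1/n}\in C^{1,\alpha}(\bar B)$. Then there is a constant $C=C(n,t)$ depending only on $n$ and $t$ such that for every $t\in(0,1]$, every $x\in B$ with $|x|<1-t$, and every $h\in\mathbb{C}^n$ with $|h|<t/2$: $u(x+h)+u(x-h)-2u(x)\leq C\,([\varphi]_{1,\alpha;\partial B}+|f^{1/n}|'_{1,\alpha;B})\,|h|^{1+\alpha}$. -/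
open Metric Set
open scoped ComplexOrder

/-- The complex Hessian matrix `(u_{i j̄})` of a function `u : ℂⁿ → ℝ`, where
`u_{i j̄} = ∂²u/∂z_i∂z̄_j = (1/4)(u_{xᵢxⱼ} + u_{yᵢyⱼ} + i (u_{xᵢyⱼ} - u_{yᵢxⱼ}))`,
computed via real Fréchet derivatives. -/
noncomputable def cxHessian (n : ℕ) (u : EuclideanSpace ℂ (Fin n) → ℝ)
    (z : EuclideanSpace ℂ (Fin n)) : Matrix (Fin n) (Fin n) ℂ :=
  Matrix.of fun i j =>
    (1 / 4 : ℂ) *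
      (Complex.ofReal
          ((fderiv ℝ (fun w => fderiv ℝ u w (EuclideanSpace.single j (1 : ℂ))) z)
              (EuclideanSpace.single i (1 : ℂ))
            + (fderiv ℝ (fun w => fderiv ℝ u w (EuclideanSpace.single j Complex.I)) z)
              (EuclideanSpace.single i Complex.I))
        + Complex.I *
          Complex.ofReal
            ((fderiv ℝ (fun w => fderiv ℝ u w (EuclideanSpace.single j Complex.I)) z)
                (EuclideanSpace.single i (1 : ℂ))
              - (fderiv ℝ (fun w => fderiv ℝ u w (EuclideanSpace.single j (1 : ℂ))) z)
                (EuclideanSpace.single i Complex.I)))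

section DetInequality

open Matrix
open scoped MatrixOrder

variable {m : Type*} [Fintype m] [DecidableEq m]

/-- The arithmetic-geometric mean inequality for the eigenvalues of a positive matrix. -/
lemma Matrix.PosSemidef.det_rpow_le_trace [Nonempty m] {A : Matrix m m ℂ} (hA : A.PosSemidef) :
    A.det.re ^ ((Fintype.card m : ℝ)⁻¹) ≤ A.trace.re / Fintype.card m := by
  have h := Real.geom_mean_le_arith_mean Finset.univ (fun _ : m => (1 : ℝ)) hA.1.eigenvalues
    (fun _ _ => zero_le_one) (by simp [Fintype.card_pos]) (fun i _ => hA.eigenvalues_nonneg i)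
  have hd : A.det.re = ∏ i, hA.1.eigenvalues i := by
    rw [hA.1.det_eq_prod_eigenvalues]
    simp [← Complex.ofReal_prod]
  have ht : A.trace.re = ∑ i, hA.1.eigenvalues i := by
    rw [hA.1.trace_eq_sum_eigenvalues]
    simp
  rw [hd, ht]
  simpa using h

lemma Matrix.PosSemidef.det_eq_re {A : Matrix m m ℂ} (hA : A.PosSemidef) :
    A.det = (A.det.re : ℂ) :=
  Complex.ext rfl (by simpa using (Complex.le_def.1 hA.det_nonneg).2.symm)

/-- **Minkowski's determinant inequality**, in the form of a superadditive bound: if finitely many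
positive semidefinite matrices sum to at most `C`, then so do the `n`-th roots of their
determinants. -/
lemma Matrix.PosDef.sum_det_rpow_le [Nonempty m] {ι : Type*} (s : Finset ι)
    {A : ι → Matrix m m ℂ} {C : Matrix m m ℂ} (hA : ∀ i ∈ s, (A i).PosSemidef) (hC : C.PosDef)
    (hle : (C - ∑ i ∈ s, A i).PosSemidef) :
    ∑ i ∈ s, (A i).det.re ^ ((Fintype.card m : ℝ)⁻¹) ≤ C.det.re ^ ((Fintype.card m : ℝ)⁻¹) := by
  obtain ⟨B, hB⟩ := CStarAlgebra.nonneg_iff_eq_star_mul_self.mp hC.posSemidef.nonneg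
  rw [star_eq_conjTranspose] at hB
  have hCdet : C.det = (Complex.normSq B.det : ℂ) := by
    rw [hB, det_mul, det_conjTranspose, Complex.normSq_eq_conj_mul_self]; rfl
  have hBdet : B.det ≠ 0 := by
    intro h0
    have := hC.det_pos
    simp [hCdet, h0] at this
  have hBu : IsUnit B.det := isUnit_iff_ne_zero.2 hBdet
  have hpos : 0 < Complex.normSq B.det := Complex.normSq_pos.2 hBdet
  set N : ℝ := (Fintype.card m : ℝ) with hN
  have hN0 : 0 < N := by simp [hN, Fintype.card_pos]
  set D : Matrix m m ℂ := B⁻¹ with hD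
  have hAD : ∀ i ∈ s, (A i).det.re ^ N⁻¹ ≤
      (Complex.normSq B.det) ^ N⁻¹ * ((Dᴴ * A i * D).trace.re / N) := by
    intro i hi
    have hps := (hA i hi).conjTranspose_mul_mul_same D
    have h1 := hps.det_rpow_le_trace
    have h2 : (A i).det.re = Complex.normSq B.det * (Dᴴ * A i * D).det.re := by
      rw [det_mul, det_mul, det_conjTranspose, (hA i hi).det_eq_re, hD, det_nonsing_inv,
        Ring.inverse_eq_inv']
      have : star (B.det)⁻¹ * ((A i).det.re : ℂ) * (B.det)⁻¹
          = (((A i).det.re * (Complex.normSq B.det)⁻¹ : ℝ) : ℂ) := by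
        push_cast
        rw [← Complex.ofReal_inv, ← Complex.normSq_inv, Complex.normSq_eq_conj_mul_self]
        simp only [Complex.star_def]
        ring
      rw [this, Complex.ofReal_re, Complex.ofReal_re]
      field_simp
    have h3 : 0 ≤ (Dᴴ * A i * D).det.re := (Complex.le_def.1 hps.det_nonneg).1
    rw [h2, Real.mul_rpow hpos.le h3]
    gcongr
  have htr : ∑ i ∈ s, (Dᴴ * A i * D).trace.re ≤ N := by
    have h0 := (hle.conjTranspose_mul_mul_same D).trace_nonneg
    have hCD : Dᴴ * C * D = 1 := by
      rw [hB, hD, conjTranspose_nonsing_inv]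
      have hBu' : IsUnit (Bᴴ).det := by rw [det_conjTranspose]; exact hBu.star
      rw [← Matrix.mul_assoc, nonsing_inv_mul _ hBu', Matrix.one_mul, mul_nonsing_inv _ hBu]
    rw [Matrix.mul_sub, Matrix.sub_mul, hCD, Matrix.mul_sum, Matrix.sum_mul, trace_sub, trace_one,
      trace_sum] at h0
    have h1 := (Complex.le_def.1 h0).1
    simp only [Complex.zero_re, Complex.sub_re, Complex.natCast_re, Complex.re_sum] at h1
    linarith
  calc ∑ i ∈ s, (A i).det.re ^ N⁻¹
      ≤ ∑ i ∈ s, (Complex.normSq B.det) ^ N⁻¹ * ((Dᴴ * A i * D).trace.re / N) :=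
        Finset.sum_le_sum hAD
    _ = (Complex.normSq B.det) ^ N⁻¹ * ((∑ i ∈ s, (Dᴴ * A i * D).trace.re) / N) := by
        rw [← Finset.mul_sum, Finset.sum_div]
    _ ≤ (Complex.normSq B.det) ^ N⁻¹ * 1 := by
        gcongr
        rw [div_le_one hN0]; exact htr
    _ = C.det.re ^ N⁻¹ := by rw [hCdet, Complex.ofReal_re, mul_one]

end DetInequality

section Taylor

variable {V W : Type*} [NormedAddCommGroup V] [NormedSpace ℝ V]
  [NormedAddCommGroup W] [NormedSpace ℝ W]

/-- First-order Taylor estimate for a function with Hölder continuous derivative. -/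
lemma Convex.norm_sub_sub_le_of_holder_fderiv {s : Set V} (hs : Convex ℝ s) {f : V → W}
    {f' : V → V →L[ℝ] W} (hf : ∀ x ∈ s, HasFDerivWithinAt f (f' x) s x) {K α : ℝ}
    (hK : 0 ≤ K) (hα : 0 ≤ α)
    (hf' : ∀ x ∈ s, ∀ y ∈ s, ‖f' x - f' y‖ ≤ K * ‖x - y‖ ^ α) {x y : V} (hx : x ∈ s)
    (hy : y ∈ s) : ‖f y - f x - f' x (y - x)‖ ≤ K * ‖y - x‖ ^ (1 + α) := by
  have hseg : segment ℝ x y ⊆ s := hs.segment_subset hx hy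
  have h := Convex.norm_image_sub_le_of_norm_hasFDerivWithin_le' (f := f) (f' := f') (φ := f' x)
    (C := K * ‖y - x‖ ^ α) (s := segment ℝ x y) (x := x) (y := y)
    (fun z hz => (hf z (hseg hz)).mono hseg) (fun z hz => by
      refine (hf' z (hseg hz) x hx).trans ?_
      have : ‖z - x‖ ≤ ‖y - x‖ := norm_sub_le_of_mem_segment hz
      gcongr) (convex_segment x y) (left_mem_segment ℝ x y) (right_mem_segment ℝ x y)
  refine h.trans (le_of_eq ?_)
  rw [Real.rpow_add' (norm_nonneg _) (by positivity), Real.rpow_one]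
  ring

/-- Second difference estimate, along a possibly non-symmetric triple of points, for a function
with Hölder continuous derivative. -/
lemma Convex.norm_second_difference_le {s : Set V} (hs : Convex ℝ s) {f : V → W}
    {f' : V → V →L[ℝ] W} (hf : ∀ x ∈ s, HasFDerivWithinAt f (f' x) s x) {K α : ℝ}
    (hK : 0 ≤ K) (hα : 0 ≤ α)
    (hf' : ∀ x ∈ s, ∀ y ∈ s, ‖f' x - f' y‖ ≤ K * ‖x - y‖ ^ α) {p q r : V} (hp : p ∈ s)
    (hq : q ∈ s) (hr : r ∈ s) :
    ‖f p + f q - (2 : ℝ) • f r‖ ≤ K * ‖p - r‖ ^ (1 + α) + K * ‖q - r‖ ^ (1 + α)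
      + ‖f' r‖ * ‖p + q - (2 : ℝ) • r‖ := by
  have h1 := hs.norm_sub_sub_le_of_holder_fderiv hf hK hα hf' hr hp
  have h2 := hs.norm_sub_sub_le_of_holder_fderiv hf hK hα hf' hr hq
  have h3 := (f' r).le_opNorm (p + q - (2 : ℝ) • r)
  have h4 : f p + f q - (2 : ℝ) • f r = (f p - f r - f' r (p - r)) + (f q - f r - f' r (q - r))
      + f' r (p + q - (2 : ℝ) • r) := by
    simp only [map_sub, map_add, two_smul]
    abel
  rw [h4]
  exact (norm_add₃_le).trans (by gcongr)

open Asymptotics Filter Topology in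
/-- Second-order Taylor expansion with Peano remainder. -/
lemma ContDiffAt.isLittleO_sq {f : V → ℝ} {p : V} (hf : ContDiffAt ℝ 2 f p) :
    (fun w => f (p + w) - f p - fderiv ℝ f p w - (1 / 2) * fderiv ℝ (fderiv ℝ f) p w w)
      =o[𝓝 0] fun w => ‖w‖ ^ 2 := by
  have hfd : ContDiffAt ℝ 1 (fderiv ℝ f) p := hf.fderiv_right (by norm_num)
  have hD : HasFDerivAt (fderiv ℝ f) (fderiv ℝ (fderiv ℝ f) p) p :=
    (hfd.differentiableAt (by norm_num)).hasFDerivAt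
  have hsym : IsSymmSndFDerivAt ℝ f p := hf.isSymmSndFDerivAt (by simp)
  set Q := fderiv ℝ (fderiv ℝ f) p with hQ
  rw [isLittleO_iff]
  intro c hc
  have h1 : ∀ᶠ w in 𝓝 (0 : V), ‖fderiv ℝ f (p + w) - fderiv ℝ f p - Q w‖ ≤ c * ‖w‖ :=
    (isLittleO_iff.1 (hasFDerivAt_iff_isLittleO_nhds_zero.1 hD)) hc
  have h2 : ∀ᶠ w in 𝓝 (0 : V), DifferentiableAt ℝ f (p + w) := by
    have : ∀ᶠ z in 𝓝 p, DifferentiableAt ℝ f z :=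
      (hf.eventually (by simp)).mono fun z hz => hz.differentiableAt (by norm_num)
    have ht : Tendsto (fun w : V => p + w) (𝓝 0) (𝓝 p) := by
      simpa using (continuous_const_add p).tendsto 0
    exact ht.eventually this
  obtain ⟨ε, hε, hball⟩ := Metric.eventually_nhds_iff_ball.1 (h1.and h2)
  filter_upwards [Metric.ball_mem_nhds (0 : V) hε] with w hw
  have hsub : ∀ z ∈ segment ℝ (0 : V) w, z ∈ ball (0 : V) ε := fun z hz =>
    (convex_ball (0 : V) ε).segment_subset (mem_ball_self hε) hw hz
  have h := Convex.norm_image_sub_le_of_norm_hasFDerivWithin_le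
    (f := fun w => f (p + w) - f p - fderiv ℝ f p w - (1 / 2) * Q w w)
    (f' := fun w => fderiv ℝ f (p + w) - fderiv ℝ f p - Q w)
    (C := c * ‖w‖) (s := segment ℝ (0 : V) w) (x := 0) (y := w) (fun z hz => by
      have hz' := (hball z (hsub z hz)).2
      have e1 : HasFDerivAt (fun w => f (p + w)) (fderiv ℝ f (p + z)) z :=
        (hasFDerivAt_comp_add_left p).2 hz'.hasFDerivAt
      have e2 : HasFDerivAt (fun w => (1 / 2 : ℝ) * Q w w) (Q z) z := by
        have := (Q.hasFDerivAt.clm_apply (hasFDerivAt_id z)).const_mul (1 / 2 : ℝ)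
        refine this.congr_fderiv ?_
        ext v
        have : Q z v = Q v z := hsym z v
        simp [this]
        ring
      exact (((e1.sub_const _).sub (fderiv ℝ f p).hasFDerivAt).sub e2).hasFDerivWithinAt)
    (fun z hz => by
      refine ((hball z (hsub z hz)).1).trans ?_
      have : ‖z - 0‖ ≤ ‖w - 0‖ := norm_sub_le_of_mem_segment hz
      simp only [sub_zero] at this
      gcongr)
    (convex_segment 0 w) (left_mem_segment ℝ 0 w) (right_mem_segment ℝ 0 w)
  have h' : ‖f (p + w) - f p - fderiv ℝ f p w - (1 / 2) * Q w w‖ ≤ c * ‖w‖ * ‖w‖ := by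
    simpa using h
  rw [norm_pow, norm_norm]
  linarith [h', (by ring : c * ‖w‖ * ‖w‖ = c * ‖w‖ ^ 2)]

open Asymptotics Filter Topology in
/-- Second-order behaviour of a `C²` function along a curve. -/
lemma ContDiffAt.tendsto_second_order_curve {f : V → ℝ} {p m : V} (hf : ContDiffAt ℝ 2 f p)
    {c : ℝ → V} (hc : Tendsto (fun s => s⁻¹ • c s) (𝓝[≠] 0) (𝓝 m)) :
    Tendsto (fun s => (f (p + c s) - f p - fderiv ℝ f p (c s)) / s ^ 2) (𝓝[≠] 0)
      (𝓝 ((1 / 2) * fderiv ℝ (fderiv ℝ f) p m m)) := by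
  set Q := fderiv ℝ (fderiv ℝ f) p with hQ
  have hs0 : Tendsto (fun s : ℝ => s) (𝓝[≠] 0) (𝓝 0) :=
    tendsto_nhdsWithin_of_tendsto_nhds tendsto_id
  have hne : ∀ᶠ s : ℝ in 𝓝[≠] 0, s ≠ 0 := eventually_mem_nhdsWithin
  have hc0 : Tendsto c (𝓝[≠] 0) (𝓝 0) := by
    have := hs0.smul hc
    rw [zero_smul] at this
    refine this.congr' ?_
    filter_upwards [hne] with s hs
    rw [smul_inv_smul₀ hs]
  have hR := (hf.isLittleO_sq.comp_tendsto hc0)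
  have hO : (fun s => ‖c s‖ ^ 2) =O[𝓝[≠] 0] fun s : ℝ => s ^ 2 := by
    have h1 : (fun s => s⁻¹ • c s) =O[𝓝[≠] 0] fun _ : ℝ => (1 : ℝ) := hc.isBigO_one ℝ
    have h2 : c =O[𝓝[≠] 0] fun s : ℝ => s := by
      have := (isBigO_refl (fun s : ℝ => s) (𝓝[≠] 0)).smul h1
      refine this.congr' ?_ (by simp)
      filter_upwards [hne] with s hs
      rw [smul_inv_smul₀ hs]
    exact h2.norm_left.pow 2
  have hR' := (hR.trans_isBigO hO).tendsto_div_nhds_zero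
  have hQt : Tendsto (fun s : ℝ => (1 / 2) * Q (s⁻¹ • c s) (s⁻¹ • c s)) (𝓝[≠] 0)
      (𝓝 ((1 / 2) * Q m m)) := by
    have hcont : Continuous fun w : V => (1 / 2) * Q w w := by fun_prop
    exact (hcont.tendsto m).comp hc
  have := hR'.add hQt
  rw [zero_add] at this
  refine this.congr' ?_
  filter_upwards [hne] with s hs
  simp only [Function.comp, map_smul, _root_.smul_apply, smul_eq_mul]
  field_simp
  ring

end Taylor

section Levi

open Filter Topology

variable {V : Type*} [NormedAddCommGroup V] [NormedSpace ℂ V] [NormedSpace ℝ V]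
  [IsScalarTower ℝ ℂ V]

/-- The real Levi form `D²u(m, m) + D²u(im, im)` of `u` at `p`. -/
noncomputable def leviForm (u : V → ℝ) (p m : V) : ℝ :=
  fderiv ℝ (fderiv ℝ u) p m m
    + fderiv ℝ (fderiv ℝ u) p (Complex.I • m) (Complex.I • m)

/-- The parameter change `σ ↦ σ / (1 + σ κ)` along a complex line under a projective map. -/
noncomputable def mobiusParam (κ σ : ℂ) : ℂ := σ / (1 + σ * κ)

lemma tendsto_inv_smul_mobiusParam (κ ζ : ℂ) (m : V) :
    Tendsto (fun s : ℝ => s⁻¹ • (mobiusParam κ (ζ * s) • m)) (𝓝[≠] 0) (𝓝 (ζ • m)) := by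
  have hcont : ContinuousAt (fun s : ℝ => (ζ / (1 + ζ * s * κ)) • m) 0 := by
    refine ContinuousAt.smul (ContinuousAt.div continuousAt_const (by fun_prop) (by simp))
      continuousAt_const
  have h := hcont.tendsto.mono_left (nhdsWithin_le_nhds (s := {0}ᶜ))
  simp only [Complex.ofReal_zero, mul_zero, zero_mul, add_zero, div_one] at h
  refine h.congr' ?_
  filter_upwards [eventually_mem_nhdsWithin] with s hs
  have hs' : (s : ℂ) ≠ 0 := by exact_mod_cast hs
  rw [← smul_assoc]
  congr 1
  rw [mobiusParam, Complex.real_smul, Complex.ofReal_inv]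
  field_simp

lemma tendsto_sum_mobiusParam (κ : ℂ) :
    Tendsto (fun s : ℝ => ((s : ℂ) ^ 2)⁻¹ * (mobiusParam κ (1 * s) + mobiusParam κ (-1 * s)
      + mobiusParam κ (Complex.I * s) + mobiusParam κ (-Complex.I * s))) (𝓝[≠] 0) (𝓝 0) := by
  have hcont : ContinuousAt (fun s : ℝ => -4 * κ ^ 3 * (s : ℂ) ^ 2 / (1 - κ ^ 4 * (s : ℂ) ^ 4)) 0 :=
    ContinuousAt.div (by fun_prop) (by fun_prop) (by simp)
  have h := hcont.tendsto.mono_left (nhdsWithin_le_nhds (s := {0}ᶜ))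
  have hne : ∀ ζ : ℂ, ∀ᶠ s : ℝ in 𝓝[≠] 0, 1 + ζ * (s : ℂ) * κ ≠ 0 := fun ζ =>
    ((by fun_prop : Continuous fun s : ℝ => 1 + ζ * (s : ℂ) * κ).continuousAt.eventually_ne
      (by simp)).filter_mono nhdsWithin_le_nhds
  simp only [Complex.ofReal_zero, ne_eq, OfNat.ofNat_ne_zero, not_false_eq_true, zero_pow, mul_zero,
    zero_div] at h
  refine h.congr' ?_
  filter_upwards [eventually_mem_nhdsWithin, hne 1, hne (-1), hne Complex.I, hne (-Complex.I)]
    with s hs h1 h2 h3 h4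
  have hs' : (s : ℂ) ≠ 0 := by exact_mod_cast hs
  simp only [mobiusParam]
  have hI : (1 + Complex.I * s * κ) * (1 + -Complex.I * s * κ) = 1 + κ ^ 2 * (s : ℂ) ^ 2 := by
    linear_combination (-(κ ^ 2 * (s : ℂ) ^ 2)) * Complex.I_sq
  have hR : (1 + 1 * (s : ℂ) * κ) * (1 + -1 * s * κ) = 1 - κ ^ 2 * (s : ℂ) ^ 2 := by ring
  have e1 : 1 * (s : ℂ) / (1 + 1 * s * κ) + -1 * s / (1 + -1 * s * κ)
      = -2 * κ * (s : ℂ) ^ 2 / (1 - κ ^ 2 * (s : ℂ) ^ 2) := by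
    rw [div_add_div _ _ h1 h2, hR]; congr 1; ring
  have e2 : Complex.I * (s : ℂ) / (1 + Complex.I * s * κ)
      + -Complex.I * s / (1 + -Complex.I * s * κ)
      = 2 * κ * (s : ℂ) ^ 2 / (1 + κ ^ 2 * (s : ℂ) ^ 2) := by
    rw [div_add_div _ _ h3 h4, hI]; congr 1
    linear_combination (-2 * (κ * (s : ℂ) ^ 2)) * Complex.I_sq
  have hR0 : 1 - κ ^ 2 * (s : ℂ) ^ 2 ≠ 0 := hR ▸ mul_ne_zero h1 h2
  have hI0 : 1 + κ ^ 2 * (s : ℂ) ^ 2 ≠ 0 := hI ▸ mul_ne_zero h3 h4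
  rw [add_assoc, e1, e2, div_add_div _ _ hR0 hI0,
    show 1 - κ ^ 4 * (s : ℂ) ^ 4 = (1 - κ ^ 2 * (s : ℂ) ^ 2) * (1 + κ ^ 2 * (s : ℂ) ^ 2) by ring]
  field_simp
  ring

/-- The Levi form as a limit of four-point averages along a projectively parametrized complex
line. -/
lemma ContDiffAt.tendsto_four_point {u : V → ℝ} {p : V} (hu : ContDiffAt ℝ 2 u p) (κ : ℂ) (m : V) :
    Tendsto (fun s : ℝ => (u (p + mobiusParam κ (1 * s) • m) + u (p + mobiusParam κ (-1 * s) • m)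
      + u (p + mobiusParam κ (Complex.I * s) • m) + u (p + mobiusParam κ (-Complex.I * s) • m)
      - 4 * u p) / s ^ 2) (𝓝[≠] 0) (𝓝 (leviForm u p m)) := by
  have h := fun ζ : ℂ => hu.tendsto_second_order_curve (tendsto_inv_smul_mobiusParam κ ζ m)
  have hlin : Tendsto (fun s : ℝ => fderiv ℝ u p ((((s : ℂ) ^ 2)⁻¹ * (mobiusParam κ (1 * s)
      + mobiusParam κ (-1 * s) + mobiusParam κ (Complex.I * s)
      + mobiusParam κ (-Complex.I * s))) • m)) (𝓝[≠] 0) (𝓝 0) := by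
    have h0 := (tendsto_sum_mobiusParam κ).smul_const m
    rw [zero_smul] at h0
    have h1 := ((fderiv ℝ u p).continuous.tendsto 0).comp h0
    rw [map_zero] at h1
    exact h1
  have := ((((h 1).add (h (-1))).add (h Complex.I)).add (h (-Complex.I))).add hlin
  have hlim : (1 / 2 * fderiv ℝ (fderiv ℝ u) p ((1 : ℂ) • m) ((1 : ℂ) • m)
      + 1 / 2 * fderiv ℝ (fderiv ℝ u) p ((-1 : ℂ) • m) ((-1 : ℂ) • m)
      + 1 / 2 * fderiv ℝ (fderiv ℝ u) p (Complex.I • m) (Complex.I • m)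
      + 1 / 2 * fderiv ℝ (fderiv ℝ u) p ((-Complex.I) • m) ((-Complex.I) • m) + 0)
      = leviForm u p m := by
    simp only [one_smul, neg_smul, map_neg, _root_.neg_apply, leviForm]
    ring
  rw [hlim] at this
  refine this.congr fun s => ?_
  have e : ∀ c : ℂ, (((s : ℂ) ^ 2)⁻¹ * c) • m = (s ^ 2)⁻¹ • (c • m) := fun c => by
    rw [← smul_assoc, Complex.real_smul]
    push_cast
    rfl
  rw [e, (fderiv ℝ u p).map_smul (s ^ 2)⁻¹, add_smul, add_smul, add_smul,
    map_add, map_add, map_add, smul_eq_mul]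
  ring

end Levi

section LeviMatrix

open Matrix

/-- The Levi form is the Hermitian form of the complex Hessian. -/
lemma leviForm_eq_cxHessian {n : ℕ} {u : EuclideanSpace ℂ (Fin n) → ℝ}
    {z : EuclideanSpace ℂ (Fin n)} (hu : ContDiffAt ℝ 2 u z) (m : EuclideanSpace ℂ (Fin n)) :
    leviForm u z m = 4 * (star (star m.ofLp) ⬝ᵥ (cxHessian n u z *ᵥ star m.ofLp)).re := by
  have hfd : DifferentiableAt ℝ (fderiv ℝ u) z :=
    (hu.fderiv_right (m := 1) (by norm_num)).differentiableAt (by norm_num)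
  set Q := fderiv ℝ (fderiv ℝ u) z with hQ
  have hQe : ∀ e v, fderiv ℝ (fun w => fderiv ℝ u w e) z v = Q v e := by
    intro e v
    rw [fderiv_clm_apply hfd (differentiableAt_const e)]
    simp [hQ]
  have hm : m = ∑ i, ((m i).re • EuclideanSpace.single i (1 : ℂ)
      + (m i).im • EuclideanSpace.single i Complex.I) := by
    ext j
    simp only [WithLp.ofLp_sum, Finset.sum_apply, WithLp.ofLp_add, WithLp.ofLp_smul, Pi.add_apply,
      Pi.smul_apply, PiLp.single_apply]
    simp [Finset.sum_add_distrib, Complex.re_add_im]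
  have hIm : Complex.I • m = ∑ i, ((m i).re • EuclideanSpace.single i Complex.I
      - (m i).im • EuclideanSpace.single i (1 : ℂ)) := by
    ext j
    simp only [WithLp.ofLp_sum, Finset.sum_apply, WithLp.ofLp_sub, WithLp.ofLp_smul, Pi.sub_apply,
      Pi.smul_apply, PiLp.single_apply]
    apply Complex.ext <;> simp [Finset.sum_sub_distrib]
  have hL : leviForm u z m = Q m m + Q (Complex.I • m) (Complex.I • m) := rfl
  have hQm := congrArg (fun x => Q x x) hm
  beta_reduce at hQm
  rw [hL, hIm, hQm]
  simp only [map_sum, map_add, map_sub, map_smul, _root_.sum_apply, _root_.add_apply,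
    _root_.sub_apply, _root_.smul_apply, smul_eq_mul, dotProduct, mulVec, Finset.mul_sum,
    cxHessian, of_apply, hQe, Complex.re_sum, ← Finset.sum_add_distrib,
    ← Finset.sum_sub_distrib]
  rw [Finset.sum_comm]
  refine Finset.sum_congr rfl fun i _ => Finset.sum_congr rfl fun j _ => ?_
  simp
  ring

end LeviMatrix

section BallAut

open Matrix

variable {V : Type*} [NormedAddCommGroup V] [InnerProductSpace ℂ V]

/-- The holomorphic automorphism of the unit ball taking `0` to `a`, see `ballAut_zero`. -/
noncomputable def ballAut (a y : V) : V :=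
  (1 + inner ℂ a y)⁻¹ • ((√(1 - ‖a‖ ^ 2) : ℂ) • y
    + (inner ℂ a y / (1 + (√(1 - ‖a‖ ^ 2) : ℂ)) + 1) • a)

/-- The vector `k` such that the derivative of `ballAut a` at `y` is a multiple of
`v ↦ v + ⟪a, v⟫ k`. -/
noncomputable def ballAutShift (a y : V) : V :=
  (√(1 - ‖a‖ ^ 2) : ℂ)⁻¹ • ((1 + (√(1 - ‖a‖ ^ 2) : ℂ))⁻¹ • a - ballAut a y)

/-- The derivative of `ballAut a` at `y` in the direction `v`. -/
noncomputable def ballAutDeriv (a y v : V) : V :=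
  ((√(1 - ‖a‖ ^ 2) : ℂ) / (1 + inner ℂ a y)) • (v + inner ℂ a v • ballAutShift a y)

lemma ballAut_zero (a : V) : ballAut a 0 = a := by simp [ballAut]

lemma one_add_inner_ne_zero {a y : V} (ha : ‖a‖ < 1) (hy : ‖y‖ ≤ 1) : 1 + inner ℂ a y ≠ 0 := by
  intro h
  have h1 : inner ℂ a y = -1 := by linear_combination h
  have h2 := norm_inner_le_norm (𝕜 := ℂ) a y
  rw [h1, norm_neg, norm_one] at h2
  nlinarith [norm_nonneg a, norm_nonneg y]

lemma sqrt_one_sub_sq_pos {r : ℝ} (hr0 : 0 ≤ r) (hr : r < 1) : 0 < √(1 - r ^ 2) :=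
  Real.sqrt_pos.2 (by nlinarith)

lemma sq_sqrt_one_sub_sq {r : ℝ} (hr0 : 0 ≤ r) (hr : r < 1) : √(1 - r ^ 2) ^ 2 = 1 - r ^ 2 :=
  Real.sq_sqrt (by nlinarith)

lemma normSq_mul_norm_ballAut_sq {a y : V} (ha : ‖a‖ < 1) (hy : ‖y‖ ≤ 1) :
    Complex.normSq (1 + inner ℂ a y) * ‖ballAut a y‖ ^ 2
      = Complex.normSq (1 + inner ℂ a y) - (1 - ‖a‖ ^ 2) * (1 - ‖y‖ ^ 2) := by
  have hd := one_add_inner_ne_zero ha hy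
  have hs := sqrt_one_sub_sq_pos (norm_nonneg _) ha
  have hs2 := sq_sqrt_one_sub_sq (norm_nonneg _) ha
  rw [ballAut, norm_smul, norm_inv, mul_pow, inv_pow, ← Complex.normSq_eq_norm_sq,
    mul_inv_cancel_left₀ (Complex.normSq_pos.2 hd).ne', norm_add_sq (𝕜 := ℂ), norm_smul, norm_smul,
    mul_pow, mul_pow, inner_smul_left, inner_smul_right, ← inner_conj_symm y a,
    ← Complex.normSq_eq_norm_sq, ← Complex.normSq_eq_norm_sq]
  set s := √(1 - ‖a‖ ^ 2)
  have ha2 : ‖a‖ ^ 2 = 1 - s ^ 2 := by linarith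
  rw [ha2]
  generalize inner ℂ a y = c
  have e : c / (1 + (s : ℂ)) = ((1 + s)⁻¹ : ℝ) * c := by push_cast; field_simp
  rw [e]
  simp only [Complex.normSq_apply, Complex.conj_ofReal, RCLike.re_to_complex, Complex.mul_re,
    Complex.mul_im, Complex.add_re, Complex.add_im, Complex.ofReal_re, Complex.ofReal_im,
    Complex.one_re, Complex.one_im, Complex.conj_re, Complex.conj_im]
  field_simp
  ring

lemma norm_ballAut_lt_one {a y : V} (ha : ‖a‖ < 1) (hy : ‖y‖ < 1) : ‖ballAut a y‖ < 1 := by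
  have h := normSq_mul_norm_ballAut_sq ha hy.le
  have hd := Complex.normSq_pos.2 (one_add_inner_ne_zero ha hy.le)
  have h1 : 0 < (1 - ‖a‖ ^ 2) * (1 - ‖y‖ ^ 2) :=
    mul_pos (by nlinarith [norm_nonneg a]) (by nlinarith [norm_nonneg y])
  by_contra! h2
  have : 1 ≤ ‖ballAut a y‖ ^ 2 := one_le_pow₀ h2
  nlinarith

lemma norm_ballAut_eq_one {a y : V} (ha : ‖a‖ < 1) (hy : ‖y‖ = 1) : ‖ballAut a y‖ = 1 := by
  have h := normSq_mul_norm_ballAut_sq ha hy.le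
  have hd := Complex.normSq_pos.2 (one_add_inner_ne_zero ha hy.le)
  rw [hy, one_pow, sub_self, mul_zero, sub_zero, mul_eq_left₀ hd.ne'] at h
  exact (pow_eq_one_iff_of_nonneg (norm_nonneg _) two_ne_zero).1 h

lemma ballAut_add_smul {a y v : V} (ha : ‖a‖ < 1) (hy : ‖y‖ ≤ 1) {σ : ℂ} (hσ : ‖y + σ • v‖ ≤ 1) :
    ballAut a (y + σ • v) = ballAut a y
      + mobiusParam (inner ℂ a v / (1 + inner ℂ a y)) σ • ballAutDeriv a y v := by
  have hd := one_add_inner_ne_zero ha hy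
  have hd' := one_add_inner_ne_zero ha hσ
  have hs : (√(1 - ‖a‖ ^ 2) : ℂ) ≠ 0 := by
    exact_mod_cast (sqrt_one_sub_sq_pos (norm_nonneg _) ha).ne'
  have hs1 : 1 + (√(1 - ‖a‖ ^ 2) : ℂ) ≠ 0 := by
    exact_mod_cast (add_pos one_pos (sqrt_one_sub_sq_pos (norm_nonneg _) ha)).ne'
  rw [inner_add_right, inner_smul_right] at hd'
  simp only [ballAutDeriv, ballAutShift, ballAut, mobiusParam, inner_add_right, inner_smul_right]
  generalize (√(1 - ‖a‖ ^ 2) : ℂ) = s at *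
  generalize inner ℂ a y = c at *
  generalize inner ℂ a v = e at *
  have hk : 1 + σ * (e / (1 + c)) ≠ 0 := by
    intro h
    apply hd'
    field_simp at h
    linear_combination h
  have hmob : σ / (1 + σ * (e / (1 + c))) = σ * (1 + c) / (1 + (c + σ * e)) := by
    rw [div_eq_div_iff hk hd']
    field_simp
    ring
  rw [hmob]
  match_scalars <;> field_simp <;> ring

lemma inner_ballAutShift {a y : V} (ha : ‖a‖ < 1) (hy : ‖y‖ ≤ 1) :
    1 + inner ℂ a (ballAutShift a y) = (√(1 - ‖a‖ ^ 2) : ℂ) / (1 + inner ℂ a y) := by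
  have hd := one_add_inner_ne_zero ha hy
  have hs : (√(1 - ‖a‖ ^ 2) : ℂ) ≠ 0 := by
    exact_mod_cast (sqrt_one_sub_sq_pos (norm_nonneg _) ha).ne'
  have hs1 : 1 + (√(1 - ‖a‖ ^ 2) : ℂ) ≠ 0 := by
    exact_mod_cast (add_pos one_pos (sqrt_one_sub_sq_pos (norm_nonneg _) ha)).ne'
  have hs2 : (RCLike.ofReal ‖a‖ : ℂ) ^ 2 = 1 - (√(1 - ‖a‖ ^ 2) : ℂ) ^ 2 := by
    have := sq_sqrt_one_sub_sq (norm_nonneg _) ha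
    have := congrArg Complex.ofReal (by linarith : ‖a‖ ^ 2 = 1 - √(1 - ‖a‖ ^ 2) ^ 2)
    push_cast at this
    exact this
  simp only [ballAutShift, ballAut, inner_smul_right, inner_sub_right, inner_add_right,
    inner_self_eq_norm_sq_to_K]
  rw [hs2]
  generalize (√(1 - ‖a‖ ^ 2) : ℂ) = s at *
  generalize inner ℂ a y = c at *
  field_simp
  ring

lemma contDiffAt_ballAut [NormedSpace ℝ V] [IsScalarTower ℝ ℂ V]
    {q : V × V} (ha : ‖q.1‖ < 1) (hy : ‖q.2‖ ≤ 1) :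
    ContDiffAt ℝ 2 (fun q : V × V => ballAut q.1 q.2) q := by
  have hinner : ContDiffAt ℝ 2 (fun q : V × V => inner ℂ q.1 q.2) q :=
    contDiffAt_fst.inner ℂ contDiffAt_snd
  have hs : ContDiffAt ℝ 2 (fun q : V × V => (√(1 - ‖q.1‖ ^ 2) : ℂ)) q := by
    refine Complex.ofRealCLM.contDiff.contDiffAt.comp q ?_
    refine ContDiffAt.sqrt (contDiffAt_const.sub (contDiffAt_fst.norm_sq ℂ)) ?_
    nlinarith [norm_nonneg q.1]
  have hs1 : 1 + (√(1 - ‖q.1‖ ^ 2) : ℂ) ≠ 0 := by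
    exact_mod_cast (add_pos one_pos (sqrt_one_sub_sq_pos (norm_nonneg _) ha)).ne'
  refine ContDiffAt.smul ((contDiffAt_const.add hinner).inv (one_add_inner_ne_zero ha hy)) ?_
  refine (hs.smul contDiffAt_snd).add (ContDiffAt.smul ?_ contDiffAt_fst)
  refine ContDiffAt.add ?_ contDiffAt_const
  simp only [div_eq_mul_inv]
  exact hinner.mul ((contDiffAt_const.add hs).inv hs1)

/-- The factor by which `ballAut a` changes the `n`-th root of a complex Monge-Ampère measure. -/
noncomputable def ballAutWeight (n : ℕ) (a y : V) : ℝ :=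
  ((1 - ‖a‖ ^ 2) / Complex.normSq (1 + inner ℂ a y)) ^ (((n : ℝ) + 1) / n)

lemma one_sub_sq_div_normSq_pos {a y : V} (ha : ‖a‖ < 1) (hy : ‖y‖ ≤ 1) :
    0 < (1 - ‖a‖ ^ 2) / Complex.normSq (1 + inner ℂ a y) :=
  div_pos (by nlinarith [norm_nonneg a]) (Complex.normSq_pos.2 (one_add_inner_ne_zero ha hy))

lemma contDiffAt_ballAutWeight [NormedSpace ℝ V] [IsScalarTower ℝ ℂ V] (n : ℕ)
    {q : V × V} (ha : ‖q.1‖ < 1) (hy : ‖q.2‖ ≤ 1) :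
    ContDiffAt ℝ 2 (fun q : V × V => ballAutWeight n q.1 q.2) q := by
  have hinner : ContDiffAt ℝ 2 (fun q : V × V => 1 + inner ℂ q.1 q.2) q :=
    contDiffAt_const.add (contDiffAt_fst.inner ℂ contDiffAt_snd)
  have hpos := one_sub_sq_div_normSq_pos ha hy
  simp only [Complex.normSq_eq_norm_sq] at hpos
  simp only [ballAutWeight, Complex.normSq_eq_norm_sq]
  refine ContDiffAt.rpow_const_of_ne ?_ hpos.ne'
  refine (contDiffAt_const.sub (contDiffAt_fst.norm_sq ℂ)).div (hinner.norm_sq ℂ) ?_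
  exact pow_ne_zero 2 (norm_ne_zero_iff.2 (one_add_inner_ne_zero ha hy))

/-- The complex conjugate of the Jacobian matrix of `ballAut a` at `y`. -/
noncomputable def ballAutMatrix {n : ℕ} (a y : EuclideanSpace ℂ (Fin n)) :
    Matrix (Fin n) (Fin n) ℂ :=
  star ((√(1 - ‖a‖ ^ 2) : ℂ) / (1 + inner ℂ a y)) •
    (1 + replicateCol Unit (star (ballAutShift a y).ofLp) * replicateRow Unit a.ofLp)

lemma ballAutMatrix_mulVec {n : ℕ} (a y v : EuclideanSpace ℂ (Fin n)) :
    ballAutMatrix a y *ᵥ star v.ofLp = star (ballAutDeriv a y v).ofLp := by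
  ext i
  have h : replicateRow Unit a.ofLp *ᵥ star v.ofLp = fun _ => star (inner ℂ a v) := by
    ext
    simp [EuclideanSpace.inner_eq_star_dotProduct, mulVec, dotProduct, mul_comm]
  rw [ballAutMatrix, smul_mulVec, add_mulVec, one_mulVec, ← mulVec_mulVec, h]
  simp [mulVec, dotProduct, ballAutDeriv]
  ring

lemma normSq_det_ballAutMatrix {n : ℕ} {a y : EuclideanSpace ℂ (Fin n)} (ha : ‖a‖ < 1)
    (hy : ‖y‖ ≤ 1) : Complex.normSq (ballAutMatrix a y).det
      = ((1 - ‖a‖ ^ 2) / Complex.normSq (1 + inner ℂ a y)) ^ (n + 1) := by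
  have h : 1 + a.ofLp ⬝ᵥ star (ballAutShift a y).ofLp
      = star ((√(1 - ‖a‖ ^ 2) : ℂ) / (1 + inner ℂ a y)) := by
    rw [← inner_ballAutShift ha hy, ← EuclideanSpace.inner_eq_star_dotProduct]
    simp
  rw [ballAutMatrix, det_smul, det_one_add_replicateCol_mul_replicateRow, h, Fintype.card_fin,
    ← pow_succ, map_pow, Complex.star_def, Complex.normSq_conj, Complex.normSq_div,
    Complex.normSq_ofReal, ← sq, sq_sqrt_one_sub_sq (norm_nonneg _) ha]

lemma normSq_det_ballAutMatrix_rpow {n : ℕ} {a y : EuclideanSpace ℂ (Fin n)}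
    (ha : ‖a‖ < 1) (hy : ‖y‖ ≤ 1) :
    Complex.normSq (ballAutMatrix a y).det ^ ((n : ℝ)⁻¹) = ballAutWeight n a y := by
  rw [normSq_det_ballAutMatrix ha hy, ballAutWeight, ← Real.rpow_natCast, ← Real.rpow_mul
    (one_sub_sq_div_normSq_pos ha hy).le]
  push_cast
  rfl

end BallAut

section Compact

variable {V E W : Type*} [NormedAddCommGroup V] [NormedSpace ℝ V]
  [NormedAddCommGroup E] [NormedSpace ℝ E] [NormedAddCommGroup W] [NormedSpace ℝ W]

/-- A `C²` function of two variables on a product of compact sets is bounded, Lipschitz, and has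
quadratic second differences in the first variable, uniformly in the second one. -/
lemma IsCompact.exists_second_difference_le {F : V × E → W} {s : Set V} {T : Set E}
    (hs : IsCompact s) (hsc : Convex ℝ s) (hT : IsCompact T)
    (hF : ∀ q ∈ s ×ˢ T, ContDiffAt ℝ 2 F q) :
    ∃ L : ℝ, 1 ≤ L ∧ ∀ y ∈ T, ∀ a ∈ s, ∀ h, a + h ∈ s → a - h ∈ s →
      ‖F (a, y)‖ ≤ L ∧ ‖F (a + h, y) - F (a, y)‖ ≤ L * ‖h‖ ∧
      ‖F (a - h, y) - F (a, y)‖ ≤ L * ‖h‖ ∧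
      ‖F (a + h, y) + F (a - h, y) - (2 : ℝ) • F (a, y)‖ ≤ L * ‖h‖ ^ 2 := by
  have hc := hs.prod hT
  have hD : ∀ q ∈ s ×ˢ T, ContDiffAt ℝ 1 (fderiv ℝ F) q := fun q hq =>
    (hF q hq).fderiv_right (by norm_num)
  obtain ⟨M₀, hM₀⟩ := hc.exists_bound_of_continuousOn (f := F) fun q hq =>
    (hF q hq).continuousAt.continuousWithinAt
  obtain ⟨M₁, hM₁⟩ := hc.exists_bound_of_continuousOn (f := fderiv ℝ F) fun q hq =>
    (hD q hq).continuousAt.continuousWithinAt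
  obtain ⟨M₂, hM₂⟩ := hc.exists_bound_of_continuousOn (f := fderiv ℝ (fderiv ℝ F)) fun q hq =>
    ((hD q hq).fderiv_right (m := 0) (by norm_num)).continuousAt.continuousWithinAt
  refine ⟨max 1 (max M₀ (max M₁ (2 * M₂))), le_max_left _ _, fun y hy a ha h hp hm => ?_⟩
  have hsub : s ×ˢ {y} ⊆ s ×ˢ T := prod_mono_right (singleton_subset_iff.2 hy)
  have hconv : Convex ℝ (s ×ˢ {y}) := hsc.prod (convex_singleton y)
  have hmem : ∀ {b}, b ∈ s → (b, y) ∈ s ×ˢ ({y} : Set E) := fun hb => ⟨hb, rfl⟩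
  have hfd : ∀ q ∈ s ×ˢ {y}, HasFDerivWithinAt F (fderiv ℝ F q) (s ×ˢ {y}) q := fun q hq =>
    ((hF q (hsub hq)).differentiableAt (by norm_num)).hasFDerivAt.hasFDerivWithinAt
  have hlip : ∀ {b}, b ∈ s → ‖F (b, y) - F (a, y)‖ ≤ M₁ * ‖b - a‖ := fun {b} hb => by
    have := hconv.norm_image_sub_le_of_norm_hasFDerivWithin_le hfd
      (fun q hq => hM₁ q (hsub hq)) (hmem ha) (hmem hb)
    simpa [Prod.norm_def] using this
  have hM₂0 : 0 ≤ M₂ := (norm_nonneg _).trans (hM₂ (a, y) (hsub (hmem ha)))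
  have hlip2 : ∀ q ∈ s ×ˢ {y}, ∀ r ∈ s ×ˢ {y},
      ‖fderiv ℝ F q - fderiv ℝ F r‖ ≤ M₂ * ‖q - r‖ ^ (1 : ℝ) := fun q hq r hr => by
    rw [Real.rpow_one]
    exact hconv.norm_image_sub_le_of_norm_hasFDerivWithin_le (fun p hp =>
      ((hD p (hsub hp)).differentiableAt (by norm_num)).hasFDerivAt.hasFDerivWithinAt)
      (fun p hp => hM₂ p (hsub hp)) hr hq
  have h2 := hconv.norm_second_difference_le hfd hM₂0 zero_le_one hlip2 (hmem hp) (hmem hm)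
    (hmem ha)
  have e : ((a + h, y) + (a - h, y) - (2 : ℝ) • (a, y) : V × E) = 0 := by
    ext <;> simp [two_smul]
  rw [e, norm_zero, mul_zero, add_zero, show (1 : ℝ) + 1 = (2 : ℕ) by norm_num,
    Real.rpow_natCast, Real.rpow_natCast] at h2
  simp only [Prod.mk_sub_mk, sub_self, add_sub_cancel_left, sub_sub_cancel_left, Prod.norm_def,
    norm_zero, norm_neg, norm_nonneg, sup_of_le_left] at h2
  refine ⟨(hM₀ _ (hsub (hmem ha))).trans (by simp), (hlip hp).trans ?_, (hlip hm).trans ?_,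
    h2.trans ?_⟩
  · rw [add_sub_cancel_left]
    gcongr
    simp
  · rw [sub_sub_cancel_left, norm_neg]
    gcongr
    simp
  · rw [← two_mul, ← mul_assoc]
    gcongr
    simp

end Compact

section Differences

variable {V : Type*} [NormedAddCommGroup V] [NormedSpace ℝ V]

lemma sq_le_rpow_one_add {d α : ℝ} (hd : 0 ≤ d) (hd1 : d ≤ 1) (hα : α ≤ 1) :
    d ^ 2 ≤ d ^ (1 + α) := by
  rcases hd.eq_or_lt with rfl | hd0
  · simpa using Real.zero_rpow_nonneg (1 + α)
  · rw [← Real.rpow_natCast]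
    exact Real.rpow_le_rpow_of_exponent_ge hd0 hd1 (by push_cast; linarith)

/-- Second difference estimate in a closed ball along an almost symmetric triple of points. -/
lemma abs_second_difference_le_s4 {Φ : V → ℝ} (hΦ : ContinuousOn Φ (closedBall 0 1))
    (hΦd : DifferentiableOn ℝ Φ (ball 0 1)) {K M α d L : ℝ} (hα : 0 ≤ α) (hα1 : α ≤ 1)
    (hK : 0 ≤ K) (hK' : ∀ x ∈ ball (0 : V) 1, ∀ y ∈ ball (0 : V) 1,
      ‖fderiv ℝ Φ x - fderiv ℝ Φ y‖ ≤ K * ‖x - y‖ ^ α)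
    (hM : ∀ x ∈ ball (0 : V) 1, ‖fderiv ℝ Φ x‖ ≤ M) (hd : 0 ≤ d) (hd1 : d ≤ 1) (hL : 1 ≤ L)
    {p q r : V} (hp : p ∈ closedBall 0 1) (hq : q ∈ closedBall 0 1) (hr : r ∈ closedBall 0 1)
    (hpr : ‖p - r‖ ≤ L * d) (hqr : ‖q - r‖ ≤ L * d) (hpqr : ‖p + q - (2 : ℝ) • r‖ ≤ L * d ^ 2) :
    |Φ p + Φ q - 2 * Φ r| ≤ (2 * K + M) * L ^ 2 * d ^ (1 + α) := by
  have hM0 : 0 ≤ M := (norm_nonneg _).trans (hM 0 (mem_ball_self one_pos))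
  have hpow : (L * d) ^ (1 + α) ≤ L ^ 2 * d ^ (1 + α) := by
    rw [Real.mul_rpow (by linarith) hd, ← Real.rpow_natCast]
    gcongr
    push_cast
    linarith
  have hsq : L * d ^ 2 ≤ L ^ 2 * d ^ (1 + α) := by
    gcongr
    · nlinarith
    · exact sq_le_rpow_one_add hd hd1 hα1
  have hscale : ∀ {ρ : ℝ} {v : V} {c : ℝ}, ρ ∈ Ico (0 : ℝ) 1 → ‖v‖ ≤ c → ‖ρ • v‖ ≤ c := by
    intro ρ v c hρ hv
    rw [norm_smul, Real.norm_of_nonneg hρ.1]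
    nlinarith [norm_nonneg v, hρ.2]
  have hball : ∀ {ρ : ℝ} {v : V}, ρ ∈ Ico (0 : ℝ) 1 → v ∈ closedBall (0 : V) 1 →
      ρ • v ∈ ball (0 : V) 1 := by
    intro ρ v hρ hv
    rw [mem_closedBall_zero_iff] at hv
    rw [mem_ball_zero_iff, norm_smul, Real.norm_of_nonneg hρ.1]
    nlinarith [norm_nonneg v, hρ.1, hρ.2]
  have hopen : ∀ ρ ∈ Ico (0 : ℝ) 1,
      |Φ (ρ • p) + Φ (ρ • q) - 2 * Φ (ρ • r)| ≤ (2 * K + M) * L ^ 2 * d ^ (1 + α) := by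
    intro ρ hρ
    have h := (convex_ball (0 : V) 1).norm_second_difference_le (f := Φ) (f' := fderiv ℝ Φ)
      (fun x hx => (hΦd.differentiableAt (isOpen_ball.mem_nhds hx)).hasFDerivAt.hasFDerivWithinAt)
      hK hα hK' (hball hρ hp) (hball hρ hq) (hball hρ hr)
    rw [← smul_sub, ← smul_sub, smul_comm (2 : ℝ), ← smul_add, ← smul_sub] at h
    have h1 : ‖ρ • (p - r)‖ ^ (1 + α) ≤ L ^ 2 * d ^ (1 + α) :=
      (Real.rpow_le_rpow (norm_nonneg _) (hscale hρ hpr) (by linarith)).trans hpow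
    have h2 : ‖ρ • (q - r)‖ ^ (1 + α) ≤ L ^ 2 * d ^ (1 + α) :=
      (Real.rpow_le_rpow (norm_nonneg _) (hscale hρ hqr) (by linarith)).trans hpow
    have h3 := (hscale hρ hpqr).trans hsq
    have h4 := hM _ (hball hρ hr)
    calc |Φ (ρ • p) + Φ (ρ • q) - 2 * Φ (ρ • r)|
        ≤ K * ‖ρ • (p - r)‖ ^ (1 + α) + K * ‖ρ • (q - r)‖ ^ (1 + α)
          + ‖fderiv ℝ Φ (ρ • r)‖ * ‖ρ • (p + q - (2 : ℝ) • r)‖ := h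
      _ ≤ K * (L ^ 2 * d ^ (1 + α)) + K * (L ^ 2 * d ^ (1 + α)) + M * (L ^ 2 * d ^ (1 + α)) := by
          gcongr
      _ = _ := by ring
  have hlim : ∀ v ∈ closedBall (0 : V) 1,
      Filter.Tendsto (fun ρ : ℝ => Φ (ρ • v)) (nhdsWithin 1 (Ico 0 1)) (nhds (Φ v)) := by
    intro v hv
    refine (hΦ v hv).tendsto.comp (tendsto_nhdsWithin_iff.2 ⟨?_, ?_⟩)
    · have : Filter.Tendsto (fun ρ : ℝ => ρ • v) (nhds 1) (nhds ((1 : ℝ) • v)) :=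
        (continuous_id.smul continuous_const).tendsto 1
      rw [one_smul] at this
      exact this.mono_left nhdsWithin_le_nhds
    · filter_upwards [self_mem_nhdsWithin] with ρ hρ
      exact ball_subset_closedBall (hball hρ hv)
  have : (nhdsWithin (1 : ℝ) (Ico 0 1)).NeBot := by
    rw [nhdsWithin_Ico_eq_nhdsLT zero_lt_one]
    infer_instance
  refine le_of_tendsto (((hlim p hp).add (hlim q hq)).sub ((hlim r hr).const_mul 2)).abs ?_
  filter_upwards [self_mem_nhdsWithin] with ρ hρ using hopen ρ hρ

/-- Lower bound for the second difference of a product. -/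
lemma le_second_difference_mul {wp wm w gp gm g c₁ c₂ c₃ L d : ℝ}
    (hw : |w| ≤ L) (hwp : |wp - w| ≤ L * d) (hwm : |wm - w| ≤ L * d)
    (hw2 : |wp + wm - 2 * w| ≤ L * d ^ 2) (hg : |g| ≤ c₁) (hgp : |gp - g| ≤ c₂ * (L * d))
    (hgm : |gm - g| ≤ c₂ * (L * d)) (hg2 : |gp + gm - 2 * g| ≤ c₃) :
    2 * (w * g) - (wp * gp + wm * gm)
      ≤ L * c₃ + 2 * (L * d * (c₂ * (L * d))) + L * d ^ 2 * c₁ := by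
  have e : 2 * (w * g) - (wp * gp + wm * gm) = -(w * (gp + gm - 2 * g))
      - (wp - w) * (gp - g) - (wm - w) * (gm - g) - (wp + wm - 2 * w) * g := by ring
  have h : ∀ {x y X Y : ℝ}, |x| ≤ X → |y| ≤ Y → -(X * Y) ≤ x * y := by
    intro x y X Y hx hy
    have := mul_le_mul hx hy (abs_nonneg y) ((abs_nonneg x).trans hx)
    rw [← abs_mul] at this
    linarith [neg_abs_le (x * y)]
  have h' : ∀ {x y X Y : ℝ}, |x| ≤ X → |y| ≤ Y → -(x * y) ≤ X * Y := fun hx hy => by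
    linarith [h hx hy]
  rw [e]
  linarith [h' hw hg2, h' hwp hgp, h' hwm hgm, h' hw2 hg]

end Differences

section MaximumPrinciple

open Matrix Filter Topology

lemma norm_sq_four_point {V : Type*} [NormedAddCommGroup V] [InnerProductSpace ℂ V] (y v : V)
    (s : ℝ) : ‖y + (1 * s : ℂ) • v‖ ^ 2 + ‖y + (-1 * s : ℂ) • v‖ ^ 2
      + ‖y + (Complex.I * s) • v‖ ^ 2 + ‖y + (-Complex.I * s) • v‖ ^ 2
      = 4 * ‖y‖ ^ 2 + 4 * s ^ 2 * ‖v‖ ^ 2 := by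
  have h1 := parallelogram_law_with_norm ℂ y ((s : ℂ) • v)
  have h2 := parallelogram_law_with_norm ℂ y ((Complex.I * s) • v)
  simp only [norm_smul, norm_mul, Complex.norm_I, Complex.norm_real] at h1 h2
  rw [one_mul, neg_one_mul, neg_mul, neg_smul, neg_smul, ← sub_eq_add_neg, ← sub_eq_add_neg]
  have h3 : ‖s‖ * ‖s‖ = s ^ 2 := by rw [Real.norm_eq_abs, abs_mul_abs_self, sq]
  linear_combination h1 + h2 + 4 * ‖v‖ ^ 2 * h3

/-- Second-order necessary condition at a maximum of a second difference of `u` along ball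
automorphisms. -/
lemma leviForm_second_difference_le {V : Type*} [NormedAddCommGroup V] [InnerProductSpace ℂ V]
    [NormedSpace ℝ V] [IsScalarTower ℝ ℂ V] {u : V → ℝ} (hu : ContDiffOn ℝ 2 u (ball 0 1))
    {ap am a y : V} (hap : ‖ap‖ < 1) (ham : ‖am‖ < 1) (ha : ‖a‖ < 1) (hy : ‖y‖ < 1) {η : ℝ}
    (hmax : ∀ z ∈ ball (0 : V) 1,
      u (ballAut ap z) + u (ballAut am z) - 2 * u (ballAut a z) + η * ‖z‖ ^ 2
        ≤ u (ballAut ap y) + u (ballAut am y) - 2 * u (ballAut a y) + η * ‖y‖ ^ 2) (v : V) :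
    leviForm u (ballAut ap y) (ballAutDeriv ap y v)
      + leviForm u (ballAut am y) (ballAutDeriv am y v) + 4 * η * ‖v‖ ^ 2
      ≤ 2 * leviForm u (ballAut a y) (ballAutDeriv a y v) := by
  have hC : ∀ {b : V}, ‖b‖ < 1 → ContDiffAt ℝ 2 u (ballAut b y) := fun hb =>
    hu.contDiffAt (isOpen_ball.mem_nhds (mem_ball_zero_iff.2 (norm_ballAut_lt_one hb hy)))
  have ht := fun {b : V} (hb : ‖b‖ < 1) =>
    (hC hb).tendsto_four_point (inner ℂ b v / (1 + inner ℂ b y)) (ballAutDeriv b y v)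
  have hlim := (((ht hap).add (ht ham)).sub ((ht ha).const_mul 2)).add_const (4 * η * ‖v‖ ^ 2)
  have hnhds : ∀ ζ : ℂ, ∀ᶠ s : ℝ in 𝓝[≠] 0, ‖y + (ζ * s) • v‖ < 1 := fun ζ => by
    have hcont : Continuous fun s : ℝ => ‖y + (ζ * s) • v‖ := by fun_prop
    exact (hcont.continuousAt.eventually_lt continuousAt_const (by simpa using hy)).filter_mono
      nhdsWithin_le_nhds
  have := le_of_tendsto (b := 0) hlim ?_
  · linarith
  filter_upwards [eventually_mem_nhdsWithin, hnhds 1, hnhds (-1), hnhds Complex.I,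
    hnhds (-Complex.I)] with s hs h1 h2 h3 h4
  have hs2 : 0 < s ^ 2 := by
    have hs0 : s ≠ 0 := hs
    positivity
  have e := fun {b : V} (hb : ‖b‖ < 1) {ζ : ℂ} (h : ‖y + (ζ * s) • v‖ < 1) =>
    ballAut_add_smul hb hy.le h.le
  have m1 := hmax _ (mem_ball_zero_iff.2 h1)
  have m2 := hmax _ (mem_ball_zero_iff.2 h2)
  have m3 := hmax _ (mem_ball_zero_iff.2 h3)
  have m4 := hmax _ (mem_ball_zero_iff.2 h4)
  rw [e hap h1, e ham h1, e ha h1] at m1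
  rw [e hap h2, e ham h2, e ha h2] at m2
  rw [e hap h3, e ham h3, e ha h3] at m3
  rw [e hap h4, e ham h4, e ha h4] at m4
  have hn := norm_sq_four_point y v s
  rw [← add_div, ← mul_div_assoc, ← sub_div, div_add' _ _ _ hs2.ne']
  refine div_nonpos_of_nonpos_of_nonneg ?_ hs2.le
  linear_combination m1 + m2 + m3 + m4 - η * hn

lemma star_dotProduct_conjTranspose_mul_mul_mulVec {m : Type*} [Fintype m]
    (B H : Matrix m m ℂ) (w : m → ℂ) :
    star w ⬝ᵥ ((Bᴴ * H * B) *ᵥ w) = star (B *ᵥ w) ⬝ᵥ (H *ᵥ (B *ᵥ w)) := by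
  rw [star_mulVec, ← mulVec_mulVec, ← mulVec_mulVec, dotProduct_mulVec]

lemma Matrix.PosSemidef.det_conjTranspose_mul_mul_rpow {m : Type*} [Fintype m] [DecidableEq m]
    {H : Matrix m m ℂ} (hH : H.PosSemidef) (B : Matrix m m ℂ) (r : ℝ) :
    (Bᴴ * H * B).det.re ^ r = Complex.normSq B.det ^ r * H.det.re ^ r := by
  have hdet : (Bᴴ * H * B).det = ((Complex.normSq B.det * H.det.re : ℝ) : ℂ) := by
    rw [det_mul, det_mul, det_conjTranspose, hH.det_eq_re, Complex.ofReal_mul,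
      Complex.normSq_eq_conj_mul_self, Complex.ofReal_re, Complex.star_def]
    ring
  rw [hdet, Complex.ofReal_re, Real.mul_rpow (Complex.normSq_nonneg _)
    (Complex.nonneg_iff.1 hH.det_nonneg).1]

/-- The concavity of `det ^ (1 / n)` along ball automorphisms at an interior maximum of a second
difference of `u`. -/
lemma ballAutWeight_mul_det_rpow_add_le {n : ℕ} (hn : 0 < n) {u : EuclideanSpace ℂ (Fin n) → ℝ}
    (hu : ContDiffOn ℝ 2 u (ball 0 1))
    (hpsh : ∀ z ∈ ball (0 : EuclideanSpace ℂ (Fin n)) 1, (cxHessian n u z).PosSemidef)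
    {ap am a y : EuclideanSpace ℂ (Fin n)} (hap : ‖ap‖ < 1) (ham : ‖am‖ < 1) (ha : ‖a‖ < 1)
    (hy : ‖y‖ < 1) {η : ℝ} (hη : 0 < η)
    (hmax : ∀ z ∈ ball (0 : EuclideanSpace ℂ (Fin n)) 1,
      u (ballAut ap z) + u (ballAut am z) - 2 * u (ballAut a z) + η * ‖z‖ ^ 2
        ≤ u (ballAut ap y) + u (ballAut am y) - 2 * u (ballAut a y) + η * ‖y‖ ^ 2) :
    ballAutWeight n ap y * (cxHessian n u (ballAut ap y)).det.re ^ ((n : ℝ)⁻¹)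
      + ballAutWeight n am y * (cxHessian n u (ballAut am y)).det.re ^ ((n : ℝ)⁻¹) + η
      ≤ 2 * (ballAutWeight n a y * (cxHessian n u (ballAut a y)).det.re ^ ((n : ℝ)⁻¹)) := by
  have : Nonempty (Fin n) := ⟨⟨0, hn⟩⟩
  set A : EuclideanSpace ℂ (Fin n) → Matrix (Fin n) (Fin n) ℂ := fun b =>
    (ballAutMatrix b y)ᴴ * cxHessian n u (ballAut b y) * ballAutMatrix b y with hA
  have hmem : ∀ {b : EuclideanSpace ℂ (Fin n)}, ‖b‖ < 1 →
      ballAut b y ∈ ball (0 : EuclideanSpace ℂ (Fin n)) 1 := fun hb =>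
    mem_ball_zero_iff.2 (norm_ballAut_lt_one hb hy)
  have hAp : ∀ {b : EuclideanSpace ℂ (Fin n)}, ‖b‖ < 1 → (A b).PosSemidef := fun hb =>
    (hpsh _ (hmem hb)).conjTranspose_mul_mul_same _
  have hAlevi : ∀ {b : EuclideanSpace ℂ (Fin n)} (v : EuclideanSpace ℂ (Fin n)), ‖b‖ < 1 →
      4 * (star (star v.ofLp) ⬝ᵥ (A b *ᵥ star v.ofLp)).re
        = leviForm u (ballAut b y) (ballAutDeriv b y v) := fun {b} v hb => by
    rw [leviForm_eq_cxHessian (hu.contDiffAt (isOpen_ball.mem_nhds (hmem hb))),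
      star_dotProduct_conjTranspose_mul_mul_mulVec, ballAutMatrix_mulVec]
  have hAdet : ∀ {b : EuclideanSpace ℂ (Fin n)}, ‖b‖ < 1 → (A b).det.re ^ ((n : ℝ)⁻¹)
      = ballAutWeight n b y * (cxHessian n u (ballAut b y)).det.re ^ ((n : ℝ)⁻¹) := fun hb => by
    rw [(hpsh _ (hmem hb)).det_conjTranspose_mul_mul_rpow, normSq_det_ballAutMatrix_rpow hb hy.le]
  have hI : ((η : ℂ) • (1 : Matrix (Fin n) (Fin n) ℂ)).PosDef :=
    PosDef.one.smul (by exact_mod_cast hη)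
  have hle : ((2 : ℂ) • A a - (A ap + A am + (η : ℂ) • 1)).PosSemidef := by
    have hherm : ((2 : ℂ) • A a - (A ap + A am + (η : ℂ) • 1)).IsHermitian :=
      (((hAp ha).smul (by norm_num : (0 : ℂ) ≤ 2)).isHermitian).sub
        (((hAp hap).add (hAp ham)).add hI.posSemidef).isHermitian
    refine PosSemidef.of_dotProduct_mulVec_nonneg hherm fun w => ?_
    refine Complex.nonneg_iff.2 ⟨?_, (hherm.im_star_dotProduct_mulVec_self w).symm⟩
    have h := leviForm_second_difference_le hu hap ham ha hy hmax (WithLp.toLp 2 (star w))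
    have hnorm : ‖WithLp.toLp 2 (star w)‖ ^ 2 = (star w ⬝ᵥ w).re := by
      simp [EuclideanSpace.norm_sq_eq, dotProduct, Complex.conj_mul', ← Complex.ofReal_pow]
    rw [← hAlevi _ hap, ← hAlevi _ ham, ← hAlevi _ ha, hnorm] at h
    simp only [star_star] at h
    simp only [sub_mulVec, add_mulVec, smul_mulVec, one_mulVec, dotProduct_sub, dotProduct_add,
      dotProduct_smul, smul_eq_mul, Complex.sub_re, Complex.add_re, Complex.ofReal_re,
      Complex.ofReal_im, Complex.mul_re, Complex.re_ofNat, Complex.im_ofNat, zero_mul, sub_zero]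
    linarith
  have hC : ((2 : ℂ) • A a).PosDef := by
    have := PosDef.posSemidef_add hle (PosDef.posSemidef_add ((hAp hap).add (hAp ham)) hI)
    rwa [sub_add_cancel] at this
  have h := hC.sum_det_rpow_le Finset.univ (A := ![A ap, A am, (η : ℂ) • 1])
    (fun i _ => by
      fin_cases i
      · exact hAp hap
      · exact hAp ham
      · exact hI.posSemidef) (by simpa [Fin.sum_univ_three] using hle)
  have hdet : ∀ {c : ℝ} {M : Matrix (Fin n) (Fin n) ℂ}, 0 ≤ c → M.PosSemidef →
      ((c : ℂ) • M).det.re ^ ((n : ℝ)⁻¹) = c * M.det.re ^ ((n : ℝ)⁻¹) := fun {c M} hc hM => by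
    rw [det_smul, Fintype.card_fin, ← Complex.ofReal_pow, Complex.re_ofReal_mul,
      Real.mul_rpow (by positivity) (Complex.nonneg_iff.1 hM.det_nonneg).1,
      Real.pow_rpow_inv_natCast hc hn.ne']
  have hdet2 := hdet zero_le_two (hAp ha)
  have hdetη := hdet hη.le PosSemidef.one
  rw [Complex.ofReal_ofNat] at hdet2
  rw [Fin.sum_univ_three, Fintype.card_fin, hdet2] at h
  simp only [cons_val_zero, cons_val_one, cons_val] at h
  rw [hdetη, hAdet hap, hAdet ham, hAdet ha] at h
  simpa using h

end MaximumPrinciple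

section Estimate

lemma continuousOn_ballAut {V : Type*} [NormedAddCommGroup V] [InnerProductSpace ℂ V]
    [NormedSpace ℝ V] [IsScalarTower ℝ ℂ V] {a : V} (ha : ‖a‖ < 1) :
    ContinuousOn (ballAut a) (closedBall 0 1) := fun y hy =>
  ((contDiffAt_ballAut (q := (a, y)) ha (mem_closedBall_zero_iff.1 hy)).continuousAt.comp
    (f := fun y => (a, y)) (by fun_prop)).continuousWithinAt

/-- The second difference estimate at `x`, given bounds for the dependence of the ball
automorphisms and of their weights on the base point. -/
lemma second_difference_le_of_ballAut_bounds {n : ℕ} (hn : 0 < n)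
    {u g Φ : EuclideanSpace ℂ (Fin n) → ℝ} {α L KΦ K₀ K₁ K₂ : ℝ}
    {x h : EuclideanSpace ℂ (Fin n)} (hα : 0 ≤ α) (hα1 : α ≤ 1) (hL : 1 ≤ L)
    (hu : ContDiffOn ℝ 2 u (ball 0 1)) (huc : ContinuousOn u (closedBall 0 1))
    (hpsh : ∀ z ∈ ball (0 : EuclideanSpace ℂ (Fin n)) 1, (cxHessian n u z).PosSemidef)
    (hdet : ∀ z ∈ ball (0 : EuclideanSpace ℂ (Fin n)) 1,
      (cxHessian n u z).det.re ^ ((n : ℝ)⁻¹) = g z)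
    (hgc : ContinuousOn g (closedBall 0 1)) (hgd : DifferentiableOn ℝ g (ball 0 1))
    (hΦc : ContinuousOn Φ (closedBall 0 1)) (hΦd : DifferentiableOn ℝ Φ (ball 0 1))
    (hbd : ∀ z ∈ sphere (0 : EuclideanSpace ℂ (Fin n)) 1, u z = Φ z)
    (hKΦ : 0 ≤ KΦ) (hK₂ : 0 ≤ K₂)
    (hΦ : ∀ x ∈ ball (0 : EuclideanSpace ℂ (Fin n)) 1,
      ∀ y ∈ ball (0 : EuclideanSpace ℂ (Fin n)) 1,
        ‖fderiv ℝ Φ x - fderiv ℝ Φ y‖ ≤ KΦ * ‖x - y‖ ^ α)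
    (hΦ₁ : ∀ x ∈ ball (0 : EuclideanSpace ℂ (Fin n)) 1, ‖fderiv ℝ Φ x‖ ≤ KΦ)
    (hg₀ : ∀ x ∈ ball (0 : EuclideanSpace ℂ (Fin n)) 1, |g x| ≤ K₀)
    (hg₁ : ∀ x ∈ ball (0 : EuclideanSpace ℂ (Fin n)) 1, ‖fderiv ℝ g x‖ ≤ K₁)
    (hg₂ : ∀ x ∈ ball (0 : EuclideanSpace ℂ (Fin n)) 1,
      ∀ y ∈ ball (0 : EuclideanSpace ℂ (Fin n)) 1,
        ‖fderiv ℝ g x - fderiv ℝ g y‖ ≤ K₂ * ‖x - y‖ ^ α)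
    (hx : ‖x‖ < 1) (hxp : ‖x + h‖ < 1) (hxm : ‖x - h‖ < 1) (hh : ‖h‖ ≤ 1)
    (hT : ∀ y ∈ closedBall (0 : EuclideanSpace ℂ (Fin n)) 1,
      ‖ballAut (x + h) y - ballAut x y‖ ≤ L * ‖h‖ ∧ ‖ballAut (x - h) y - ballAut x y‖ ≤ L * ‖h‖ ∧
      ‖ballAut (x + h) y + ballAut (x - h) y - (2 : ℝ) • ballAut x y‖ ≤ L * ‖h‖ ^ 2)
    (hW : ∀ y ∈ closedBall (0 : EuclideanSpace ℂ (Fin n)) 1, |ballAutWeight n x y| ≤ L ∧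
      |ballAutWeight n (x + h) y - ballAutWeight n x y| ≤ L * ‖h‖ ∧
      |ballAutWeight n (x - h) y - ballAutWeight n x y| ≤ L * ‖h‖ ∧
      |ballAutWeight n (x + h) y + ballAutWeight n (x - h) y - 2 * ballAutWeight n x y|
        ≤ L * ‖h‖ ^ 2) :
    u (x + h) + u (x - h) - 2 * u x ≤ 5 * L ^ 3 * (KΦ + (K₀ + K₁ + K₂)) * ‖h‖ ^ (1 + α) := by
  have h0 : (0 : EuclideanSpace ℂ (Fin n)) ∈ ball 0 1 := mem_ball_self one_pos
  have hK₀ : 0 ≤ K₀ := (abs_nonneg _).trans (hg₀ 0 h0)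
  have hK₁ : 0 ≤ K₁ := (norm_nonneg _).trans (hg₁ 0 h0)
  set D := ‖h‖ ^ (1 + α) with hD
  have hD0 : 0 ≤ D := by positivity
  have hsq : ‖h‖ ^ 2 ≤ D := sq_le_rpow_one_add (norm_nonneg _) hh hα1
  have hL23 : L ^ 2 ≤ L ^ 3 := pow_le_pow_right₀ hL (by norm_num)
  have hL13 : L ≤ L ^ 3 := le_self_pow₀ hL (by norm_num)
  set E := 5 * L ^ 3 * (K₀ + K₁ + K₂) * D with hE
  have hE0 : 0 ≤ E := by positivity
  have hEle : L * ((2 * K₂ + K₁) * L ^ 2 * D) + 2 * (L * ‖h‖ * (K₁ * (L * ‖h‖)))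
      + L * ‖h‖ ^ 2 * K₀ ≤ E := by
    have e1 : L ^ 2 * K₁ * ‖h‖ ^ 2 ≤ L ^ 3 * K₁ * D := by gcongr
    have e2 : L * K₀ * ‖h‖ ^ 2 ≤ L ^ 3 * K₀ * D := by gcongr
    have e3 : 0 ≤ L ^ 3 * K₀ * D := by positivity
    have e4 : 0 ≤ L ^ 3 * K₁ * D := by positivity
    have e5 : 0 ≤ L ^ 3 * K₂ * D := by positivity
    rw [hE]
    linarith
  have hBle : (2 * KΦ + KΦ) * L ^ 2 * D ≤ 5 * L ^ 3 * KΦ * D := by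
    have e1 : KΦ * D * L ^ 2 ≤ KΦ * D * L ^ 3 := by gcongr
    have e2 : 0 ≤ KΦ * D * L ^ 3 := by positivity
    linarith
  refine le_of_forall_pos_le_add fun ε hε => ?_
  set ψ : EuclideanSpace ℂ (Fin n) → ℝ := fun y =>
    u (ballAut (x + h) y) + u (ballAut (x - h) y) - 2 * u (ballAut x y) + (E + ε) * ‖y‖ ^ 2 with hψ
  have hmaps : ∀ {b : EuclideanSpace ℂ (Fin n)}, ‖b‖ < 1 → ∀ y ∈ closedBall 0 1,
      ballAut b y ∈ closedBall (0 : EuclideanSpace ℂ (Fin n)) 1 := fun hb y hy => by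
    rw [mem_closedBall_zero_iff] at hy ⊢
    rcases hy.lt_or_eq with hy | hy
    · exact (norm_ballAut_lt_one hb hy).le
    · exact (norm_ballAut_eq_one hb hy).le
  have huT : ∀ {b : EuclideanSpace ℂ (Fin n)}, ‖b‖ < 1 →
      ContinuousOn (fun y => u (ballAut b y)) (closedBall 0 1) := fun hb =>
    huc.comp (continuousOn_ballAut hb) (hmaps hb)
  have hψc : ContinuousOn ψ (closedBall 0 1) :=
    (((huT hxp).add (huT hxm)).sub ((huT hx).const_mul 2)).add (by fun_prop)
  obtain ⟨y, hy, hmax⟩ := (isCompact_closedBall (0 : EuclideanSpace ℂ (Fin n)) 1).exists_isMaxOn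
    ⟨0, ball_subset_closedBall h0⟩ hψc
  obtain ⟨hT₁, hT₂, hT₃⟩ := hT y hy
  obtain ⟨hW₀, hW₁, hW₂, hW₃⟩ := hW y hy
  rcases (mem_closedBall_zero_iff.1 hy).lt_or_eq with hy1 | hy1
  · exfalso
    have hb : ∀ {b : EuclideanSpace ℂ (Fin n)}, ‖b‖ < 1 →
        ballAut b y ∈ ball (0 : EuclideanSpace ℂ (Fin n)) 1 := fun hb =>
      mem_ball_zero_iff.2 (norm_ballAut_lt_one hb hy1)
    have hconc := ballAutWeight_mul_det_rpow_add_le hn hu hpsh hxp hxm hx hy1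
      (add_pos_of_nonneg_of_pos hE0 hε) fun z hz => hmax (ball_subset_closedBall hz)
    rw [hdet _ (hb hxp), hdet _ (hb hxm), hdet _ (hb hx)] at hconc
    have hlip : ∀ {p q : EuclideanSpace ℂ (Fin n)}, p ∈ ball 0 1 → q ∈ ball 0 1 →
        ‖p - q‖ ≤ L * ‖h‖ → |g p - g q| ≤ K₁ * (L * ‖h‖) := fun hp hq hpq =>
      ((convex_ball _ _).norm_image_sub_le_of_norm_fderiv_le
        (fun z hz => hgd.differentiableAt (isOpen_ball.mem_nhds hz)) hg₁ hq hp).trans (by gcongr)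
    have hg := abs_second_difference_le_s4 hgc hgd hα hα1 hK₂ hg₂ hg₁ (norm_nonneg h) hh hL
      (hmaps hxp y hy) (hmaps hxm y hy) (hmaps hx y hy) hT₁ hT₂ hT₃
    have := le_second_difference_mul hW₀ hW₁ hW₂ hW₃ (hg₀ _ (hb hx))
      (hlip (hb hxp) (hb hx) hT₁) (hlip (hb hxm) (hb hx) hT₂) hg
    linarith
  · have hs : ∀ {b : EuclideanSpace ℂ (Fin n)}, ‖b‖ < 1 → u (ballAut b y) = Φ (ballAut b y) :=
      fun hb => hbd _ (mem_sphere_zero_iff_norm.2 (norm_ballAut_eq_one hb hy1))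
    have hB := abs_second_difference_le_s4 hΦc hΦd hα hα1 hKΦ hΦ hΦ₁ (norm_nonneg h) hh hL
      (hmaps hxp y hy) (hmaps hxm y hy) (hmaps hx y hy) hT₁ hT₂ hT₃
    have h1 : ψ 0 ≤ ψ y := hmax (ball_subset_closedBall h0)
    simp only [hψ, ballAut_zero, norm_zero, hs hxp, hs hxm, hs hx, hy1] at h1
    have h2 := (le_abs_self _).trans hB
    have e : 5 * L ^ 3 * (KΦ + (K₀ + K₁ + K₂)) * D = 5 * L ^ 3 * KΦ * D + E := by rw [hE]; ring
    rw [e]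
    linarith

lemma cxHessian_sub_clm {n : ℕ} {u : EuclideanSpace ℂ (Fin n) → ℝ}
    {z : EuclideanSpace ℂ (Fin n)} (hu : ContDiffAt ℝ 2 u z)
    (ℓ : EuclideanSpace ℂ (Fin n) →L[ℝ] ℝ) :
    cxHessian n (fun w => u w - ℓ w) z = cxHessian n u z := by
  have h : ∀ e, fderiv ℝ (fun w => fderiv ℝ (fun w => u w - ℓ w) w e) z
      = fderiv ℝ (fun w => fderiv ℝ u w e) z := fun e => by
    have : (fun w => fderiv ℝ (fun w => u w - ℓ w) w e)
        =ᶠ[nhds z] fun w => fderiv ℝ u w e - ℓ e := by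
      filter_upwards [hu.eventually (by simp)] with w hw
      rw [fderiv_fun_sub (hw.differentiableAt (by norm_num)) ℓ.differentiableAt, ℓ.fderiv]
      rfl
    rw [this.fderiv_eq, fderiv_sub_const]
  simp only [cxHessian, h]

lemma nonneg_of_holder_bound {V W : Type*} [NormedAddCommGroup V] [NormedSpace ℝ V] [Nontrivial V]
    [SeminormedAddCommGroup W] {F : V → W} {K α : ℝ}
    (hF : ∀ x ∈ ball (0 : V) 1, ∀ y ∈ ball (0 : V) 1, ‖F x - F y‖ ≤ K * ‖x - y‖ ^ α) :
    0 ≤ K := by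
  obtain ⟨v, hv⟩ := exists_norm_eq V (by norm_num : (0 : ℝ) ≤ 1 / 2)
  have h := (norm_nonneg _).trans
    (hF v (by rw [mem_ball_zero_iff, hv]; norm_num) 0 (mem_ball_self one_pos))
  rw [sub_zero, hv] at h
  exact nonneg_of_mul_nonneg_left h (by positivity)

end Estimate

/-- **Second-order difference estimate** (Lemma 3.1). If `u ∈ PSH(B) ∩ C(B̄)` solves
`det(u_{i j̄}) = f` in the unit ball `B ⊂ ℂⁿ` with `u = φ` on `∂B`,
`φ ∈ C^{1,α}(∂B)`, `f ≥ 0`, `f^{1/n} ∈ C^{1,α}(B̄)`, `α ∈ (0,1]`, then for any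
`t ∈ (0,1]`, `x ∈ B_{1-t}`, `h ∈ B_{t/2}`:
`u(x+h) + u(x-h) - 2u(x) ≤ C(n,t) ([φ]_{1,α;∂B} + |f^{1/n}|'_{1,α;B}) |h|^{1+α}`.
The boundary seminorm `[φ]_{1,α;∂B}` (an infimum over extensions) is expressed by
quantifying over all extensions `Φ ∈ C^{1,α}(B̄)` of the boundary values with Hölder
gradient constant `KΦ`, and `|f^{1/n}|'_{1,α;B} = sup|f^{1/n}| + sup|∇f^{1/n}| + [f^{1/n}]_{1,α;B}`
is expressed through arbitrary upper bounds `K₀, K₁, K₂` of its three pieces. -/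
theorem second_order_difference_estimate (n : ℕ) (hn : 0 < n)
    (t : ℝ) (ht0 : 0 < t) (ht1 : t ≤ 1) :
    ∃ C : ℝ, ∀ (α : ℝ), 0 < α → α ≤ 1 →
      ∀ u f g Φ : EuclideanSpace ℂ (Fin n) → ℝ,
      -- u ∈ C²(B) ∩ C(B̄)
      ContDiffOn ℝ 2 u (ball 0 1) →
      ContinuousOn u (closedBall 0 1) →
      -- u is plurisubharmonic on B
      (∀ z ∈ ball (0 : EuclideanSpace ℂ (Fin n)) 1, (cxHessian n u z).PosSemidef) →
      -- the complex Monge-Ampère equation det(u_{i j̄}) = f in B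
      (∀ z ∈ ball (0 : EuclideanSpace ℂ (Fin n)) 1, (cxHessian n u z).det = (f z : ℂ)) →
      -- f ≥ 0 and g = f^{1/n}
      (∀ z ∈ closedBall (0 : EuclideanSpace ℂ (Fin n)) 1, 0 ≤ f z) →
      (∀ z ∈ closedBall (0 : EuclideanSpace ℂ (Fin n)) 1, g z = f z ^ ((n : ℝ)⁻¹)) →
      -- g = f^{1/n} ∈ C^{1,α}(B̄)
      ContinuousOn g (closedBall 0 1) →
      DifferentiableOn ℝ g (ball 0 1) →
      -- Φ ∈ C^{1,α}(B̄) is an extension of the boundary datum φ, and u = φ on ∂B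
      ContinuousOn Φ (closedBall 0 1) →
      DifferentiableOn ℝ Φ (ball 0 1) →
      (∀ z ∈ sphere (0 : EuclideanSpace ℂ (Fin n)) 1, u z = Φ z) →
      ∀ KΦ K₀ K₁ K₂ : ℝ,
      (∀ x ∈ ball (0 : EuclideanSpace ℂ (Fin n)) 1,
        ∀ y ∈ ball (0 : EuclideanSpace ℂ (Fin n)) 1,
          ‖fderiv ℝ Φ x - fderiv ℝ Φ y‖ ≤ KΦ * ‖x - y‖ ^ α) →
      (∀ x ∈ ball (0 : EuclideanSpace ℂ (Fin n)) 1, |g x| ≤ K₀) →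
      (∀ x ∈ ball (0 : EuclideanSpace ℂ (Fin n)) 1, ‖fderiv ℝ g x‖ ≤ K₁) →
      (∀ x ∈ ball (0 : EuclideanSpace ℂ (Fin n)) 1,
        ∀ y ∈ ball (0 : EuclideanSpace ℂ (Fin n)) 1,
          ‖fderiv ℝ g x - fderiv ℝ g y‖ ≤ K₂ * ‖x - y‖ ^ α) →
      -- conclusion
      ∀ x h : EuclideanSpace ℂ (Fin n), ‖x‖ < 1 - t → ‖h‖ < t / 2 →
        u (x + h) + u (x - h) - 2 * u x ≤
          C * (KΦ + (K₀ + K₁ + K₂)) * ‖h‖ ^ (1 + α) := by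
  have : Nonempty (Fin n) := ⟨⟨0, hn⟩⟩
  have hcs := isCompact_closedBall (0 : EuclideanSpace ℂ (Fin n)) (1 - t / 2)
  have hcv := convex_closedBall (0 : EuclideanSpace ℂ (Fin n)) (1 - t / 2)
  have hct := isCompact_closedBall (0 : EuclideanSpace ℂ (Fin n)) 1
  have hlt : ∀ {a : EuclideanSpace ℂ (Fin n)}, a ∈ closedBall 0 (1 - t / 2) → ‖a‖ < 1 :=
    fun ha => (mem_closedBall_zero_iff.1 ha).trans_lt (by linarith)
  obtain ⟨L₁, hL₁, hT⟩ := hcs.exists_second_difference_le hcv hct fun q hq =>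
    contDiffAt_ballAut (hlt hq.1) (mem_closedBall_zero_iff.1 hq.2)
  obtain ⟨L₂, -, hW⟩ := hcs.exists_second_difference_le hcv hct fun q hq =>
    contDiffAt_ballAutWeight n (hlt hq.1) (mem_closedBall_zero_iff.1 hq.2)
  have hL₁L := le_max_left L₁ L₂
  have hL₂L := le_max_right L₁ L₂
  refine ⟨5 * max L₁ L₂ ^ 3, ?_⟩
  intro α hα hα1 u f g Φ hu huc hpsh hdet hf hg hgc hgd hΦc hΦd hbd KΦ K₀ K₁ K₂ hΦ hg₀ hg₁ hg₂ x h
    hx hh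
  have hKΦ := nonneg_of_holder_bound hΦ
  have hK₂ := nonneg_of_holder_bound hg₂
  have hx1 : x ∈ closedBall 0 (1 - t / 2) := mem_closedBall_zero_iff.2 (by linarith)
  have hxp : x + h ∈ closedBall 0 (1 - t / 2) :=
    mem_closedBall_zero_iff.2 ((norm_add_le _ _).trans (by linarith))
  have hxm : x - h ∈ closedBall 0 (1 - t / 2) :=
    mem_closedBall_zero_iff.2 ((norm_sub_le _ _).trans (by linarith))
  set ℓ := fderiv ℝ Φ 0 with hℓ
  have huz : ∀ z ∈ ball (0 : EuclideanSpace ℂ (Fin n)) 1,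
      cxHessian n (fun w => u w - ℓ w) z = cxHessian n u z := fun z hz =>
    cxHessian_sub_clm (hu.contDiffAt (isOpen_ball.mem_nhds hz)) ℓ
  have hΦz : ∀ z ∈ ball (0 : EuclideanSpace ℂ (Fin n)) 1,
      fderiv ℝ (fun w => Φ w - ℓ w) z = fderiv ℝ Φ z - ℓ := fun z hz => by
    rw [fderiv_fun_sub (hΦd.differentiableAt (isOpen_ball.mem_nhds hz)) ℓ.differentiableAt,
      ℓ.fderiv]
  have key := second_difference_le_of_ballAut_bounds hn (u := fun w => u w - ℓ w) (g := g)
    (Φ := fun w => Φ w - ℓ w) hα.le hα1 (hL₁.trans hL₁L) (hu.sub ℓ.contDiff.contDiffOn)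
    (huc.sub ℓ.continuous.continuousOn) (fun z hz => by rw [huz z hz]; exact hpsh z hz)
    (fun z hz => by
      rw [huz z hz, hdet z hz, Complex.ofReal_re, hg z (ball_subset_closedBall hz)])
    hgc hgd (hΦc.sub ℓ.continuous.continuousOn) (hΦd.sub ℓ.differentiable.differentiableOn)
    (fun z hz => by rw [hbd z hz]) hKΦ hK₂
    (fun p hp q hq => by rw [hΦz p hp, hΦz q hq, sub_sub_sub_cancel_right]; exact hΦ p hp q hq)
    (fun p hp => by
      rw [hΦz p hp, hℓ]
      refine (hΦ p hp 0 (mem_ball_self one_pos)).trans (mul_le_of_le_one_right hKΦ ?_)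
      rw [sub_zero]
      exact Real.rpow_le_one (norm_nonneg _) (mem_ball_zero_iff.1 hp).le hα.le)
    hg₀ hg₁ hg₂ (hlt hx1) (hlt hxp) (hlt hxm) (by linarith)
    (fun y hy => by
      obtain ⟨-, h1, h2, h3⟩ := hT y hy x hx1 h hxp hxm
      exact ⟨h1.trans (by gcongr), h2.trans (by gcongr), h3.trans (by gcongr)⟩)
    (fun y hy => by
      obtain ⟨h0, h1, h2, h3⟩ := hW y hy x hx1 h hxp hxm
      exact ⟨h0.trans hL₂L, h1.trans (by gcongr), h2.trans (by gcongr), h3.trans (by gcongr)⟩)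
  simp only [map_add, map_sub] at key
  linarith
end

section
/- Let $r\geq t>0$, let $B_{r+t}(0)$ be a ball in $\mathbb{R}^n$, let $\alpha\in(0,1)$, and let $v\in C(B_{r+t}(0))$. Suppose there is a constant $A\geq 0$ such that $\left|\;\fint_{\partial B_h(0)}v(x+y)\,d\sigma_y-v(x)\right|\leq A\,h^{1+\alpha}$ for all $x\in B_r(0)$ and all $h\in(0,t]$, where the barred integral denotes the average over the sphere of radius $h$ with respect to surface measure. Then $v\in C^{1,\alpha}(B_r(0))$ and there is a constant $C=C(n,\alpha)$ depending only on $n$ and $\alpha$ with $[v]^*_{1,\alpha;B_r(0)}\leq C\,(r^{1+\alpha}t^{-1-\alpha}\sup_{B_{r+t}(0)}|v|+A\,r^{1+\alpha})$. -/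
open Metric Set MeasureTheory

/-- The average of `y ↦ v (x + y)` over the sphere `{y : ‖y‖ = h}` in `ℝⁿ`,
with respect to the `(n-1)`-dimensional Hausdorff (surface) measure. -/
noncomputable def sphereAvg (n : ℕ) (v : EuclideanSpace ℝ (Fin n) → ℝ)
    (x : EuclideanSpace ℝ (Fin n)) (h : ℝ) : ℝ :=
  ⨍ y in sphere (0 : EuclideanSpace ℝ (Fin n)) h, v (x + y) ∂(μH[(n : ℝ) - 1])

/-- A Lipschitz-on-compacts chart from `ℝᵐ` to the unit sphere of `ℝᵐ⁺¹`, obtained by radially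
projecting the hyperplane `{x | x i = s}`. -/
noncomputable def sphereChart {m : ℕ} (i : Fin (m + 1)) (s : ℝ) (z : Fin m → ℝ) :
    EuclideanSpace ℝ (Fin (m + 1)) :=
  (√(1 + ∑ j, z j ^ 2))⁻¹ • WithLp.toLp 2 (i.insertNth (α := fun _ => ℝ) s z)

theorem contDiff_sphereChart {m : ℕ} (i : Fin (m + 1)) (s : ℝ) :
    ContDiff ℝ 1 (sphereChart i s) := by
  have hpos : ∀ z : Fin m → ℝ, 0 < 1 + ∑ j, z j ^ 2 := fun z => by positivity
  have h1 : ContDiff ℝ 1 fun z : Fin m → ℝ => (√(1 + ∑ j, z j ^ 2))⁻¹ := by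
    refine ContDiff.inv (ContDiff.sqrt (by fun_prop) fun z => (hpos z).ne') fun z => ?_
    exact (Real.sqrt_pos.2 (hpos z)).ne'
  refine h1.smul ?_
  rw [contDiff_euclidean]
  intro j
  rcases Fin.eq_self_or_eq_succAbove i j with rfl | ⟨k, rfl⟩
  · simpa using contDiff_const
  · simpa using contDiff_apply ℝ ℝ k

theorem sphere_subset_iUnion_sphereChart (m : ℕ) :
    sphere (0 : EuclideanSpace ℝ (Fin (m + 1))) 1 ⊆
      ⋃ i : Fin (m + 1), (sphereChart i 1 '' Icc (-1) 1 ∪ sphereChart i (-1) '' Icc (-1) 1) := by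
  intro x hx
  have hx2 : ∑ j, x j ^ 2 = 1 := by
    have := EuclideanSpace.norm_sq_eq x
    rw [mem_sphere_zero_iff_norm.1 hx] at this
    simpa using this.symm
  obtain ⟨i, -, hi⟩ := Finset.exists_max_image Finset.univ (fun j => |x j|) ⟨0, Finset.mem_univ _⟩
  have hi0 : x i ≠ 0 := by
    intro h0
    have : ∀ j, x j = 0 := fun j => by simpa [h0] using hi j (Finset.mem_univ _)
    simp [this] at hx2
  have habs : 0 < |x i| := abs_pos.2 hi0
  set z : Fin m → ℝ := fun j => x (i.succAbove j) / |x i| with hz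
  have hzI : z ∈ Icc (-1 : Fin m → ℝ) 1 := by
    have : ∀ j, |z j| ≤ 1 := fun j => by
      rw [hz]; simp only [abs_div, abs_abs]
      exact (div_le_one habs).2 (hi _ (Finset.mem_univ _))
    exact ⟨fun j => (abs_le.1 (this j)).1, fun j => (abs_le.1 (this j)).2⟩
  have hsum : (√(1 + ∑ j, z j ^ 2))⁻¹ = |x i| := by
    have : 1 + ∑ j, z j ^ 2 = (|x i|⁻¹) ^ 2 := by
      rw [Fin.sum_univ_succAbove _ i] at hx2
      have h2 : x i ^ 2 = |x i| ^ 2 := (sq_abs _).symm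
      simp only [hz, div_pow, ← Finset.sum_div]
      field_simp
      linarith
    rw [this, Real.sqrt_sq (by positivity), inv_inv]
  have key : ∀ s : ℝ, |x i| * s = x i → sphereChart i s z = x := by
    intro s hs
    ext j
    rcases Fin.eq_self_or_eq_succAbove i j with rfl | ⟨k, rfl⟩
    · simp [sphereChart, hsum, hs]
    · have : sphereChart i s z (i.succAbove k) = |x i| * z k := by simp [sphereChart, hsum]
      rw [this, hz]
      field_simp
  refine mem_iUnion.2 ⟨i, ?_⟩
  rcases abs_choice (x i) with h | h
  · exact Or.inl ⟨z, hzI, key 1 (by rw [mul_one, h])⟩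
  · exact Or.inr ⟨z, hzI, key (-1) (by rw [h]; ring)⟩

theorem hausdorffMeasure_sphere_lt_top (m : ℕ) :
    μH[(m : ℝ)] (sphere (0 : EuclideanSpace ℝ (Fin (m + 1))) 1) < ⊤ := by
  have key : ∀ (i : Fin (m + 1)) (s : ℝ), μH[(m : ℝ)] (sphereChart i s '' Icc (-1) 1) < ⊤ := by
    intro i s
    obtain ⟨K, hK⟩ := LocallyLipschitzOn.exists_lipschitzOnWith_of_compact
      (isCompact_Icc (a := (-1 : Fin m → ℝ)) (b := 1))
      ((contDiff_sphereChart i s).locallyLipschitz.locallyLipschitzOn)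
    refine (hK.hausdorffMeasure_image_le (Nat.cast_nonneg m)).trans_lt ?_
    refine ENNReal.mul_lt_top (by simp) ?_
    have h := hausdorffMeasure_pi_real (ι := Fin m)
    rw [Fintype.card_fin] at h
    rw [h]
    exact isCompact_Icc.measure_lt_top
  refine (measure_mono (sphere_subset_iUnion_sphereChart m)).trans_lt ?_
  refine (measure_iUnion_le _).trans_lt ?_
  rw [tsum_fintype]
  refine ENNReal.sum_lt_top.2 fun i _ => (measure_union_le _ _).trans_lt ?_
  exact ENNReal.add_lt_top.2 ⟨key i 1, key i (-1)⟩

theorem hausdorffMeasure_sphere_pos (m : ℕ) :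
    0 < μH[(m : ℝ)] (sphere (0 : EuclideanSpace ℝ (Fin (m + 1))) 1) := by
  set p : EuclideanSpace ℝ (Fin (m + 1)) → (Fin m → ℝ) := fun x j => x j.succ with hp
  have hLip : LipschitzWith 1 p := by
    refine LipschitzWith.of_dist_le_mul fun x y => ?_
    rw [NNReal.coe_one, one_mul]
    refine (dist_pi_le_iff dist_nonneg).2 fun j => ?_
    rw [Real.dist_eq, dist_eq_norm]
    simpa using PiLp.norm_apply_le (x - y) j.succ
  have hball : ball (0 : Fin m → ℝ) (1 / (m + 1)) ⊆
      p '' sphere (0 : EuclideanSpace ℝ (Fin (m + 1))) 1 := by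
    intro z hz
    have hz1 : ∀ j, |z j| ≤ 1 / (m + 1) := fun j =>
      (norm_le_pi_norm z j).trans (mem_ball_zero_iff.1 hz).le
    have hsum : ∑ j, z j ^ 2 ≤ 1 := by
      calc ∑ j, z j ^ 2 ≤ ∑ j : Fin m, (1 / ((m : ℝ) + 1)) ^ 2 := by
            refine Finset.sum_le_sum fun j _ => ?_
            rw [← sq_abs]
            exact pow_le_pow_left₀ (abs_nonneg _) (hz1 j) 2
        _ = m / ((m : ℝ) + 1) ^ 2 := by simp; ring
        _ ≤ 1 := by
            rw [div_le_one (by positivity)]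
            nlinarith [(Nat.cast_nonneg m : (0 : ℝ) ≤ m)]
    refine ⟨WithLp.toLp 2 (Fin.cons (√(1 - ∑ j, z j ^ 2)) z), ?_, ?_⟩
    · rw [mem_sphere_zero_iff_norm, EuclideanSpace.norm_eq, Fin.sum_univ_succ]
      simp [Real.sq_sqrt (sub_nonneg.2 hsum)]
    · ext j
      simp [hp]
  have h1 := hLip.hausdorffMeasure_image_le (Nat.cast_nonneg m)
    (sphere (0 : EuclideanSpace ℝ (Fin (m + 1))) 1)
  have h := hausdorffMeasure_pi_real (ι := Fin m)
  rw [Fintype.card_fin] at h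
  have h2 : 0 < μH[(m : ℝ)] (ball (0 : Fin m → ℝ) (1 / (m + 1))) := by
    rw [h]; exact measure_ball_pos _ _ (by positivity)
  simpa using h2.trans_le ((measure_mono hball).trans h1)

/-- The normalized surface measure on the unit sphere of `ℝᵐ⁺¹`, as a measure on `ℝᵐ⁺¹`. -/
noncomputable def unitSphereMeasure (m : ℕ) : Measure (EuclideanSpace ℝ (Fin (m + 1))) :=
  (μH[(m : ℝ)] (sphere (0 : EuclideanSpace ℝ (Fin (m + 1))) 1))⁻¹ •
    (μH[(m : ℝ)]).restrict (sphere (0 : EuclideanSpace ℝ (Fin (m + 1))) 1)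

instance (m : ℕ) : IsProbabilityMeasure (unitSphereMeasure m) := by
  refine ⟨?_⟩
  simp only [unitSphereMeasure, Measure.smul_apply, Measure.restrict_apply_univ, smul_eq_mul]
  exact ENNReal.inv_mul_cancel (hausdorffMeasure_sphere_pos m).ne'
    (hausdorffMeasure_sphere_lt_top m).ne

theorem ae_norm_eq_one_unitSphereMeasure (m : ℕ) : ∀ᵐ ω ∂unitSphereMeasure m, ‖ω‖ = 1 := by
  refine Measure.ae_smul_measure ?_ _
  filter_upwards [ae_restrict_mem isClosed_sphere.measurableSet] with ω hω
  exact mem_sphere_zero_iff_norm.1 hω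

theorem map_unitSphereMeasure (m : ℕ)
    (R : EuclideanSpace ℝ (Fin (m + 1)) ≃ₗᵢ[ℝ] EuclideanSpace ℝ (Fin (m + 1))) :
    (unitSphereMeasure m).map R = unitSphereMeasure m := by
  have hR : MeasurableEmbedding R := R.toHomeomorph.measurableEmbedding
  have h1 : (μH[(m : ℝ)] : Measure (EuclideanSpace ℝ (Fin (m + 1)))).map R = μH[(m : ℝ)] :=
    R.toIsometryEquiv.map_hausdorffMeasure m
  have h2 : R ⁻¹' sphere 0 1 = sphere 0 1 := by ext; simp
  rw [unitSphereMeasure, Measure.map_smul]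
  congr 1
  conv_lhs => rw [← h2, ← hR.restrict_map, h1]

open scoped Pointwise in
theorem sphereAvg_eq_integral_unitSphereMeasure (m : ℕ)
    (v : EuclideanSpace ℝ (Fin (m + 1)) → ℝ) (x : EuclideanSpace ℝ (Fin (m + 1)))
    {h : ℝ} (hh : 0 < h) :
    sphereAvg (m + 1) v x h = ∫ ω, v (x + h • ω) ∂unitSphereMeasure m := by
  set E := EuclideanSpace ℝ (Fin (m + 1))
  have hd : (((m + 1 : ℕ) : ℝ) - 1) = m := by push_cast; ring
  have hS : sphere (0 : E) h = h • sphere (0 : E) 1 := by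
    rw [smul_sphere' hh.ne']; simp [abs_of_pos hh]
  have hemb : MeasurableEmbedding (fun y : E => h • y) :=
    (Homeomorph.smulOfNeZero h hh.ne').measurableEmbedding
  set c : ENNReal := ((‖h‖₊ ^ (m : ℝ) : NNReal) : ENNReal) with hc
  have hc0 : c ≠ 0 := by
    rw [hc, ENNReal.coe_ne_zero]
    exact (NNReal.rpow_pos (nnnorm_pos.2 hh.ne')).ne'
  have hsm : ∀ s : Set E, μH[(m : ℝ)] (h • s) = c * μH[(m : ℝ)] s := fun s =>
    Measure.hausdorffMeasure_smul₀ (Nat.cast_nonneg m) hh.ne' s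
  have hmap : (μH[(m : ℝ)] : Measure E).restrict (sphere 0 h) =
      c • ((μH[(m : ℝ)] : Measure E).restrict (sphere 0 1)).map (fun y => h • y) := by
    have hpre : ∀ s : Set E, h • ((fun y : E => h • y) ⁻¹' s) = s := fun s => by
      rw [← image_smul]
      exact image_preimage_eq s (Homeomorph.smulOfNeZero h hh.ne').surjective
    have h1 : (μH[(m : ℝ)] : Measure E) = c • (μH[(m : ℝ)] : Measure E).map (fun y => h • y) := by
      ext s hs
      rw [Measure.smul_apply, hemb.map_apply, smul_eq_mul, ← hsm, hpre]
    have h2 : (fun y : E => h • y) ⁻¹' sphere 0 h = sphere 0 1 := by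
      rw [hS, ← image_smul]
      exact preimage_image_eq _ (Homeomorph.smulOfNeZero h hh.ne').injective
    conv_lhs => rw [h1, Measure.restrict_smul, hemb.restrict_map, h2]
  rw [sphereAvg, hd, average, Measure.restrict_apply_univ, hS, hsm, ← hS, hmap, smul_smul,
    ENNReal.mul_inv (Or.inl hc0) (Or.inl ENNReal.coe_ne_top), mul_right_comm,
    ENNReal.inv_mul_cancel hc0 ENNReal.coe_ne_top, one_mul, ← Measure.map_smul,
    hemb.integral_map, unitSphereMeasure]

theorem charFun_eq_of_norm_eq {E : Type*} [NormedAddCommGroup E] [InnerProductSpace ℝ E]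
    [MeasurableSpace E] [BorelSpace E] {μ : Measure E}
    (hμ : ∀ R : E ≃ₗᵢ[ℝ] E, μ.map R = μ) {ξ η : E} (h : ‖ξ‖ = ‖η‖) :
    charFun μ ξ = charFun μ η := by
  set R := Submodule.reflection (ℝ ∙ (ξ - η))ᗮ
  have hR : R ξ = η := Submodule.reflection_sub h
  have hemb : MeasurableEmbedding R := R.toHomeomorph.measurableEmbedding
  rw [← hR, charFun_apply, charFun_apply]
  conv_rhs => rw [← hμ R, hemb.integral_map]
  simp

/-- A rotation invariant finite measure is the law of `‖y‖ • ω`, with `y` distributed according to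
the measure itself and `ω` uniformly distributed on the unit sphere. -/
theorem map_norm_smul_prod_eq {E : Type*} [NormedAddCommGroup E] [InnerProductSpace ℝ E]
    [FiniteDimensional ℝ E] [MeasurableSpace E] [BorelSpace E] {μ σ : Measure E}
    [IsFiniteMeasure μ] [IsProbabilityMeasure σ] (hμ : ∀ R : E ≃ₗᵢ[ℝ] E, μ.map R = μ)
    (hσ : ∀ R : E ≃ₗᵢ[ℝ] E, σ.map R = σ) (hσ1 : ∀ᵐ ω ∂σ, ‖ω‖ = 1) :
    (μ.prod σ).map (fun p => ‖p.1‖ • p.2) = μ := by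
  have hmeas : Measurable (fun p : E × E => ‖p.1‖ • p.2) := by fun_prop
  refine Measure.ext_of_charFun (funext fun ξ => ?_)
  have hint : Integrable (fun p : E × E => Complex.exp (inner ℝ (‖p.1‖ • p.2) ξ * Complex.I))
      (μ.prod σ) := by
    refine Integrable.of_bound (C := 1) (by fun_prop) (Filter.Eventually.of_forall fun p => ?_)
    rw [Complex.norm_exp_ofReal_mul_I]
  have hint' : Integrable (fun p : E × E => Complex.exp (inner ℝ p.2 (‖ξ‖ • p.1) * Complex.I))
      (μ.prod σ) := by
    refine Integrable.of_bound (C := 1) (by fun_prop) (Filter.Eventually.of_forall fun p => ?_)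
    rw [Complex.norm_exp_ofReal_mul_I]
  calc charFun ((μ.prod σ).map (fun p => ‖p.1‖ • p.2)) ξ
      = ∫ p, Complex.exp (inner ℝ (‖p.1‖ • p.2) ξ * Complex.I) ∂(μ.prod σ) := by
        rw [charFun_apply, integral_map hmeas.aemeasurable (by fun_prop)]
    _ = ∫ y, charFun σ (‖y‖ • ξ) ∂μ := by
        rw [integral_prod _ hint]
        simp only [charFun_apply, inner_smul_left, inner_smul_right, conj_trivial]
    _ = ∫ y, charFun σ (‖ξ‖ • y) ∂μ := by
        refine integral_congr_ae (Filter.Eventually.of_forall fun y => ?_)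
        exact charFun_eq_of_norm_eq hσ (by simp [norm_smul, mul_comm])
    _ = ∫ ω, charFun μ (‖ξ‖ • ω) ∂σ := by
        simp only [charFun_apply]
        rw [integral_integral_swap hint']
        simp only [inner_smul_right, real_inner_comm]
    _ = ∫ ω, charFun μ ξ ∂σ := by
        refine integral_congr_ae ?_
        filter_upwards [hσ1] with ω hω
        exact charFun_eq_of_norm_eq hμ (by simp [norm_smul, hω])
    _ = charFun μ ξ := by simp

open scoped ContDiff in
/-- A smooth, nonnegative, radial kernel of mass one supported in the closed unit ball. -/
structure IsRadialMollifier {E : Type*} [NormedAddCommGroup E] [InnerProductSpace ℝ E]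
    [FiniteDimensional ℝ E] [MeasurableSpace E] [BorelSpace E] (φ : E → ℝ) : Prop where
  contDiff : ContDiff ℝ ∞ φ
  nonneg : ∀ y, 0 ≤ φ y
  integral_eq_one : ∫ y, φ y = 1
  eq_zero : ∀ y, 1 < ‖y‖ → φ y = 0
  radial : ∀ y z, ‖y‖ = ‖z‖ → φ y = φ z

/-- The average of `y ↦ V (x - h y)` against the kernel `ψ`. -/
noncomputable def mollify {E F : Type*} [NormedAddCommGroup E] [InnerProductSpace ℝ E]
    [FiniteDimensional ℝ E] [MeasurableSpace E] [BorelSpace E] [NormedAddCommGroup F]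
    [NormedSpace ℝ F] (ψ : E → F) (h : ℝ) (V : E → ℝ) (x : E) : F :=
  ∫ y, V (x - h • y) • ψ y

theorem hasCompactSupport_of_eq_zero {E F : Type*} [NormedAddCommGroup E] [InnerProductSpace ℝ E]
    [FiniteDimensional ℝ E] [NormedAddCommGroup F] {ψ : E → F} (h : ∀ y, 1 < ‖y‖ → ψ y = 0) :
    HasCompactSupport ψ := by
  refine HasCompactSupport.intro (isCompact_closedBall (0 : E) 1) fun y hy => h y ?_
  simpa using hy

section

variable {E : Type*} [NormedAddCommGroup E] [InnerProductSpace ℝ E] [FiniteDimensional ℝ E]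
  [MeasurableSpace E] [BorelSpace E] {F : Type*} [NormedAddCommGroup F] [NormedSpace ℝ F]

theorem exists_isRadialMollifier (E : Type*) [NormedAddCommGroup E] [InnerProductSpace ℝ E]
    [FiniteDimensional ℝ E] [MeasurableSpace E] [BorelSpace E] :
    ∃ φ : E → ℝ, IsRadialMollifier φ := by
  set f : E → ℝ := fun y => Real.smoothTransition (1 - ‖y‖ ^ 2) with hf
  have hsmooth : ContDiff ℝ (⊤ : ℕ∞) f :=
    Real.smoothTransition.contDiff.comp (contDiff_const.sub (contDiff_norm_sq ℝ))
  have hzero : ∀ y, 1 < ‖y‖ → f y = 0 := fun y hy =>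
    Real.smoothTransition.zero_of_nonpos (by nlinarith)
  have hpos : 0 < ∫ y, f y := by
    refine Continuous.integral_pos_of_hasCompactSupport_nonneg_nonzero (x := 0) hsmooth.continuous
      (hasCompactSupport_of_eq_zero hzero) (fun y => Real.smoothTransition.nonneg _) ?_
    simp [hf]
  refine ⟨fun y => (∫ y, f y)⁻¹ * f y, contDiff_const.mul hsmooth, fun y => ?_, ?_, fun y hy => ?_,
    fun y z hyz => ?_⟩
  · exact mul_nonneg (inv_nonneg.2 hpos.le) (Real.smoothTransition.nonneg _)
  · rw [integral_const_mul, inv_mul_cancel₀ hpos.ne']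
  · rw [hzero y hy, mul_zero]
  · simp only [hf, hyz]

theorem hasFDerivAt_mollify {ψ : E → F} (hψ : ContDiff ℝ 1 ψ) (hψc : HasCompactSupport ψ)
    {V : E → ℝ} {K : ℝ} (hV : Measurable V) (hVK : ∀ x, |V x| ≤ K) {h : ℝ} (hh : h ≠ 0) (x : E) :
    HasFDerivAt (mollify ψ h V) (h⁻¹ • mollify (fderiv ℝ ψ) h V x) x := by
  set f : E → ℝ := fun y => V (h • y) with hf
  have hfm : Measurable f := by fun_prop
  have hfl : LocallyIntegrable f (volume : Measure E) := by
    refine (locallyIntegrable_const K).mono hfm.aestronglyMeasurable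
      (Filter.Eventually.of_forall fun y => ?_)
    exact (hVK _).trans (le_abs_self K)
  have hconv := hψc.hasFDerivAt_convolution_right (μ := volume) (ContinuousLinearMap.lsmul ℝ ℝ) hfl
    hψ (h⁻¹ • x)
  have hlin : HasFDerivAt (fun z : E => h⁻¹ • z) (h⁻¹ • ContinuousLinearMap.id ℝ E) x :=
    (hasFDerivAt_id x).const_smul h⁻¹
  have hcomp := hconv.comp x hlin
  have harg : ∀ z y : E, h • (h⁻¹ • z - y) = z - h • y := fun z y => by
    rw [smul_sub, smul_inv_smul₀ hh]
  convert hcomp using 1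
  · ext z
    simp [mollify, convolution_eq_swap, hf, harg]
  · have : convolution f (fderiv ℝ ψ) ((ContinuousLinearMap.lsmul ℝ ℝ).precompR E) volume (h⁻¹ • x)
        = mollify (fderiv ℝ ψ) h V x := by
      rw [convolution_eq_swap, mollify]
      refine integral_congr_ae (Filter.Eventually.of_forall fun y => ?_)
      ext w
      simp [hf, harg, ContinuousLinearMap.precompR_apply]
    rw [this]
    ext w
    simp

theorem norm_mollify_le {ψ : E → F} (hψ : Continuous ψ) (hψ0 : ∀ y, 1 < ‖y‖ → ψ y = 0) {V : E → ℝ}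
    {h S : ℝ} {x : E} (hS : ∀ y, ‖y‖ ≤ 1 → |V (x - h • y)| ≤ S) :
    ‖mollify ψ h V x‖ ≤ (∫ y, ‖ψ y‖) * S := by
  rw [← integral_mul_const]
  refine norm_integral_le_of_norm_le ?_ (Filter.Eventually.of_forall fun y => ?_)
  · exact (hψ.norm.integrable_of_hasCompactSupport
      (hasCompactSupport_of_eq_zero hψ0).norm).mul_const S
  · rw [norm_smul, mul_comm]
    rcases le_or_gt ‖y‖ 1 with hy | hy
    · exact mul_le_mul_of_nonneg_left (hS y hy) (norm_nonneg _)
    · simp [hψ0 y hy]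

theorem integrable_smul_of_bounded {ψ : E → F} (hψ : Continuous ψ) (hψ0 : ∀ y, 1 < ‖y‖ → ψ y = 0)
    {g : E → ℝ} {K : ℝ} (hg : Measurable g) (hgK : ∀ x, |g x| ≤ K) :
    Integrable fun y => g y • ψ y :=
  (hψ.integrable_of_hasCompactSupport (hasCompactSupport_of_eq_zero hψ0)).bdd_smul K
    hg.aestronglyMeasurable (Filter.Eventually.of_forall hgK)

theorem mollify_sub {ψ : E → F} (hψ : Continuous ψ) (hψ0 : ∀ y, 1 < ‖y‖ → ψ y = 0)
    {f g : E → ℝ} {K L : ℝ} (hf : Measurable f) (hfK : ∀ x, |f x| ≤ K) (hg : Measurable g)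
    (hgL : ∀ x, |g x| ≤ L) (h : ℝ) (x : E) :
    mollify ψ h (f - g) x = mollify ψ h f x - mollify ψ h g x := by
  simp only [mollify, Pi.sub_apply, sub_smul]
  exact integral_sub
    (integrable_smul_of_bounded hψ hψ0 (hf.comp (by fun_prop)) fun y => hfK _)
    (integrable_smul_of_bounded hψ hψ0 (hg.comp (by fun_prop)) fun y => hgL _)

theorem mollify_comm {φ : E → ℝ} (hφ : Continuous φ) (hφ0 : ∀ y, 1 < ‖y‖ → φ y = 0)
    {V : E → ℝ} {K : ℝ} (hV : Measurable V) (hVK : ∀ x, |V x| ≤ K) (h h' : ℝ) (x : E) :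
    mollify φ h (mollify φ h' V) x = mollify φ h' (mollify φ h V) x := by
  have hφi : Integrable φ := hφ.integrable_of_hasCompactSupport (hasCompactSupport_of_eq_zero hφ0)
  have hint : Integrable (fun p : E × E => V (x - h • p.1 - h' • p.2) • (φ p.1 * φ p.2))
      (volume.prod volume) :=
    (hφi.mul_prod hφi).bdd_smul K (hV.comp (by fun_prop)).aestronglyMeasurable
      (Filter.Eventually.of_forall fun p => hVK _)
  calc mollify φ h (mollify φ h' V) x
      = ∫ y, ∫ z, V (x - h • y - h' • z) • (φ y * φ z) := by
        simp only [mollify, smul_eq_mul, ← integral_mul_const]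
        simp only [mul_assoc, mul_comm]
    _ = ∫ z, ∫ y, V (x - h • y - h' • z) • (φ y * φ z) := integral_integral_swap hint
    _ = mollify φ h' (mollify φ h V) x := by
        simp only [mollify, smul_eq_mul, ← integral_mul_const]
        simp only [mul_assoc, sub_right_comm]

theorem abs_mollify_sub_le_of_sphere_mean {φ : E → ℝ} (hφ : IsRadialMollifier φ) {σ : Measure E}
    [IsProbabilityMeasure σ] (hσ : ∀ R : E ≃ₗᵢ[ℝ] E, σ.map R = σ) (hσ1 : ∀ᵐ ω ∂σ, ‖ω‖ = 1)
    {V : E → ℝ} {K : ℝ} (hV : Measurable V) (hVK : ∀ x, |V x| ≤ K) {A t β h : ℝ} (hA : 0 ≤ A)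
    (hβ : 0 ≤ β) {x : E} (hx : ∀ s, 0 < s → s ≤ t → |(∫ ω, V (x + s • ω) ∂σ) - V x| ≤ A * s ^ β)
    (hh : 0 < h) (hht : h ≤ t) : |mollify φ h V x - V x| ≤ A * h ^ β := by
  have hφc := hφ.contDiff.continuous
  have hφi : Integrable φ :=
    hφc.integrable_of_hasCompactSupport (hasCompactSupport_of_eq_zero hφ.eq_zero)
  set μ : Measure E := volume.withDensity fun y => ENNReal.ofReal (φ y) with hμ
  have hμ1 : IsProbabilityMeasure μ := by
    refine ⟨?_⟩
    rw [hμ, withDensity_apply _ MeasurableSet.univ, Measure.restrict_univ,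
      ← ofReal_integral_eq_lintegral_ofReal hφi (Filter.Eventually.of_forall hφ.nonneg),
      hφ.integral_eq_one, ENNReal.ofReal_one]
  have hμR : ∀ R : E ≃ₗᵢ[ℝ] E, μ.map R = μ := by
    intro R
    have hemb : MeasurableEmbedding R := R.toHomeomorph.measurableEmbedding
    ext s hs
    rw [hemb.map_apply, hμ, withDensity_apply _ hs, withDensity_apply _ (hemb.measurable hs),
      ← R.measurePreserving.setLIntegral_comp_preimage_emb hemb _ s]
    refine lintegral_congr fun y => ?_
    rw [hφ.radial (R y) y (R.norm_map y)]
  have hint : ∀ g : E → ℝ, ∫ y, g y ∂μ = ∫ y, g y * φ y := by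
    intro g
    rw [hμ, integral_withDensity_eq_integral_toReal_smul (by fun_prop) (by simp)]
    refine integral_congr_ae (Filter.Eventually.of_forall fun y => ?_)
    simp [ENNReal.toReal_ofReal (hφ.nonneg y), mul_comm]
  have hmean : ∀ s : ℝ, ∫ ω, V (x - s • ω) ∂σ = ∫ ω, V (x + s • ω) ∂σ := by
    intro s
    have hemb : MeasurableEmbedding (LinearIsometryEquiv.neg ℝ : E ≃ₗᵢ[ℝ] E) :=
      (LinearIsometryEquiv.neg ℝ : E ≃ₗᵢ[ℝ] E).toHomeomorph.measurableEmbedding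
    conv_rhs => rw [← hσ (LinearIsometryEquiv.neg ℝ), hemb.integral_map]
    simp [sub_eq_add_neg]
  have hbd : ∀ {X : Type _} [MeasurableSpace X] (ν : Measure X) [IsFiniteMeasure ν] (u : X → E),
      Measurable u → Integrable (fun p => V (u p)) ν := fun ν _ u hu =>
    Integrable.of_bound (hV.comp hu).aestronglyMeasurable K
      (Filter.Eventually.of_forall fun p => hVK _)
  have hmol : mollify φ h V x = ∫ y, ∫ ω, V (x + (h * ‖y‖) • ω) ∂σ ∂μ := by
    calc mollify φ h V x = ∫ y, V (x - h • y) ∂μ := by simp [mollify, hint]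
      _ = ∫ p, V (x - h • (‖p.1‖ • p.2)) ∂(μ.prod σ) := by
        conv_lhs => rw [← map_norm_smul_prod_eq hμR hσ hσ1]
        exact integral_map (by fun_prop) (hV.comp (by fun_prop)).aestronglyMeasurable
      _ = ∫ y, ∫ ω, V (x - h • (‖y‖ • ω)) ∂σ ∂μ :=
        integral_prod _ (hbd _ (fun p : E × E => x - h • (‖p.1‖ • p.2)) (by fun_prop))
      _ = _ := by simp only [smul_smul, hmean]
  have hinner : Integrable (fun y => ∫ ω, V (x + (h * ‖y‖) • ω) ∂σ) μ :=
    (hbd (μ.prod σ) (fun p : E × E => x + (h * ‖p.1‖) • p.2) (by fun_prop)).integral_prod_left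
  have hnorm : ∀ᵐ y ∂μ, ‖y‖ ≤ 1 := by
    rw [hμ, ae_withDensity_iff (by fun_prop)]
    refine Filter.Eventually.of_forall fun y hy => ?_
    by_contra hlt
    exact hy (by rw [hφ.eq_zero y (not_le.1 hlt), ENNReal.ofReal_zero])
  have hV1 : V x = ∫ _, V x ∂μ := by simp
  rw [hmol, hV1, ← integral_sub hinner (integrable_const _), ← Real.norm_eq_abs]
  refine (norm_integral_le_of_norm_le_const (C := A * h ^ β) ?_).trans (by simp)
  filter_upwards [hnorm] with y hy
  rcases (norm_nonneg y).eq_or_lt with h0 | h0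
  · simp only [← h0, mul_zero, zero_smul, add_zero, integral_const, probReal_univ, one_smul,
      sub_self, norm_zero]
    positivity
  · have hle : h * ‖y‖ ≤ h := mul_le_of_le_one_right hh.le hy
    refine (hx _ (by positivity) (hle.trans hht)).trans ?_
    gcongr

end

theorem exists_dyadic_near {h ρ : ℝ} (hρ : 0 < ρ) (hρh : ρ ≤ h) :
    ∃ k : ℕ, ρ ≤ h / 2 ^ k ∧ h / 2 ^ k ≤ 2 * ρ := by
  obtain ⟨k, hk1, hk2⟩ := exists_nat_pow_near ((one_le_div hρ).2 hρh) one_lt_two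
  refine ⟨k, ?_, ?_⟩
  · rw [le_div_iff₀ (by positivity)]
    rwa [le_div_iff₀ hρ, mul_comm] at hk1
  · rw [div_le_iff₀ (by positivity)]
    rw [div_lt_iff₀ hρ, pow_succ] at hk2
    linarith

open Filter Topology in
/-- A quantitative interpolation principle: a sequence converging geometrically at scale `h / 2 ^ k`
with at most geometrically growing Lipschitz constants has a Hölder continuous limit. -/
theorem exists_holder_limit_of_dyadic {α : ℝ} (hα0 : 0 < α) (hα1 : α < 1) :
    ∃ C : ℝ, 0 ≤ C ∧ ∀ {E F : Type*} [NormedAddCommGroup E] [NormedAddCommGroup F]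
      [CompleteSpace F] (U : Set E) (G : ℕ → E → F) (h a b c d : ℝ), 0 < h → 0 ≤ a → 0 ≤ b →
      0 ≤ c → 0 ≤ d →
      (∀ k, ∀ x ∈ U, ‖G (k + 1) x - G k x‖ ≤ a * (h / 2 ^ k) ^ α) →
      (∀ x ∈ U, ‖G 0 x‖ ≤ b * h ^ (-1 : ℝ)) →
      (∀ k, ∀ x ∈ U, ∀ y ∈ U, ‖(G (k + 1) x - G k x) - (G (k + 1) y - G k y)‖ ≤
        c * (h / 2 ^ k) ^ (α - 1) * ‖x - y‖) →
      (∀ x ∈ U, ∀ y ∈ U, ‖G 0 x - G 0 y‖ ≤ d * h ^ (-2 : ℝ) * ‖x - y‖) →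
      ∃ g : E → F, TendstoUniformlyOn G g atTop U ∧ ∀ x ∈ U, ∀ y ∈ U,
        ‖g x - g y‖ ≤ C * (a + c + (b + d) * h ^ (-(1 + α))) * ‖x - y‖ ^ α := by
  set q : ℝ := (2 : ℝ) ^ (-α) with hq
  set p : ℝ := (2 : ℝ) ^ (1 - α) with hp
  have hq0 : 0 < q := by positivity
  have hq1 : q < 1 := Real.rpow_lt_one_of_one_lt_of_neg one_lt_two (by linarith)
  have hp1 : 1 < p := Real.one_lt_rpow one_lt_two (by linarith)
  have hq2 : 0 < 1 - q := by linarith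
  have hp2 : 0 < p - 1 := by linarith
  refine ⟨4 / (1 - q) + 1 / (p - 1) + 2, by positivity, ?_⟩
  intro E F _ _ _ U G h a b c d hh ha hb hc hd hG hG0 hL hL0
  have hpowα : ∀ k : ℕ, (h / 2 ^ k) ^ α = h ^ α * q ^ k := fun k => by
    rw [Real.div_rpow hh.le (by positivity), hq, ← Real.rpow_natCast, ← Real.rpow_natCast,
      ← Real.rpow_mul two_pos.le, ← Real.rpow_mul two_pos.le, div_eq_mul_inv,
      ← Real.rpow_neg two_pos.le]
    ring_nf
  have hpow1 : ∀ k : ℕ, (h / 2 ^ (k + 1)) ^ (α - 1) = p * (h / 2 ^ k) ^ (α - 1) := fun k => by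
    have : h / 2 ^ (k + 1) = (h / 2 ^ k) * 2⁻¹ := by rw [pow_succ]; field_simp
    rw [this, Real.mul_rpow (by positivity) (by positivity), Real.inv_rpow two_pos.le,
      ← Real.rpow_neg two_pos.le, neg_sub, mul_comm]
  have hgeo : ∀ x ∈ U, ∀ k, dist (G k x) (G (k + 1) x) ≤ a * h ^ α * q ^ k := fun x hx k => by
    rw [dist_comm, dist_eq_norm, mul_assoc, ← hpowα]
    exact hG k x hx
  have hlim : ∀ x, ∃ l, x ∈ U → Tendsto (fun k => G k x) atTop (𝓝 l) := fun x => by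
    by_cases hx : x ∈ U
    · obtain ⟨l, hl⟩ := cauchySeq_tendsto_of_complete (cauchySeq_of_le_geometric _ _ hq1 (hgeo x hx))
      exact ⟨l, fun _ => hl⟩
    · exact ⟨0, fun h => absurd h hx⟩
  choose g hg using hlim
  have hdist : ∀ x ∈ U, ∀ k, ‖G k x - g x‖ ≤ a / (1 - q) * (h / 2 ^ k) ^ α := fun x hx k => by
    rw [← dist_eq_norm, hpowα]
    refine (dist_le_of_le_geometric_of_tendsto _ _ hq1 (hgeo x hx) (hg x hx) k).trans_eq ?_
    ring
  refine ⟨g, ?_, ?_⟩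
  · rw [Metric.tendstoUniformlyOn_iff]
    intro ε hε
    have hz : Tendsto (fun k : ℕ => a / (1 - q) * (h / 2 ^ k) ^ α) atTop (𝓝 0) := by
      simp only [hpowα]
      have := (tendsto_pow_atTop_nhds_zero_of_lt_one hq0.le hq1).const_mul (a / (1 - q) * h ^ α)
      simpa [mul_assoc] using this
    filter_upwards [hz.eventually (gt_mem_nhds hε)] with k hk x hx
    rw [dist_comm, dist_eq_norm]
    exact (hdist x hx k).trans_lt hk
  intro x hx y hy
  have hLip : ∀ k, ‖G k x - G k y‖ ≤
      (d * h ^ (-2 : ℝ) + c / (p - 1) * (h / 2 ^ k) ^ (α - 1)) * ‖x - y‖ := by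
    intro k
    induction k with
    | zero =>
      refine (hL0 x hx y hy).trans (mul_le_mul_of_nonneg_right ?_ (norm_nonneg _))
      have : 0 ≤ c / (p - 1) * (h / 2 ^ 0) ^ (α - 1) := by positivity
      linarith
    | succ k ih =>
      have hsplit : G (k + 1) x - G (k + 1) y =
          (G (k + 1) x - G k x - (G (k + 1) y - G k y)) + (G k x - G k y) := by abel
      rw [hsplit]
      refine (norm_add_le _ _).trans ((add_le_add (hL k x hx y hy) ih).trans_eq ?_)
      rw [hpow1]
      field_simp
      ring
  rcases eq_or_ne x y with rfl | hxy
  · simp only [sub_self, norm_zero]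
    rw [Real.zero_rpow hα0.ne', mul_zero]
  set ρ := ‖x - y‖ with hρdef
  have hρ : 0 < ρ := norm_pos_iff.2 (sub_ne_zero.2 hxy)
  have htri : ∀ k, ‖g x - g y‖ ≤ ‖G k x - G k y‖ + 2 * (a / (1 - q) * (h / 2 ^ k) ^ α) := by
    intro k
    have hsplit : g x - g y = (G k x - G k y) - (G k x - g x) + (G k y - g y) := by abel
    rw [hsplit]
    have h1 := norm_add_le ((G k x - G k y) - (G k x - g x)) (G k y - g y)
    have h2 := norm_sub_le (G k x - G k y) (G k x - g x)
    linarith [hdist x hx k, hdist y hy k]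
  set P := ρ ^ α with hP
  have hP0 : 0 < P := by positivity
  set H := h ^ (-(1 + α)) with hH
  have hH0 : 0 < H := by positivity
  have e1 : a / (1 - q) = a * (1 / (1 - q)) := by ring
  have e2 : c / (p - 1) = c * (1 / (p - 1)) := by ring
  have e3 : 4 / (1 - q) = 4 * (1 / (1 - q)) := by ring
  have hu : 0 < 1 / (1 - q) := by positivity
  have hw : 0 < 1 / (p - 1) := by positivity
  have hfinal : (4 * (1 / (1 - q)) * a + 1 / (p - 1) * c + (2 * b + d) * H) * P ≤
      (4 / (1 - q) + 1 / (p - 1) + 2) * (a + c + (b + d) * H) * P := by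
    refine mul_le_mul_of_nonneg_right ?_ hP0.le
    rw [e3]
    generalize 1 / (1 - q) = u at *
    generalize 1 / (p - 1) = w at *
    have : 0 ≤ w * a + 2 * a + 4 * u * c + 2 * c + (4 * u + w) * ((b + d) * H) + d * H := by
      positivity
    nlinarith
  refine le_trans ?_ hfinal
  rcases le_or_gt ρ h with hle | hgt
  · obtain ⟨k, hk1, hk2⟩ := exists_dyadic_near hρ hle
    have hkpos : 0 < h / 2 ^ k := by positivity
    have b1 : (h / 2 ^ k) ^ α ≤ 2 * P := by
      calc (h / 2 ^ k) ^ α ≤ (2 * ρ) ^ α := by gcongr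
        _ = 2 ^ α * P := Real.mul_rpow two_pos.le hρ.le
        _ ≤ 2 * P := by
          gcongr
          calc (2 : ℝ) ^ α ≤ 2 ^ (1 : ℝ) :=
                Real.rpow_le_rpow_of_exponent_le one_le_two hα1.le
            _ = 2 := Real.rpow_one 2
    have b2 : (h / 2 ^ k) ^ (α - 1) * ρ ≤ P := by
      calc (h / 2 ^ k) ^ (α - 1) * ρ ≤ ρ ^ (α - 1) * ρ := by
            refine mul_le_mul_of_nonneg_right ?_ hρ.le
            exact Real.rpow_le_rpow_of_nonpos hρ hk1 (by linarith)
        _ = P := by rw [Real.rpow_sub_one hρ.ne', div_mul_cancel₀ _ hρ.ne']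
    have b3 : h ^ (-2 : ℝ) * ρ ≤ H * P := by
      have h3 : ρ = ρ ^ (1 - α) * P := by
        rw [hP, ← Real.rpow_add hρ]; simp
      have h4 : H = h ^ (-2 : ℝ) * h ^ (1 - α) := by
        rw [hH, ← Real.rpow_add hh]; ring_nf
      calc h ^ (-2 : ℝ) * ρ = h ^ (-2 : ℝ) * (ρ ^ (1 - α) * P) := by rw [← h3]
        _ ≤ h ^ (-2 : ℝ) * (h ^ (1 - α) * P) := by
          gcongr
        _ = H * P := by rw [h4]; ring
    have h5 := htri k
    have h6 := hLip k
    rw [e1] at h5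
    rw [e2] at h6
    have t1 : 2 * (a * (1 / (1 - q)) * (h / 2 ^ k) ^ α) ≤ 2 * (a * (1 / (1 - q)) * (2 * P)) := by
      gcongr
    have t2 : c * (1 / (p - 1)) * ((h / 2 ^ k) ^ (α - 1) * ρ) ≤ c * (1 / (p - 1)) * P := by gcongr
    have t3 : d * (h ^ (-2 : ℝ) * ρ) ≤ d * (H * P) := by gcongr
    have t4 : 0 ≤ b * H * P := by positivity
    nlinarith
  · have h5 := htri 0
    have b0 : h ^ α ≤ P := by rw [hP]; gcongr
    have b1 : h ^ (-1 : ℝ) ≤ H * P := by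
      have : h ^ (-1 : ℝ) = H * h ^ α := by rw [hH, ← Real.rpow_add hh]; ring_nf
      rw [this]; gcongr
    have h6 := norm_sub_le (G 0 x) (G 0 y)
    have h7 := hG0 x hx
    have h8 := hG0 y hy
    rw [e1, pow_zero, div_one] at h5
    have t1 : 2 * (a * (1 / (1 - q)) * h ^ α) ≤ 2 * (a * (1 / (1 - q)) * P) := by gcongr
    have t2 : b * h ^ (-1 : ℝ) ≤ b * (H * P) := by gcongr
    have t3 : 0 ≤ d * H * P := by positivity
    have t4 : 0 ≤ a * (1 / (1 - q)) * P := by positivity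
    have t5 : 0 ≤ c * (1 / (p - 1)) * P := by positivity
    nlinarith

theorem fderiv_eq_zero_of_eq_zero {E F : Type*} [NormedAddCommGroup E] [NormedSpace ℝ E]
    [NormedAddCommGroup F] [NormedSpace ℝ F] {ψ : E → F}
    (hψ : ∀ y, 1 < ‖y‖ → ψ y = 0) : ∀ y, 1 < ‖y‖ → fderiv ℝ ψ y = 0 := by
  intro y hy
  have : ψ =ᶠ[nhds y] fun _ => 0 := by
    filter_upwards [continuous_norm.continuousAt.eventually (lt_mem_nhds hy)] with z hz
    exact hψ z hz
  rw [this.fderiv_eq]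
  simp

section

variable {E : Type*} [NormedAddCommGroup E] [InnerProductSpace ℝ E] [FiniteDimensional ℝ E]
  [MeasurableSpace E] [BorelSpace E]

/-- The gradient of `mollify φ s f`. -/
noncomputable def gradMollify (φ : E → ℝ) (s : ℝ) (f : E → ℝ) (x : E) : E →L[ℝ] ℝ :=
  s⁻¹ • mollify (fderiv ℝ φ) s f x

namespace IsRadialMollifier

variable {φ : E → ℝ}

theorem contDiff_fderiv (hφ : IsRadialMollifier φ) : ContDiff ℝ 1 (fderiv ℝ φ) :=
  hφ.contDiff.fderiv_right (by norm_cast)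

theorem contDiff_one (hφ : IsRadialMollifier φ) : ContDiff ℝ 1 φ := hφ.contDiff.of_le (by norm_cast)

theorem hasFDerivAt_mollify (hφ : IsRadialMollifier φ)
    {V : E → ℝ} {K : ℝ} (hV : Measurable V) (hVK : ∀ x, |V x| ≤ K) {s : ℝ}
    (hs : s ≠ 0) (x : E) : HasFDerivAt (mollify φ s V) (gradMollify φ s V x) x :=
  _root_.hasFDerivAt_mollify hφ.contDiff_one (hasCompactSupport_of_eq_zero hφ.eq_zero) hV hVK hs x

theorem measurable_mollify (hφ : IsRadialMollifier φ)
    {V : E → ℝ} {K : ℝ} (hV : Measurable V) (hVK : ∀ x, |V x| ≤ K) {s : ℝ}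
    (hs : s ≠ 0) : Measurable (mollify φ s V) :=
  (continuous_iff_continuousAt.2 fun x =>
    (hφ.hasFDerivAt_mollify hV hVK hs x).continuousAt).measurable

theorem abs_mollify_le (hφ : IsRadialMollifier φ)
    {V : E → ℝ} {K : ℝ} (hVK : ∀ x, |V x| ≤ K) (s : ℝ) (x : E) :
    |mollify φ s V x| ≤ (∫ y, ‖φ y‖) * K :=
  norm_mollify_le hφ.contDiff.continuous hφ.eq_zero fun _ _ => hVK _

theorem abs_sub_mollify_le (hφ : IsRadialMollifier φ)
    {V : E → ℝ} {K : ℝ} (hVK : ∀ x, |V x| ≤ K) (s : ℝ) (x : E) :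
    |(V - mollify φ s V) x| ≤ K + (∫ y, ‖φ y‖) * K :=
  (abs_sub _ _).trans (add_le_add (hVK x) (hφ.abs_mollify_le hVK s x))

theorem norm_gradMollify_le (hφ : IsRadialMollifier φ) {f : E → ℝ} {s S : ℝ} (hs : 0 < s) {x : E}
    (hS : ∀ y, ‖y‖ ≤ 1 → |f (x - s • y)| ≤ S) :
    ‖gradMollify φ s f x‖ ≤ s⁻¹ * ((∫ y, ‖fderiv ℝ φ y‖) * S) := by
  rw [gradMollify, norm_smul, Real.norm_of_nonneg (inv_nonneg.2 hs.le)]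
  exact mul_le_mul_of_nonneg_left (norm_mollify_le hφ.contDiff_fderiv.continuous
    (fderiv_eq_zero_of_eq_zero hφ.eq_zero) hS) (inv_nonneg.2 hs.le)

theorem hasFDerivAt_gradMollify (hφ : IsRadialMollifier φ)
    {V : E → ℝ} {K : ℝ} (hV : Measurable V) (hVK : ∀ x, |V x| ≤ K)
    {s : ℝ} (hs : s ≠ 0) (x : E) : HasFDerivAt (gradMollify φ s V)
      (s⁻¹ • s⁻¹ • mollify (fderiv ℝ (fderiv ℝ φ)) s V x) x :=
  (_root_.hasFDerivAt_mollify hφ.contDiff_fderiv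
    (hasCompactSupport_of_eq_zero (fderiv_eq_zero_of_eq_zero hφ.eq_zero)) hV hVK hs x).const_smul s⁻¹

theorem norm_gradMollify_sub_le (hφ : IsRadialMollifier φ)
    {f : E → ℝ} {K : ℝ} (hf : Measurable f) (hfK : ∀ x, |f x| ≤ K)
    {s S : ℝ} (hs : 0 < s) {U : Set E} (hU : Convex ℝ U)
    (hS : ∀ x ∈ U, ∀ y, ‖y‖ ≤ 1 → |f (x - s • y)| ≤ S) {x y : E} (hx : x ∈ U) (hy : y ∈ U) :
    ‖gradMollify φ s f x - gradMollify φ s f y‖ ≤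
      s⁻¹ * (s⁻¹ * ((∫ y, ‖fderiv ℝ (fderiv ℝ φ) y‖) * S)) * ‖x - y‖ := by
  refine hU.norm_image_sub_le_of_norm_hasFDerivWithin_le
    (fun z _ => (hφ.hasFDerivAt_gradMollify hf hfK hs.ne' z).hasFDerivWithinAt) (fun z hz => ?_) hy hx
  rw [norm_smul, norm_smul, Real.norm_of_nonneg (inv_nonneg.2 hs.le)]
  have := norm_mollify_le (hφ.contDiff_fderiv.continuous_fderiv one_ne_zero)
    (fderiv_eq_zero_of_eq_zero (fderiv_eq_zero_of_eq_zero hφ.eq_zero)) (hS z hz)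
  gcongr

theorem gradMollify_sub_eq (hφ : IsRadialMollifier φ)
    {V : E → ℝ} {K : ℝ} (hV : Measurable V) (hVK : ∀ x, |V x| ≤ K)
    {s s' : ℝ} (hs : s ≠ 0) (hs' : s' ≠ 0) (x : E) :
    gradMollify φ s' V x - gradMollify φ s V x =
      gradMollify φ s' (V - mollify φ s V) x - gradMollify φ s (V - mollify φ s' V) x := by
  have hc := hφ.contDiff.continuous
  have hfun : mollify φ s' V - mollify φ s V =
      mollify φ s' (V - mollify φ s V) - mollify φ s (V - mollify φ s' V) := by
    ext z
    simp only [Pi.sub_apply]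
    rw [mollify_sub hc hφ.eq_zero hV hVK (hφ.measurable_mollify hV hVK hs)
        (hφ.abs_mollify_le hVK s),
      mollify_sub hc hφ.eq_zero hV hVK (hφ.measurable_mollify hV hVK hs')
        (hφ.abs_mollify_le hVK s'), mollify_comm hc hφ.eq_zero hV hVK s s']
    ring
  have h1 := (hφ.hasFDerivAt_mollify hV hVK hs' x).sub (hφ.hasFDerivAt_mollify hV hVK hs x)
  have h2 := (hφ.hasFDerivAt_mollify (hV.sub (hφ.measurable_mollify hV hVK hs))
    (hφ.abs_sub_mollify_le hVK s) hs' x).sub (hφ.hasFDerivAt_mollify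
      (hV.sub (hφ.measurable_mollify hV hVK hs')) (hφ.abs_sub_mollify_le hVK s') hs x)
  rw [← hfun] at h2
  exact h1.unique h2

open Filter Topology in
/-- If mollification at every scale `s ≤ h` moves `V` by at most `A s ^ (1 + α)`, then `V` is
continuously differentiable with Hölder gradient. -/
theorem exists_hasFDerivAt_of_abs_mollify_sub_le (hφ : IsRadialMollifier φ)
    {α : ℝ} (hα0 : 0 < α) (hα1 : α < 1) :
    ∃ C : ℝ, 0 ≤ C ∧ ∀ (V : E → ℝ) (K A h : ℝ) (U D : Set E), Measurable V → (∀ x, |V x| ≤ K) →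
      0 < h → 0 ≤ A → IsOpen U → Convex ℝ U →
      (∀ x ∈ U, ∀ y, ‖y‖ ≤ 1 → ∀ s, 0 < s → s ≤ h → x - s • y ∈ D) →
      (∀ x ∈ D, ∀ s, 0 < s → s ≤ h → |mollify φ s V x - V x| ≤ A * s ^ (1 + α)) →
      ∃ g : E → E →L[ℝ] ℝ, (∀ x ∈ U, HasFDerivAt V (g x) x) ∧ ∀ x ∈ U, ∀ y ∈ U,
        ‖g x - g y‖ ≤ C * (A + K * h ^ (-(1 + α))) * ‖x - y‖ ^ α := by
  obtain ⟨C₀, hC₀, hlim⟩ := exists_holder_limit_of_dyadic hα0 hα1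
  set C₁ : ℝ := ∫ y, ‖fderiv ℝ φ y‖ with hC₁def
  set C₂ : ℝ := ∫ y, ‖fderiv ℝ (fderiv ℝ φ) y‖ with hC₂def
  have hC₁ : 0 ≤ C₁ := integral_nonneg fun y => norm_nonneg (fderiv ℝ φ y)
  have hC₂ : 0 ≤ C₂ := integral_nonneg fun y => norm_nonneg (fderiv ℝ (fderiv ℝ φ) y)
  refine ⟨C₀ * (3 * C₁ + 5 * C₂), by positivity, ?_⟩
  intro V K A h U D hV hVK hh hA hUo hUc hUD hD
  have hK : 0 ≤ K := (abs_nonneg _).trans (hVK 0)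
  set s : ℕ → ℝ := fun k => h / 2 ^ k with hsdef
  have hs : ∀ k, 0 < s k := fun k => by positivity
  have hsh : ∀ k, s k ≤ h := fun k => div_le_self hh.le (one_le_pow₀ one_le_two)
  have hsucc : ∀ k, s (k + 1) = s k / 2 := fun k => by
    simp only [hsdef, pow_succ]; field_simp
  have hinv : ∀ k, (s (k + 1))⁻¹ = 2 * (s k)⁻¹ := fun k => by
    rw [hsucc, inv_div]; field_simp
  have hmono : ∀ k, s (k + 1) ^ (1 + α) ≤ s k ^ (1 + α) := fun k => by
    have := hs k
    rw [hsucc]; gcongr; linarith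
  have hp1 : ∀ k, (s k)⁻¹ * s k ^ (1 + α) = s k ^ α := fun k => by
    rw [Real.rpow_add (hs k), Real.rpow_one, inv_mul_cancel_left₀ (hs k).ne']
  have hp2 : ∀ k, (s k)⁻¹ * s k ^ α = s k ^ (α - 1) := fun k => by
    rw [Real.rpow_sub_one (hs k).ne']; ring
  have happ : ∀ k, ∀ σ, 0 < σ → σ ≤ h → ∀ x ∈ U, ∀ y, ‖y‖ ≤ 1 →
      |(V - mollify φ (s k) V) (x - σ • y)| ≤ A * s k ^ (1 + α) := by
    intro k σ hσ hσh x hx y hy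
    rw [Pi.sub_apply, abs_sub_comm]
    exact hD _ (hUD x hx y hy σ hσ hσh) _ (hs k) (hsh k)
  have hfm : ∀ k, Measurable (V - mollify φ (s k) V) := fun k =>
    hV.sub (hφ.measurable_mollify hV hVK (hs k).ne')
  have hgrad : ∀ k, ∀ x ∈ U, ‖gradMollify φ (s (k + 1)) V x - gradMollify φ (s k) V x‖ ≤
      3 * C₁ * A * s k ^ α := by
    intro k x hx
    rw [hφ.gradMollify_sub_eq hV hVK (hs k).ne' (hs (k + 1)).ne']
    have h1 := hφ.norm_gradMollify_le (hs (k + 1)) (happ k _ (hs (k + 1)) (hsh _) x hx)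
    have h2 := hφ.norm_gradMollify_le (hs k) (happ (k + 1) _ (hs k) (hsh _) x hx)
    have h3 : (s k)⁻¹ * (C₁ * (A * s (k + 1) ^ (1 + α))) ≤
        (s k)⁻¹ * (C₁ * (A * s k ^ (1 + α))) := by
      have := (inv_pos.2 (hs k)).le
      have := hmono k
      gcongr
    rw [← hC₁def] at h1 h2
    rw [hinv] at h1
    rw [← hp1]
    linarith [norm_sub_le (gradMollify φ (s (k + 1)) (V - mollify φ (s k) V) x)
      (gradMollify φ (s k) (V - mollify φ (s (k + 1)) V) x)]
  have hlip : ∀ k, ∀ x ∈ U, ∀ y ∈ U,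
      ‖(gradMollify φ (s (k + 1)) V x - gradMollify φ (s k) V x) -
        (gradMollify φ (s (k + 1)) V y - gradMollify φ (s k) V y)‖ ≤
      5 * C₂ * A * s k ^ (α - 1) * ‖x - y‖ := by
    intro k x hx y hy
    rw [hφ.gradMollify_sub_eq hV hVK (hs k).ne' (hs (k + 1)).ne',
      hφ.gradMollify_sub_eq hV hVK (hs k).ne' (hs (k + 1)).ne', sub_sub_sub_comm]
    have h1 := hφ.norm_gradMollify_sub_le (hfm k) (hφ.abs_sub_mollify_le hVK (s k)) (hs (k + 1)) hUc
      (happ k _ (hs (k + 1)) (hsh _)) hx hy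
    have h2 := hφ.norm_gradMollify_sub_le (hfm (k + 1)) (hφ.abs_sub_mollify_le hVK (s (k + 1)))
      (hs k) hUc (happ (k + 1) _ (hs k) (hsh _)) hx hy
    have h3 : (s k)⁻¹ * ((s k)⁻¹ * (C₂ * (A * s (k + 1) ^ (1 + α)))) * ‖x - y‖ ≤
        (s k)⁻¹ * ((s k)⁻¹ * (C₂ * (A * s k ^ (1 + α)))) * ‖x - y‖ := by
      have := (inv_pos.2 (hs k)).le
      have := hmono k
      gcongr
    rw [← hC₂def] at h1 h2
    rw [hinv] at h1
    rw [← hp2, ← hp1]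
    refine (norm_sub_le _ _).trans ?_
    linarith
  have hzero : s 0 = h := by simp [hsdef]
  obtain ⟨g, hg, hgh⟩ := hlim U (fun k => gradMollify φ (s k) V) h (3 * C₁ * A) (C₁ * K)
    (5 * C₂ * A) (C₂ * K) hh (by positivity) (by positivity) (by positivity) (by positivity) hgrad
    (fun x hx => by
      have := hφ.norm_gradMollify_le (x := x) (hs 0) fun y _ => hVK (x - s 0 • y)
      rw [hzero] at this
      simp only [hzero]
      rw [Real.rpow_neg_one]
      linarith)
    hlip
    (fun x hx y hy => by
      have := hφ.norm_gradMollify_sub_le hV hVK (hs 0) hUc (fun x _ y _ => hVK (x - s 0 • y)) hx hy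
      rw [hzero] at this
      simp only [hzero]
      rw [Real.rpow_neg hh.le, Real.rpow_two, sq, mul_inv]
      linarith)
  refine ⟨g, fun x hx => ?_, fun x hx y hy => (hgh x hx y hy).trans ?_⟩
  · refine hasFDerivAt_of_tendstoUniformlyOn hUo hg
      (fun k z _ => hφ.hasFDerivAt_mollify hV hVK (hs k).ne' z) (fun z hz => ?_) hx
    have hzD : z ∈ D := by simpa using hUD z hz 0 (by simp) h hh le_rfl
    have hs0 : Tendsto s atTop (𝓝 0) := by
      have := (tendsto_pow_atTop_nhds_zero_of_lt_one (r := (2 : ℝ)⁻¹) (by norm_num)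
        (by norm_num)).const_mul h
      simpa [hsdef, div_eq_mul_inv] using this
    have hpow : Tendsto (fun k => A * s k ^ (1 + α)) atTop (𝓝 0) := by
      have := (hs0.rpow_const (p := 1 + α) (Or.inr (by linarith))).const_mul A
      rwa [Real.zero_rpow (by linarith), mul_zero] at this
    rw [tendsto_iff_norm_sub_tendsto_zero]
    exact squeeze_zero (fun _ => norm_nonneg _) (fun k => hD z hzD _ (hs k) (hsh k)) hpow
  · have hH : 0 ≤ h ^ (-(1 + α)) := by positivity
    generalize h ^ (-(1 + α)) = H at *
    have hle : 3 * C₁ * A + 5 * C₂ * A + (C₁ * K + C₂ * K) * H ≤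
        (3 * C₁ + 5 * C₂) * (A + K * H) := by
      have : 0 ≤ 2 * C₁ * (K * H) + 4 * C₂ * (K * H) := by positivity
      linarith
    rw [mul_assoc C₀ (3 * C₁ + 5 * C₂)]
    gcongr

end IsRadialMollifier

end

/-- Interior Hölder estimate for the gradient of a bounded function satisfying the approximate mean
value property, at distance `δ / 2` from the boundary. -/
theorem exists_hasFDerivAt_of_sphereAvg (m : ℕ) {α : ℝ} (hα0 : 0 < α) (hα1 : α < 1) :
    ∃ C : ℝ, 0 ≤ C ∧ ∀ r t δ : ℝ, 0 < t → t ≤ r → 0 < δ → δ ≤ r →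
      ∀ (v : EuclideanSpace ℝ (Fin (m + 1)) → ℝ) (A K : ℝ), 0 ≤ A →
      ContinuousOn v (ball 0 (r + t)) →
      (∀ x ∈ ball (0 : EuclideanSpace ℝ (Fin (m + 1))) r, ∀ h : ℝ, 0 < h → h ≤ t →
        |sphereAvg (m + 1) v x h - v x| ≤ A * h ^ (1 + α)) →
      (∀ z ∈ ball (0 : EuclideanSpace ℝ (Fin (m + 1))) (r + t), |v z| ≤ K) →
      ∃ g : EuclideanSpace ℝ (Fin (m + 1)) → EuclideanSpace ℝ (Fin (m + 1)) →L[ℝ] ℝ,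
        (∀ x ∈ ball 0 (r - δ / 2), HasFDerivAt v (g x) x) ∧
        ∀ x ∈ ball 0 (r - δ / 2), ∀ y ∈ ball 0 (r - δ / 2), ‖g x - g y‖ ≤
          C * (A + K * (t * δ / (2 * r)) ^ (-(1 + α))) * ‖x - y‖ ^ α := by
  obtain ⟨φ, hφ⟩ := exists_isRadialMollifier (EuclideanSpace ℝ (Fin (m + 1)))
  obtain ⟨C, hC, hmain⟩ := hφ.exists_hasFDerivAt_of_abs_mollify_sub_le hα0 hα1
  refine ⟨C, hC, ?_⟩
  intro r t δ ht htr hδ hδr v A K hA hcont hmean hK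
  classical
  have hr : 0 < r := ht.trans_le htr
  set B := ball (0 : EuclideanSpace ℝ (Fin (m + 1))) (r + t) with hB
  set V := B.indicator v with hV
  have hVm : Measurable V := by
    rw [hV, ← piecewise_eq_indicator]
    exact hcont.measurable_piecewise continuousOn_const isOpen_ball.measurableSet
  have hVK : ∀ x, |V x| ≤ K := fun x => by
    by_cases hx : x ∈ B
    · rw [hV, indicator_of_mem hx]; exact hK x hx
    · rw [hV, indicator_of_notMem hx, abs_zero]
      exact (abs_nonneg _).trans (hK 0 (mem_ball_self (by positivity)))
  have hrB : ∀ x ∈ ball (0 : EuclideanSpace ℝ (Fin (m + 1))) r, V x = v x := fun x hx =>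
    indicator_of_mem (ball_subset_ball (by linarith) hx) v
  set h₀ := t * δ / (2 * r) with hh₀
  have hh₀pos : 0 < h₀ := by positivity
  have hh₀t : h₀ ≤ t := by
    rw [hh₀, div_le_iff₀ (by positivity)]; nlinarith
  have hh₀δ : h₀ ≤ δ / 2 := by
    rw [hh₀, div_le_iff₀ (by positivity)]; nlinarith
  obtain ⟨g, hg, hgα⟩ := hmain V K A h₀ (ball 0 (r - δ / 2)) (ball 0 r) hVm hVK hh₀pos hA
    isOpen_ball (convex_ball _ _)
    (fun x hx y hy s hs hsh => by
      rw [mem_ball_zero_iff] at hx ⊢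
      have h1 := norm_sub_le x (s • y)
      have h2 : ‖s • y‖ ≤ s := by
        rw [norm_smul, Real.norm_of_nonneg hs.le]
        exact mul_le_of_le_one_right hs.le hy
      linarith)
    (fun x hx s hs hsh => by
      refine abs_mollify_sub_le_of_sphere_mean hφ (map_unitSphereMeasure m)
        (ae_norm_eq_one_unitSphereMeasure m) hVm hVK hA (by linarith) (t := t)
        (fun s hs hst => ?_) hs (hsh.trans hh₀t)
      have heq : ∫ ω, V (x + s • ω) ∂unitSphereMeasure m = sphereAvg (m + 1) v x s := by
        rw [sphereAvg_eq_integral_unitSphereMeasure m v x hs]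
        refine integral_congr_ae ?_
        filter_upwards [ae_norm_eq_one_unitSphereMeasure m] with ω hω
        refine indicator_of_mem ?_ v
        rw [hB, mem_ball_zero_iff]
        rw [mem_ball_zero_iff] at hx
        have h1 := norm_add_le x (s • ω)
        rw [norm_smul, Real.norm_of_nonneg hs.le, hω] at h1
        linarith
      rw [heq, hrB x hx]
      exact hmean x hx s hs hst)
  refine ⟨g, fun x hx => (hg x hx).congr_of_eventuallyEq ?_, hgα⟩
  filter_upwards [isOpen_ball.mem_nhds hx] with z hz
  exact (hrB z (ball_subset_ball (by linarith) hz)).symm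

theorem infDist_compl_ball_le {E : Type*} [NormedAddCommGroup E] [NormedSpace ℝ E] [Nontrivial E]
    {r : ℝ} (x : E) (hx : x ∈ ball (0 : E) r) :
    infDist x (ball (0 : E) r)ᶜ ≤ r - ‖x‖ := by
  obtain ⟨u, hu, hxu⟩ : ∃ u : E, ‖u‖ = 1 ∧ x = ‖x‖ • u := by
    rcases eq_or_ne x 0 with rfl | hx0
    · obtain ⟨u, hu⟩ := exists_norm_eq E zero_le_one
      exact ⟨u, hu, by simp⟩
    · exact ⟨‖x‖⁻¹ • x, by simp [norm_smul, hx0], by simp [smul_smul, hx0]⟩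
  have hmem : r • u ∈ (ball (0 : E) r)ᶜ := by
    simp [norm_smul, hu, le_abs_self]
  refine (infDist_le_dist_of_mem hmem).trans_eq ?_
  rw [mem_ball_zero_iff] at hx
  conv_lhs => rw [hxu]
  rw [dist_comm, dist_eq_norm, ← sub_smul, norm_smul, hu, mul_one, Real.norm_of_nonneg]
  linarith

/-- **From a mean value inequality to interior `C^{1,α}` regularity** (Lemma 3.2).
Let `r ≥ t > 0`, `α ∈ (0,1)` and `v ∈ C(B_{r+t}(0))` in `ℝⁿ`. If there is `A ≥ 0` with
`|⨍_{∂B_h(0)} v(x+y) dσ_y - v(x)| ≤ A h^{1+α}` for all `x ∈ B_r(0)`, `h ∈ (0,t]`,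
then `v ∈ C^{1,α}(B_r(0))` and
`[v]^*_{1,α;B_r(0)} ≤ C(n,α) (r^{1+α} t^{-1-α} sup_{B_{r+t}}|v| + A r^{1+α})`.
The weighted seminorm bound is stated pointwise (with `d_x = infDist x (B_r)ᶜ`), and
`sup_{B_{r+t}}|v|` is expressed through an arbitrary upper bound `Kv`. -/
theorem mean_value_inequality_implies_C1alpha (n : ℕ) (α : ℝ) (hα0 : 0 < α) (hα1 : α < 1) :
    ∃ C : ℝ, ∀ r t : ℝ, 0 < t → t ≤ r →
      ∀ v : EuclideanSpace ℝ (Fin n) → ℝ, ∀ A : ℝ, 0 ≤ A →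
      ContinuousOn v (ball 0 (r + t)) →
      (∀ x ∈ ball (0 : EuclideanSpace ℝ (Fin n)) r, ∀ h : ℝ, 0 < h → h ≤ t →
        |sphereAvg n v x h - v x| ≤ A * h ^ (1 + α)) →
      -- v ∈ C^{1,α}(B_r(0)): v is C¹ on B_r(0) (the Hölder gradient bound follows
      -- quantitatively from the weighted seminorm estimate below)
      ((∀ x ∈ ball (0 : EuclideanSpace ℝ (Fin n)) r, DifferentiableAt ℝ v x) ∧
        ContDiffOn ℝ 1 v (ball 0 r)) ∧
      -- weighted seminorm estimate, stated pointwise: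
      ∀ Kv : ℝ,
      (∀ z ∈ ball (0 : EuclideanSpace ℝ (Fin n)) (r + t), |v z| ≤ Kv) →
      ∀ x ∈ ball (0 : EuclideanSpace ℝ (Fin n)) r,
      ∀ y ∈ ball (0 : EuclideanSpace ℝ (Fin n)) r,
        (min (infDist x (ball (0 : EuclideanSpace ℝ (Fin n)) r)ᶜ)
            (infDist y (ball (0 : EuclideanSpace ℝ (Fin n)) r)ᶜ)) ^ (1 + α) *
            ‖fderiv ℝ v x - fderiv ℝ v y‖ ≤
          C * (r ^ (1 + α) * t ^ (-(1 + α)) * Kv + A * r ^ (1 + α)) * ‖x - y‖ ^ α := by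
  rcases n with _ | m
  · refine ⟨0, fun r t _ _ v A _ _ _ => ⟨⟨fun x _ => ?_, ?_⟩, fun Kv _ x _ y _ => ?_⟩⟩
    · exact (hasFDerivAt_of_subsingleton v x).differentiableAt
    · rw [show v = fun _ => v 0 from funext fun x => congrArg v (Subsingleton.elim x 0)]
      exact contDiffOn_const
    · rw [Subsingleton.elim x y]
      simp
  obtain ⟨C, hC, hmain⟩ := exists_hasFDerivAt_of_sphereAvg m hα0 hα1
  refine ⟨C * 2 ^ (1 + α), ?_⟩
  intro r t ht htr v A hA hcont hmean
  have hr : 0 < r := ht.trans_le htr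
  have hreg : ∀ x ∈ ball (0 : EuclideanSpace ℝ (Fin (m + 1))) r,
      DifferentiableAt ℝ v x ∧ ContinuousAt (fderiv ℝ v) x := by
    intro x hx
    rw [mem_ball_zero_iff] at hx
    have hx0 := norm_nonneg x
    set r' := (r + ‖x‖) / 2 with hr'
    set t' := min t r' with ht'
    have hr'0 : 0 < r' := by positivity
    have ht'0 : 0 < t' := lt_min ht hr'0
    have ht't : t' ≤ t := min_le_left _ _
    have hsub : closedBall (0 : EuclideanSpace ℝ (Fin (m + 1))) (r' + t') ⊆ ball 0 (r + t) :=
      closedBall_subset_ball (by linarith)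
    obtain ⟨K, hK⟩ := (isCompact_closedBall _ _).exists_bound_of_continuousOn (hcont.mono hsub)
    obtain ⟨g, hg, hgα⟩ := hmain r' t' (r' - ‖x‖) ht'0 (min_le_right _ _) (by linarith)
      (by linarith) v A K hA (hcont.mono (ball_subset_closedBall.trans hsub))
      (fun z hz h hh hht => hmean z (ball_subset_ball (by linarith) hz) h hh (hht.trans ht't))
      (fun z hz => hK z (ball_subset_closedBall hz))
    have hxU : x ∈ ball (0 : EuclideanSpace ℝ (Fin (m + 1))) (r' - (r' - ‖x‖) / 2) := by
      rw [mem_ball_zero_iff]; linarith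
    refine ⟨(hg x hxU).differentiableAt, ?_⟩
    set M := C * (A + K * (t' * (r' - ‖x‖) / (2 * r')) ^ (-(1 + α)))
    have hlim : Filter.Tendsto (fun y => M * ‖y - x‖ ^ α) (nhds x) (nhds 0) := by
      have hc : Continuous fun y => M * ‖y - x‖ ^ α :=
        continuous_const.mul ((continuous_id.sub continuous_const).norm.rpow_const
          fun _ => Or.inr hα0.le)
      exact hc.tendsto' x 0 (by simp [Real.zero_rpow hα0.ne'])
    rw [ContinuousAt, tendsto_iff_norm_sub_tendsto_zero]
    refine squeeze_zero' (Filter.Eventually.of_forall fun _ => norm_nonneg _) ?_ hlim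
    filter_upwards [isOpen_ball.mem_nhds hxU] with y hy
    rw [(hg y hy).fderiv, (hg x hxU).fderiv]
    exact hgα y hy x hxU
  refine ⟨⟨fun x hx => (hreg x hx).1, ?_⟩, ?_⟩
  · rw [← zero_add (1 : WithTop ℕ∞), contDiffOn_succ_iff_fderiv_of_isOpen isOpen_ball,
      contDiffOn_zero]
    exact ⟨fun x hx => (hreg x hx).1.differentiableWithinAt, by simp,
      fun x hx => (hreg x hx).2.continuousWithinAt⟩
  intro K hK x hx y hy
  have hK0 : 0 ≤ K := (abs_nonneg _).trans (hK 0 (mem_ball_self (by positivity)))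
  have hdx := infDist_compl_ball_le x hx
  have hdy := infDist_compl_ball_le y hy
  rw [mem_ball_zero_iff] at hx hy
  set δ := r - max ‖x‖ ‖y‖ with hδ
  have hδ0 : 0 < δ := sub_pos.2 (max_lt hx hy)
  have hxm := le_max_left ‖x‖ ‖y‖
  have hym := le_max_right ‖x‖ ‖y‖
  have hδr : δ ≤ r := by linarith [norm_nonneg x]
  have hmin : min (infDist x (ball (0 : EuclideanSpace ℝ (Fin (m + 1))) r)ᶜ)
      (infDist y (ball (0 : EuclideanSpace ℝ (Fin (m + 1))) r)ᶜ) ≤ δ := by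
    rw [hδ, ← min_sub_sub_left]
    exact min_le_min hdx hdy
  have hmin0 := le_min (infDist_nonneg (x := x) (s := (ball (0 : EuclideanSpace ℝ (Fin (m + 1))) r)ᶜ))
    (infDist_nonneg (x := y) (s := (ball (0 : EuclideanSpace ℝ (Fin (m + 1))) r)ᶜ))
  obtain ⟨g, hg, hgα⟩ := hmain r t δ ht htr hδ0 hδr v A K hA hcont hmean hK
  have hxU : x ∈ ball (0 : EuclideanSpace ℝ (Fin (m + 1))) (r - δ / 2) := by
    rw [mem_ball_zero_iff]; linarith
  have hyU : y ∈ ball (0 : EuclideanSpace ℝ (Fin (m + 1))) (r - δ / 2) := by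
    rw [mem_ball_zero_iff]; linarith
  rw [(hg x hxU).fderiv, (hg y hyU).fderiv]
  have h1α : 0 ≤ 1 + α := by linarith
  have hscale : δ ^ (1 + α) * (t * δ / (2 * r)) ^ (-(1 + α)) =
      2 ^ (1 + α) * (r ^ (1 + α) * t ^ (-(1 + α))) := by
    rw [Real.rpow_neg (by positivity), Real.rpow_neg ht.le, Real.div_rpow (by positivity)
      (by positivity), Real.mul_rpow ht.le hδ0.le, Real.mul_rpow two_pos.le hr.le]
    field_simp
  have hone : (1 : ℝ) ≤ 2 ^ (1 + α) := Real.one_le_rpow one_le_two h1α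
  have hA1 : A * δ ^ (1 + α) ≤ 2 ^ (1 + α) * (A * r ^ (1 + α)) := by
    calc A * δ ^ (1 + α) ≤ A * r ^ (1 + α) := by gcongr
      _ ≤ 2 ^ (1 + α) * (A * r ^ (1 + α)) := le_mul_of_one_le_left (by positivity) hone
  calc _ ≤ δ ^ (1 + α) * (C * (A + K * (t * δ / (2 * r)) ^ (-(1 + α))) * ‖x - y‖ ^ α) := by
        gcongr
        exact hgα x hxU y hyU
    _ = C * (A * δ ^ (1 + α) + K * (δ ^ (1 + α) * (t * δ / (2 * r)) ^ (-(1 + α)))) *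
          ‖x - y‖ ^ α := by ring
    _ ≤ C * (2 ^ (1 + α) * (A * r ^ (1 + α)) +
          K * (2 ^ (1 + α) * (r ^ (1 + α) * t ^ (-(1 + α))))) * ‖x - y‖ ^ α := by
        rw [hscale]; gcongr
    _ = _ := by ring
end
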